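/- Let (R,m) be a Noetherian local ring with d = dim R ≤ 2 and let C be a semidualizing R-module. Then the following are equivalent: (i) C is a dualizing R-module; (ii) H_m^d(R) is a C-injective R-module; (iii) H_m^d(R) is a G_C-injective R-module; (iv) H_a^d(M) is G_C-injective for all finitely generated R-modules M and all ideals a of R. -/

import Mathlib

/-!
Common definitions: semidualizing modules, `C`-injective modules and dimensions,
`G_C`-injective modules, Bass/Auslander classes, relative Cohen-Macaulayness,
Cohen-Macaulay and Gorenstein local rings, trivial extensions, ideal torsion.
-/

noncomputable section

open CategoryTheory TensorProduct

universe u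

variable (R : Type u) [CommRing R]

/-- An `R`-module `M` is `C`-injective if it is isomorphic to `Hom_R(C, I)`
for some injective `R`-module `I`. -/
def IsCInjective (C M : ModuleCat.{u} R) : Prop :=
  ∃ I : ModuleCat.{u} R, Module.Injective R I ∧ Nonempty (M ≃ₗ[R] (C →ₗ[R] I))

/-- `HasCoresDimLE R P n M` : the module `M` admits a coresolution of length at most `n`
by modules satisfying the property `P`. -/
def HasCoresDimLE (P : ModuleCat.{u} R → Prop) : ℕ → ModuleCat.{u} R → Prop
  | 0, M => Subsingleton M ∨ P M
  | n + 1, M => Subsingleton M ∨ ∃ (X : ModuleCat.{u} R) (f : M →ₗ[R] X),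
      P X ∧ Function.Injective f ∧
        HasCoresDimLE P n (ModuleCat.of R (X ⧸ LinearMap.range f))

/-- The coresolution dimension of `M` with respect to the class of modules satisfying `P`,
as an element of `ℕ∞` (`⊤` meaning no finite coresolution exists). -/
def coresDim (P : ModuleCat.{u} R → Prop) (M : ModuleCat.{u} R) : ℕ∞ :=
  sInf {d : ℕ∞ | ∃ n : ℕ, d = n ∧ HasCoresDimLE R P n M}

/-- The `C`-injective dimension of `M`. -/
def cinjDim (C M : ModuleCat.{u} R) : ℕ∞ :=
  coresDim R (IsCInjective R C) M

/-- The injective dimension of `M`. -/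
def injDim (M : ModuleCat.{u} R) : ℕ∞ :=
  coresDim R (fun N => Module.Injective R N) M

/-- A finitely generated `R`-module `C` is semidualizing if the natural map
`R → Hom_R(C,C)` is bijective and `Ext_R^i(C,C) = 0` for all `i ≥ 1`. -/
def IsSemidualizing (C : ModuleCat.{u} R) : Prop :=
  Module.Finite R C ∧ Function.Bijective (LinearMap.lsmul R C) ∧
    ∀ i : ℕ, 1 ≤ i →
      Subsingleton (((Ext R (ModuleCat.{u} R) i).obj (Opposite.op C)).obj C)

/-- A dualizing module is a semidualizing module of finite injective dimension. -/
def IsDualizing (C : ModuleCat.{u} R) : Prop :=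
  IsSemidualizing R C ∧ injDim R C ≠ ⊤

/-- A complete `I_C I`-resolution: an exact complex `Y` (with `d i : Y (i+1) → Y i`)
which stays exact after applying `Hom_R(I, -)` for every `C`-injective `I`, whose terms
in positive degrees are `C`-injective and whose terms in degrees `≤ 0` are injective. -/
structure CompleteICIResolution (C : ModuleCat.{u} R) where
  Y : ℤ → ModuleCat.{u} R
  d : (i : ℤ) → (Y (i + 1) →ₗ[R] Y i)
  exact : ∀ i : ℤ, Function.Exact (d (i + 1)) (d i)
  cinj_pos : ∀ i : ℤ, 0 < i → IsCInjective R C (Y i)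
  inj_nonpos : ∀ i : ℤ, i ≤ 0 → Module.Injective R (Y i)
  homExact : ∀ I : ModuleCat.{u} R, IsCInjective R C I → ∀ i : ℤ,
    Function.Exact (fun f : I →ₗ[R] Y (i + 1 + 1) => (d (i + 1)).comp f)
      (fun f : I →ₗ[R] Y (i + 1) => (d i).comp f)

/-- A module is `G_C`-injective if it is the kernel of the degree-`0` differential of some
complete `I_C I`-resolution. -/
def IsGCInjective (C M : ModuleCat.{u} R) : Prop :=
  ∃ res : CompleteICIResolution R C,
    Nonempty (M ≃ₗ[R] ↥(LinearMap.ker (res.d (-1))))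

/-- The `G_C`-injective dimension of `M`. -/
def gcinjDim (C M : ModuleCat.{u} R) : ℕ∞ :=
  coresDim R (IsGCInjective R C) M

/-- `M` is relative Cohen-Macaulay with respect to `a`: there is exactly one
non-vanishing local cohomology module of `M` with respect to `a`. -/
def IsRelativeCM (a : Ideal R) (M : ModuleCat.{u} R) : Prop :=
  ∃! n : ℕ, Nontrivial ((localCohomology a n).obj M)

/-- `M` is relative Cohen-Macaulay with respect to `a`, with (unique) non-vanishing
local cohomology in degree `n`. -/
def IsRelativeCMAt (a : Ideal R) (n : ℕ) (M : ModuleCat.{u} R) : Prop :=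
  Nontrivial ((localCohomology a n).obj M) ∧
    ∀ i : ℕ, i ≠ n → Subsingleton ((localCohomology a i).obj M)

/-- The cohomological dimension `cd(a, M)`: the largest `i` with `H_a^i(M) ≠ 0`. -/
def lcCohomDim (a : Ideal R) (M : ModuleCat.{u} R) : ℕ :=
  sSup {i : ℕ | Nontrivial ((localCohomology a i).obj M)}

/-- The grade `grade(a, M)`: the least `i` with `H_a^i(M) ≠ 0`. -/
def lcGrade (a : Ideal R) (M : ModuleCat.{u} R) : ℕ :=
  sInf {i : ℕ | Nontrivial ((localCohomology a i).obj M)}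

/-- A Noetherian local ring is Cohen-Macaulay iff `H_m^i(R) = 0` for all `i ≠ dim R`
(Grothendieck's characterization, taken here as the definition). -/
def IsCohenMacaulayLocalRing (S : Type u) [CommRing S] [IsLocalRing S] : Prop :=
  ∀ i : ℕ, (i : WithBot ℕ∞) ≠ ringKrullDim S →
    Subsingleton ((localCohomology (IsLocalRing.maximalIdeal S) i).obj (ModuleCat.of S S))

/-- A local ring is Gorenstein if it has finite injective dimension over itself. -/
def IsGorensteinLocalRing (S : Type u) [CommRing S] : Prop :=
  injDim S (ModuleCat.of S S) ≠ ⊤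

/-- The `a`-torsion submodule `Γ_a(M)` of `M`. -/
def idealTorsion (a : Ideal R) (M : Type u) [AddCommGroup M] [Module R M] :
    Submodule R M :=
  ⨆ n : ℕ, Submodule.torsionBySet R M ((a ^ n : Ideal R) : Set R)

/-- The Krull dimension of a module, `dim_S N = dim (S / ann_S N)`. -/
def moduleKrullDim (S : Type u) [CommRing S] (N : Type u) [AddCommGroup N] [Module S N] :
    WithBot ℕ∞ :=
  ringKrullDim (S ⧸ Module.annihilator S N)

/-- `ht_M(a) = inf { dim_{R_p} M_p  |  p ∈ Supp (M / a M) }`. -/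
def heightWRT (a : Ideal R) (M : Type u) [AddCommGroup M] [Module R M] : WithBot ℕ∞ :=
  ⨅ (p : PrimeSpectrum R) (_ : p ∈ Module.support R (M ⧸ (a • (⊤ : Submodule R M)))),
    moduleKrullDim (Localization.AtPrime p.asIdeal) (LocalizedModule p.asIdeal.primeCompl M)

/-- Membership in the Bass class `B_C(R)`. -/
def MemBassClass (C M : ModuleCat.{u} R) : Prop :=
  (∀ i : ℕ, 1 ≤ i →
      Subsingleton (((Ext R (ModuleCat.{u} R) i).obj (Opposite.op C)).obj M)) ∧
  (∀ i : ℕ, 1 ≤ i →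
      Subsingleton (((Tor (ModuleCat.{u} R) i).obj C).obj (ModuleCat.of R (C →ₗ[R] M)))) ∧
  Function.Bijective
    (TensorProduct.lift ((LinearMap.id : (C →ₗ[R] M) →ₗ[R] (C →ₗ[R] M)).flip))

/-- Membership in the Auslander class `A_C(R)`. -/
def MemAuslanderClass (C M : ModuleCat.{u} R) : Prop :=
  (∀ i : ℕ, 1 ≤ i →
      Subsingleton (((Tor (ModuleCat.{u} R) i).obj C).obj M)) ∧
  (∀ i : ℕ, 1 ≤ i →
      Subsingleton (((Ext R (ModuleCat.{u} R) i).obj (Opposite.op C)).obj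
        (ModuleCat.of R (↥C ⊗[R] ↥M)))) ∧
  Function.Bijective ((TensorProduct.mk R ↥C ↥M).flip)

/-- `HasResDimLE R P n M` : `M` admits a resolution of length at most `n`
by modules satisfying `P`. -/
def HasResDimLE (P : ModuleCat.{u} R → Prop) : ℕ → ModuleCat.{u} R → Prop
  | 0, M => Subsingleton M ∨ P M
  | n + 1, M => Subsingleton M ∨ ∃ (X : ModuleCat.{u} R) (f : X →ₗ[R] M),
      P X ∧ Function.Surjective f ∧
        HasResDimLE P n (ModuleCat.of R ↥(LinearMap.ker f))

/-- The projective dimension of `M`. -/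
def projDim (M : ModuleCat.{u} R) : ℕ∞ :=
  sInf {d : ℕ∞ | ∃ n : ℕ, d = n ∧ HasResDimLE R (fun N => Module.Projective R N) n M}

/-- The first projection of the trivial extension `R ⋉ C`, as a ring homomorphism. -/
def trivExtFst (C : Type u) [AddCommGroup C] [Module R C] [Module Rᵐᵒᵖ C]
    [IsCentralScalar R C] : TrivSqZeroExt R C →+* R where
  toFun := TrivSqZeroExt.fst
  map_one' := TrivSqZeroExt.fst_one (R := R) (M := C)
  map_mul' := TrivSqZeroExt.fst_mul
  map_zero' := TrivSqZeroExt.fst_zero (R := R) (M := C)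
  map_add' := TrivSqZeroExt.fst_add

/-- The ideal `a ⊕ C` of the trivial extension `R ⋉ C`. -/
def trivExtIdeal (a : Ideal R) (C : Type u) [AddCommGroup C] [Module R C] [Module Rᵐᵒᵖ C]
    [IsCentralScalar R C] : Ideal (TrivSqZeroExt R C) :=
  Ideal.comap (trivExtFst R C) a

/-- An `R`-module `M`, viewed as a module over the trivial extension `R ⋉ C` via the
natural surjection `R ⋉ C → R`. -/
def trivExtModuleCat (C : Type u) [AddCommGroup C] [Module R C] [Module Rᵐᵒᵖ C]
    [IsCentralScalar R C] (M : Type u) [AddCommGroup M] [Module R M] :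
    ModuleCat.{u} (TrivSqZeroExt R C) :=
  letI := Module.compHom M (trivExtFst R C)
  ModuleCat.of (TrivSqZeroExt R C) M

end

noncomputable section
open CategoryTheory

universe u

set_option linter.unusedSectionVars false

namespace ExtBridge

variable {R : Type u} [CommRing R] {X Y : ModuleCat.{u} R}

lemma extMk_eq_zero_of_zero (P : ProjectiveResolution X) (f : P.complex.X 0 ⟶ Y)
    (hf : P.complex.d 1 0 ≫ f = 0) (h : P.extMk f 1 rfl hf = 0) : f = 0 := by
  simp only [← P.extEquivCohomologyClass.apply_eq_iff_eq,
    ProjectiveResolution.extEquivCohomologyClass_extMk,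
    ProjectiveResolution.extEquivCohomologyClass_zero,
    CochainComplex.HomComplex.CohomologyClass.mk_eq_zero_iff] at h
  rw [CochainComplex.HomComplex.Cocycle.toSingleMk_mem_coboundaries_iff _ _ _ _ _ 1 (by lia)] at h
  obtain ⟨g, hg⟩ := h
  have h0 : P.cochainComplex.d (-((0 : ℕ) : ℤ)) 1 = 0 := by
    have : Limits.IsZero (P.cochainComplex.X 1) := P.cochainComplex.isZero_of_isStrictlyLE 0 1
    exact this.eq_of_tgt _ _
  rw [h0, Limits.zero_comp] at hg
  rw [← cancel_epi (P.cochainComplexXIso (-((0 : ℕ) : ℤ)) 0 rfl).hom, ← hg, Limits.comp_zero]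

abbrev oldFun (Y : ModuleCat.{u} R) : ModuleCat.{u} R ⥤ (ModuleCat.{u} R)ᵒᵖ :=
  ((linearYoneda R (ModuleCat.{u} R)).obj Y).rightOp

abbrev oldCx (P : ProjectiveResolution X) (Y : ModuleCat.{u} R) :
    ChainComplex (ModuleCat.{u} R)ᵒᵖ ℕ :=
  ((oldFun Y).mapHomologicalComplex _).obj P.complex

abbrev ldIso (P : ProjectiveResolution X) (Y : ModuleCat.{u} R) (n : ℕ) :
    ((oldFun Y).leftDerived n).obj X ≅ (oldCx P Y).homology n :=
  P.isoLeftDerivedObj (oldFun Y) n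

abbrev cls (P : ProjectiveResolution X) (Y : ModuleCat.{u} R) (n : ℕ) :
    ((oldCx P Y).opcycles n).unop ⟶ ((oldFun Y).leftDerived n |>.obj X).unop :=
  ((oldCx P Y).homologyι n).unop ≫ (ldIso P Y n).hom.unop

abbrev coc (P : ProjectiveResolution X) (Y : ModuleCat.{u} R) (n : ℕ) :
    ((oldCx P Y).opcycles n).unop ⟶ ModuleCat.of R (P.complex.X n ⟶ Y) :=
  ((oldCx P Y).pOpcycles n).unop

lemma cls_surjective (P : ProjectiveResolution X) (Y : ModuleCat.{u} R) (n : ℕ) :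
    Function.Surjective (cls P Y n) := by
  rw [← ModuleCat.epi_iff_surjective]
  have h1 : Epi ((oldCx P Y).homologyι n).unop := unop_epi_of_mono _
  have h2 : Epi (ldIso P Y n).hom.unop :=
    unop_epi_of_mono (ldIso P Y n).hom
  exact epi_comp _ _

lemma coc_injective (P : ProjectiveResolution X) (Y : ModuleCat.{u} R) (n : ℕ) :
    Function.Injective (coc P Y n) := by
  rw [← ModuleCat.mono_iff_injective]
  exact unop_mono_of_epi ((oldCx P Y).pOpcycles n)

lemma d_comp_coc (P : ProjectiveResolution X) (Y : ModuleCat.{u} R) (n m : ℕ)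
    (z : ((oldCx P Y).opcycles n).unop) : P.complex.d m n ≫ (coc P Y n z : P.complex.X n ⟶ Y) = 0 := by
  have := congrArg Quiver.Hom.unop ((oldCx P Y).d_pOpcycles m n)
  exact congrArg (fun f => f.hom z) this

lemma exists_coc (P : ProjectiveResolution X) (Y : ModuleCat.{u} R) (n : ℕ)
    (f : P.complex.X n ⟶ Y) (hf : P.complex.d (n+1) n ≫ f = 0) :
    ∃ z, coc P Y n z = f := by
  let g : ModuleCat.of R R ⟶ ModuleCat.of R (P.complex.X n ⟶ Y) :=
    ModuleCat.ofHom (LinearMap.toSpanSingleton R _ f)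
  have hg : (oldCx P Y).d (n+1) n ≫ (show (oldCx P Y).X n ⟶ Opposite.op (ModuleCat.of R R) from g.op) = 0 := by
    apply Quiver.Hom.unop_inj
    apply ModuleCat.hom_ext
    apply LinearMap.ext_ring
    change P.complex.d (n+1) n ≫ ((1:R) • f) = 0
    rw [one_smul, hf]
  let k := (oldCx P Y).descOpcycles (show (oldCx P Y).X n ⟶ Opposite.op (ModuleCat.of R R) from g.op) (n+1) (by simp) hg
  have hk := congrArg Quiver.Hom.unop ((oldCx P Y).p_descOpcycles
    (show (oldCx P Y).X n ⟶ Opposite.op (ModuleCat.of R R) from g.op) (n+1) (by simp) hg)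
  refine ⟨k.unop (1:R), ?_⟩
  have := congrArg (fun f => f.hom (1:R)) hk
  refine Eq.trans this ?_
  change (1:R) • f = f
  exact one_smul _ _

lemma cls_eq_zero_iff_succ (P : ProjectiveResolution X) (Y : ModuleCat.{u} R) (n : ℕ)
    (z : ((oldCx P Y).opcycles (n+1)).unop) :
    cls P Y (n+1) z = 0 ↔ ∃ g : P.complex.X n ⟶ Y, P.complex.d (n+1) n ≫ g = coc P Y (n+1) z := by
  let S := ShortComplex.mk _ _ ((oldCx P Y).homologyι_comp_fromOpcycles (n+1) n)
  have hS : S.Exact := ShortComplex.exact_of_f_is_kernel _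
    ((oldCx P Y).homologyIsKernel (n+1) n (by simp))
  have h2 : ((oldCx P Y).homologyι (n+1)).unop z = 0 ↔
      ∃ g, ((oldCx P Y).fromOpcycles (n+1) n).unop g = z := by
    constructor
    · exact (ShortComplex.moduleCat_exact_iff _).1 hS.unop z
    · rintro ⟨g, rfl⟩
      exact congrArg (fun f => f.unop.hom g) ((oldCx P Y).homologyι_comp_fromOpcycles (n+1) n)
  have h3 : cls P Y (n+1) z = 0 ↔ ((oldCx P Y).homologyι (n+1)).unop z = 0 := by
    change (ldIso P Y (n+1)).hom.unop _ = 0 ↔ _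
    constructor
    · intro h
      have hi : Function.Injective (ldIso P Y (n+1)).hom.unop := by
        rw [← ModuleCat.mono_iff_injective]
        exact unop_mono_of_epi (ldIso P Y (n+1)).hom
      exact hi (h.trans (map_zero (ldIso P Y (n+1)).hom.unop.hom).symm)
    · intro h; erw [h]; exact map_zero _
  rw [h3]
  refine h2.trans ?_
  have key : ∀ g : P.complex.X n ⟶ Y,
      coc P Y (n+1) (((oldCx P Y).fromOpcycles (n+1) n).unop g) = P.complex.d (n+1) n ≫ g := by
    intro g
    have := congrArg Quiver.Hom.unop ((oldCx P Y).p_fromOpcycles (n+1) n)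
    exact congrArg (fun f => f.hom g) this
  constructor
  · rintro ⟨g, hg⟩
    refine ⟨g, ?_⟩
    exact (key g).symm.trans (congrArg (coc P Y (n+1)) hg)
  · rintro ⟨g, hg⟩
    refine ⟨g, coc_injective P Y _ ?_⟩
    exact (key g).trans hg

lemma cls_eq_zero_iff_zero (P : ProjectiveResolution X) (Y : ModuleCat.{u} R)
    (z : ((oldCx P Y).opcycles 0).unop) :
    cls P Y 0 z = 0 ↔ coc P Y 0 z = 0 := by
  have : Function.Injective (cls P Y 0) := by
    rw [← ModuleCat.mono_iff_injective]
    have : IsIso ((oldCx P Y).homologyι 0) :=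
      (oldCx P Y).isIso_homologyι 0 _ rfl (by simp)
    have h1 : Mono ((oldCx P Y).homologyι 0).unop := unop_mono_of_epi _
    have h2 : Mono (ldIso P Y 0).hom.unop :=
      unop_mono_of_epi (ldIso P Y 0).hom
    exact mono_comp _ _
  rw [map_eq_zero_iff _ this, map_eq_zero_iff _ (coc_injective P Y 0)]

def tr (P : ProjectiveResolution X) (Y : ModuleCat.{u} R) (n : ℕ) :
    ((oldCx P Y).opcycles n).unop →ₗ[R] Abelian.Ext X Y n where
  toFun z := P.extMk (coc P Y n z) (n+1) rfl (d_comp_coc P Y n _ z)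
  map_add' a b := by
    rw [P.add_extMk]
    congr 1
    exact map_add _ _ _
  map_smul' r a := by
    rw [RingHom.id_apply, Abelian.Ext.smul_eq_comp_mk₀, P.extMk_comp_mk₀]
    congr 1
    rw [Linear.comp_smul, Category.comp_id]
    exact map_smul (coc P Y n).hom r a

lemma tr_surjective (P : ProjectiveResolution X) (Y : ModuleCat.{u} R) (n : ℕ) :
    Function.Surjective (tr P Y n) := by
  intro e
  obtain ⟨f, hf, rfl⟩ := P.extMk_surjective e (n+1) rfl
  obtain ⟨z, hz⟩ := exists_coc P Y n f hf
  refine ⟨z, ?_⟩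
  subst hz; rfl

lemma tr_eq_zero_iff (P : ProjectiveResolution X) (Y : ModuleCat.{u} R) (n : ℕ)
    (z : ((oldCx P Y).opcycles n).unop) : tr P Y n z = 0 ↔ cls P Y n z = 0 := by
  cases n with
  | zero =>
    rw [cls_eq_zero_iff_zero]
    constructor
    · intro h; exact extMk_eq_zero_of_zero P _ (d_comp_coc P Y 0 1 z) h
    · intro h
      change P.extMk (coc P Y 0 z) 1 rfl (d_comp_coc P Y 0 1 z) = 0
      have h' : (P.complex.d 1 0 ≫ (0 : P.complex.X 0 ⟶ Y)) = 0 := Limits.comp_zero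
      exact (by congr 1 : P.extMk (coc P Y 0 z) 1 rfl (d_comp_coc P Y 0 1 z) =
        P.extMk 0 1 rfl h').trans (P.extMk_zero _ _)
  | succ n =>
    rw [cls_eq_zero_iff_succ]
    exact P.extMk_eq_zero_iff _ (n+1+1) rfl (d_comp_coc P Y (n+1) _ z) _ rfl

lemma exists_equiv_aux (P : ProjectiveResolution X) (Y : ModuleCat.{u} R) (n : ℕ) :
    ∃ e : (((Ext R (ModuleCat.{u} R) n).obj (Opposite.op X)).obj Y) ≃ₗ[R] Abelian.Ext X Y n,
      ∀ z, e (cls P Y n z) = tr P Y n z := by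
  have h : LinearMap.ker (cls P Y n).hom = LinearMap.ker (tr P Y n) := by
    ext z; exact (tr_eq_zero_iff P Y n z).symm
  let e1 := (cls P Y n).hom.quotKerEquivOfSurjective (cls_surjective P Y n)
  let e2 := (tr P Y n).quotKerEquivOfSurjective (tr_surjective P Y n)
  refine ⟨e1.symm ≪≫ₗ Submodule.quotEquivOfEq _ _ h ≪≫ₗ e2, fun z => ?_⟩
  have : e1.symm (cls P Y n z) = Submodule.Quotient.mk z := by
    rw [LinearEquiv.symm_apply_eq]; rfl
  change e2 (Submodule.quotEquivOfEq _ _ h (e1.symm (cls P Y n z))) = _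
  rw [this]
  rfl

def pres (X : ModuleCat.{u} R) : ProjectiveResolution X := projectiveResolution X

def equiv (X Y : ModuleCat.{u} R) (n : ℕ) :
    (((Ext R (ModuleCat.{u} R) n).obj (Opposite.op X)).obj Y) ≃ₗ[R] Abelian.Ext X Y n :=
  (exists_equiv_aux (pres X) Y n).choose

lemma equiv_naturality {X X' : ModuleCat.{u} R} (Y : ModuleCat.{u} R) (n : ℕ) (f : X' ⟶ X)
    (h : ((Ext R (ModuleCat.{u} R) n).obj (Opposite.op X)).obj Y) :
    equiv X' Y n ((((Ext R (ModuleCat.{u} R) n).map f.op).app Y).hom h) =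
      (Abelian.Ext.mk₀ f).comp (equiv X Y n h) (zero_add n) := by
  obtain ⟨z, rfl⟩ := cls_surjective (pres X) Y n h
  let φ0 := ProjectiveResolution.lift f (pres X') (pres X)
  have h0 : φ0.f 0 ≫ (pres X).π.f 0 = (pres X').π.f 0 ≫ f := by
    have := ProjectiveResolution.lift_commutes_zero f (pres X') (pres X)
    exact this
  let φ : ProjectiveResolution.Hom (pres X') (pres X) f := ⟨φ0, h0⟩
  have nat := ProjectiveResolution.isoLeftDerivedObj_hom_naturality f (pres X') (pres X) φ0 h0 (oldFun Y) n
  let ψ : oldCx (pres X') Y ⟶ oldCx (pres X) Y := ((oldFun Y).mapHomologicalComplex _).map φ0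
  let w := (HomologicalComplex.opcyclesMap ψ n).unop z
  have h1 : (((Ext R (ModuleCat.{u} R) n).map f.op).app Y).hom (cls (pres X) Y n z) = cls (pres X') Y n w := by
    have e1 : (cls (pres X) Y n) ≫ ((oldFun Y).leftDerived n |>.map f).unop =
        (HomologicalComplex.opcyclesMap ψ n).unop ≫ cls (pres X') Y n := by
      apply Quiver.Hom.op_inj
      have := HomologicalComplex.homologyι_naturality ψ n
      change ((oldFun Y).leftDerived n).map f ≫ (ldIso (pres X) Y n).hom ≫ _ = 
        (ldIso (pres X') Y n).hom ≫ HomologicalComplex.homologyι _ n ≫ HomologicalComplex.opcyclesMap ψ n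
      rw [← this, ← Category.assoc, ← Category.assoc]
      congr 1
    exact congrArg (fun f => f.hom z) e1
  have h2 : coc (pres X') Y n w = φ0.f n ≫ (coc (pres X) Y n z : (pres X).complex.X n ⟶ Y) := by
    have e2 := congrArg Quiver.Hom.unop (HomologicalComplex.p_opcyclesMap ψ n)
    exact congrArg (fun f => f.hom z) e2
  have e3 : equiv X' Y n (cls (pres X') Y n w) = tr (pres X') Y n w := (exists_equiv_aux (pres X') Y n).choose_spec w
  have e4 : equiv X Y n (cls (pres X) Y n z) = tr (pres X) Y n z := (exists_equiv_aux (pres X) Y n).choose_spec z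
  erw [h1, e3, e4]
  refine Eq.trans ?_ (ProjectiveResolution.mk₀_comp_extMk _ _ rfl (d_comp_coc _ Y n _ z) φ).symm
  have aux : ∀ (a b : (pres X').complex.X n ⟶ Y) (ha hb), a = b →
      (pres X').extMk a (n+1) rfl ha = (pres X').extMk b (n+1) rfl hb := by
    rintro a b ha hb rfl; rfl
  exact aux _ _ (d_comp_coc _ Y n _ w) _ h2
end ExtBridge

/-- A short exact sequence of modules, in terms of linear maps. -/
structure IsSES {R : Type u} [CommRing R] {A B D : Type u} [AddCommGroup A] [AddCommGroup B]
    [AddCommGroup D] [Module R A] [Module R B] [Module R D] (f : A →ₗ[R] B) (g : B →ₗ[R] D) :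
    Prop where
  inj : Function.Injective f
  exact : Function.Exact f g
  surj : Function.Surjective g

/-- `ExtVanish R i M N` says that `Ext^i_R(M, N) = 0`. -/
def ExtVanish (R : Type u) [CommRing R] (i : ℕ) (M N : Type u) [AddCommGroup M] [Module R M]
    [AddCommGroup N] [Module R N] : Prop :=
  Subsingleton (Abelian.Ext (ModuleCat.of R M) (ModuleCat.of R N) i)

section
variable {R : Type u} [CommRing R] {A B D M N M' N' : Type u} [AddCommGroup A] [AddCommGroup B]
    [AddCommGroup D] [Module R A] [Module R B] [Module R D] [AddCommGroup M] [Module R M]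
    [AddCommGroup N] [Module R N] [AddCommGroup M'] [Module R M']
    [AddCommGroup N'] [Module R N'] {f : A →ₗ[R] B} {g : B →ₗ[R] D}

namespace IsSES

abbrev cx (h : IsSES f g) : ShortComplex (ModuleCat.{u} R) :=
  ShortComplex.mk (ModuleCat.ofHom f) (ModuleCat.ofHom g) (by
    ext x; exact h.exact.apply_apply_eq_zero x)

lemma shortExact (h : IsSES f g) : h.cx.ShortExact where
  exact := (ShortComplex.moduleCat_exact_iff _).2 fun x hx => (h.exact x).1 hx
  mono_f := (ModuleCat.mono_iff_injective _).2 h.inj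
  epi_g := (ModuleCat.epi_iff_surjective _).2 h.surj

lemma of_surjective (g : B →ₗ[R] D) (hg : Function.Surjective g) :
    IsSES (LinearMap.ker g).subtype g :=
  ⟨Subtype.val_injective, by intro x; simp, hg⟩

lemma of_submodule (S : Submodule R B) : IsSES S.subtype S.mkQ :=
  ⟨Subtype.val_injective, by intro x; simp, S.mkQ_surjective⟩

lemma of_injective (f : A →ₗ[R] B) (hf : Function.Injective f) :
    IsSES f (LinearMap.range f).mkQ :=
  ⟨hf, by intro x; simp, Submodule.mkQ_surjective _⟩

end IsSES

namespace ExtVanish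

lemma of_projective (i : ℕ) [Module.Projective R M] : ExtVanish R (i + 1) M N := by
  have : Projective (ModuleCat.of R M) := (IsProjective.iff_projective M).1 inferInstance
  exact Abelian.Ext.subsingleton_of_projective _ _ i

lemma of_injective (i : ℕ) (h : Module.Injective R N) : ExtVanish R (i + 1) M N := by
  have : Injective (ModuleCat.of R N) := (Module.injective_iff_injective_object R N).1 h
  exact Abelian.Ext.subsingleton_of_injective _ _ i

variable {i : ℕ}

lemma contra_mid (h : IsSES f g) (h1 : ExtVanish R i A N) (h2 : ExtVanish R i D N) :
    ExtVanish R i B N := by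
  have := h1; have := h2
  refine subsingleton_of_forall_eq 0 fun x => ?_
  obtain ⟨y, rfl⟩ := Abelian.Ext.contravariant_sequence_exact₂ h.shortExact _ x
    (h1.elim _ _)
  rw [h2.elim y 0, Abelian.Ext.comp_zero]

lemma contra_right (h : IsSES f g) (h1 : ExtVanish R i A N) (h2 : ExtVanish R (i + 1) B N) :
    ExtVanish R (i + 1) D N := by
  refine subsingleton_of_forall_eq 0 fun x => ?_
  obtain ⟨y, rfl⟩ := Abelian.Ext.contravariant_sequence_exact₃ h.shortExact _ x
    (h2.elim _ _) (add_comm 1 i)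
  rw [h1.elim y 0, Abelian.Ext.comp_zero]

lemma contra_left (h : IsSES f g) (h1 : ExtVanish R i B N) (h2 : ExtVanish R (i + 1) D N) :
    ExtVanish R i A N := by
  refine subsingleton_of_forall_eq 0 fun x => ?_
  obtain ⟨y, rfl⟩ := Abelian.Ext.contravariant_sequence_exact₁ h.shortExact _ x
    (add_comm 1 i) (h2.elim _ _)
  rw [h1.elim y 0, Abelian.Ext.comp_zero]

lemma co_right (h : IsSES f g) (h1 : ExtVanish R i M B) (h2 : ExtVanish R (i + 1) M A) :
    ExtVanish R i M D := by
  refine subsingleton_of_forall_eq 0 fun x => ?_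
  obtain ⟨y, rfl⟩ := Abelian.Ext.covariant_sequence_exact₃ _ h.shortExact x rfl
    (h2.elim _ _)
  rw [h1.elim y 0, Abelian.Ext.zero_comp]

lemma co_left (h : IsSES f g) (h1 : ExtVanish R i M D) (h2 : ExtVanish R (i + 1) M B) :
    ExtVanish R (i + 1) M A := by
  refine subsingleton_of_forall_eq 0 fun x => ?_
  obtain ⟨y, rfl⟩ := Abelian.Ext.covariant_sequence_exact₁ _ h.shortExact x
    (h2.elim _ _) rfl
  rw [h1.elim y 0, Abelian.Ext.zero_comp]

lemma exists_lift (h : IsSES f g) (h1 : ExtVanish R 1 M A) (φ : M →ₗ[R] D) :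
    ∃ ψ : M →ₗ[R] B, g ∘ₗ ψ = φ := by
  obtain ⟨y, hy⟩ := Abelian.Ext.covariant_sequence_exact₃ _ h.shortExact
    (Abelian.Ext.mk₀ (ModuleCat.ofHom φ)) rfl (h1.elim _ _)
  obtain ⟨y, rfl⟩ := (Abelian.Ext.mk₀_bijective _ _).2 y
  rw [Abelian.Ext.mk₀_comp_mk₀] at hy
  have := (Abelian.Ext.mk₀_bijective _ _).1 hy
  exact ⟨y.hom, congrArg ModuleCat.Hom.hom this⟩

lemma exists_extend (h : IsSES f g) (h1 : ExtVanish R 1 D N) (φ : A →ₗ[R] N) :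
    ∃ ψ : B →ₗ[R] N, ψ ∘ₗ f = φ := by
  obtain ⟨y, hy⟩ := Abelian.Ext.contravariant_sequence_exact₁ h.shortExact _
    (Abelian.Ext.mk₀ (ModuleCat.ofHom φ)) (add_zero 1) (h1.elim _ _)
  obtain ⟨y, rfl⟩ := (Abelian.Ext.mk₀_bijective _ _).2 y
  rw [Abelian.Ext.mk₀_comp_mk₀] at hy
  have := (Abelian.Ext.mk₀_bijective _ _).1 hy
  exact ⟨y.hom, congrArg ModuleCat.Hom.hom this⟩

lemma one_of_extend (h : IsSES f g) (hB : ExtVanish R 1 B N)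
    (H : ∀ φ : A →ₗ[R] N, ∃ ψ : B →ₗ[R] N, ψ ∘ₗ f = φ) : ExtVanish R 1 D N := by
  refine subsingleton_of_forall_eq 0 fun x => ?_
  obtain ⟨y, rfl⟩ := Abelian.Ext.contravariant_sequence_exact₃ h.shortExact _ x
    (hB.elim _ _) (add_zero 1)
  obtain ⟨y, rfl⟩ := (Abelian.Ext.mk₀_bijective _ _).2 y
  obtain ⟨ψ, hψ⟩ := H y.hom
  have : y = ModuleCat.ofHom f ≫ ModuleCat.ofHom ψ := by
    rw [← ModuleCat.ofHom_comp, hψ]; rfl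
  rw [this, ← Abelian.Ext.mk₀_comp_mk₀]
  exact h.shortExact.extClass_comp_assoc _

lemma one_of_lift (h : IsSES f g) (hB : ExtVanish R 1 M B)
    (H : ∀ φ : M →ₗ[R] D, ∃ ψ : M →ₗ[R] B, g ∘ₗ ψ = φ) : ExtVanish R 1 M A := by
  refine subsingleton_of_forall_eq 0 fun x => ?_
  obtain ⟨y, rfl⟩ := Abelian.Ext.covariant_sequence_exact₁ _ h.shortExact x
    (hB.elim _ _) rfl
  obtain ⟨y, rfl⟩ := (Abelian.Ext.mk₀_bijective _ _).2 y
  obtain ⟨ψ, hψ⟩ := H y.hom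
  have : y = ModuleCat.ofHom ψ ≫ ModuleCat.ofHom g := by
    rw [← ModuleCat.ofHom_comp, hψ]; rfl
  rw [this, ← Abelian.Ext.mk₀_comp_mk₀, Abelian.Ext.comp_assoc_of_second_deg_zero]
  have := h.shortExact.comp_extClass
  dsimp at this
  rw [this, Abelian.Ext.comp_zero]

lemma retract_left (s : M →ₗ[R] M') (r : M' →ₗ[R] M) (hrs : r ∘ₗ s = LinearMap.id)
    (h : ExtVanish R i M' N) : ExtVanish R i M N := by
  refine subsingleton_of_forall_eq 0 fun x => ?_
  have : x = (Abelian.Ext.mk₀ (ModuleCat.ofHom s)).comp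
      ((Abelian.Ext.mk₀ (ModuleCat.ofHom r)).comp x (zero_add i)) (zero_add i) := by
    rw [Abelian.Ext.mk₀_comp_mk₀_assoc, ← ModuleCat.ofHom_comp, hrs]
    exact (Abelian.Ext.mk₀_id_comp x).symm
  rw [this, h.elim ((Abelian.Ext.mk₀ (ModuleCat.ofHom r)).comp x (zero_add i)) 0,
    Abelian.Ext.comp_zero]

lemma retract_right (s : N →ₗ[R] N') (r : N' →ₗ[R] N) (hrs : r ∘ₗ s = LinearMap.id)
    (h : ExtVanish R i M N') : ExtVanish R i M N := by
  refine subsingleton_of_forall_eq 0 fun x => ?_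
  have : x = (x.comp (Abelian.Ext.mk₀ (ModuleCat.ofHom s)) (add_zero i)).comp
      (Abelian.Ext.mk₀ (ModuleCat.ofHom r)) (add_zero i) := by
    rw [Abelian.Ext.comp_assoc_of_third_deg_zero, Abelian.Ext.mk₀_comp_mk₀,
      ← ModuleCat.ofHom_comp, hrs]
    exact (Abelian.Ext.comp_mk₀_id x).symm
  rw [this, h.elim (x.comp (Abelian.Ext.mk₀ (ModuleCat.ofHom s)) (add_zero i)) 0,
    Abelian.Ext.zero_comp]

lemma congr_left (e : M ≃ₗ[R] M') : ExtVanish R i M N ↔ ExtVanish R i M' N :=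
  ⟨retract_left e.symm.toLinearMap e.toLinearMap (by ext; simp),
    retract_left e.toLinearMap e.symm.toLinearMap (by ext; simp)⟩

lemma congr_right (e : N ≃ₗ[R] N') : ExtVanish R i M N ↔ ExtVanish R i M N' :=
  ⟨retract_right e.symm.toLinearMap e.toLinearMap (by ext; simp),
    retract_right e.toLinearMap e.symm.toLinearMap (by ext; simp)⟩

lemma of_subsingleton_left [Subsingleton M] : ExtVanish R i M N := by
  refine subsingleton_of_forall_eq 0 fun x => ?_
  have h : 𝟙 (ModuleCat.of R M) = 0 := by ext x; exact Subsingleton.elim (α := M) _ _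
  rw [← Abelian.Ext.mk₀_id_comp x, h, Abelian.Ext.mk₀_zero, Abelian.Ext.zero_comp]

lemma of_subsingleton_right [Subsingleton N] : ExtVanish R i M N := by
  refine subsingleton_of_forall_eq 0 fun x => ?_
  have h : 𝟙 (ModuleCat.of R N) = 0 := by ext x; exact Subsingleton.elim (α := N) _ _
  rw [← Abelian.Ext.comp_mk₀_id x, h, Abelian.Ext.mk₀_zero, Abelian.Ext.comp_zero]

end ExtVanish

lemma ext_exists_smul_right {x : R} {f : B →ₗ[R] D} {i : ℕ}
    (h : IsSES (LinearMap.lsmul R B x) f)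
    (hD : ExtVanish R i M D) (e : Abelian.Ext (ModuleCat.of R M) (ModuleCat.of R B) i) :
    ∃ e', x • e' = e := by
  obtain ⟨y, rfl⟩ := Abelian.Ext.covariant_sequence_exact₂ _ h.shortExact e (hD.elim _ _)
  exact ⟨y, by rw [Abelian.Ext.smul_eq_comp_mk₀]; rfl⟩

lemma ext_exists_smul_left {x : R} {f : B →ₗ[R] D} {i : ℕ}
    (h : IsSES (LinearMap.lsmul R B x) f)
    (hD : ExtVanish R (i + 1) D N) (e : Abelian.Ext (ModuleCat.of R B) (ModuleCat.of R N) i) :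
    ∃ e', x • e' = e := by
  obtain ⟨y, rfl⟩ := Abelian.Ext.contravariant_sequence_exact₁ h.shortExact _ e
    (add_comm 1 i) (hD.elim _ _)
  refine ⟨y, ?_⟩
  have : ModuleCat.ofHom (LinearMap.lsmul R B x) = x • 𝟙 (ModuleCat.of R B) := rfl
  dsimp only
  rw [this, Abelian.Ext.mk₀_smul, Abelian.Ext.smul_comp, Abelian.Ext.mk₀_id_comp]

lemma ext_smul_eq_zero_left {x : R} {i : ℕ} (hx : ∀ m : M, x • m = 0)
    (e : Abelian.Ext (ModuleCat.of R M) (ModuleCat.of R N) i) : x • e = 0 := by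
  have : x • 𝟙 (ModuleCat.of R M) = 0 := by ext m; exact hx m
  rw [← Abelian.Ext.mk₀_id_comp e, ← Abelian.Ext.smul_comp, ← Abelian.Ext.mk₀_smul, this,
    Abelian.Ext.mk₀_zero, Abelian.Ext.zero_comp]

/-- If `x` kills `M`, is regular on `B`, and `Ext^i(M, B/xB) = 0`, then `Ext^i(M, B) = 0`. -/
lemma ExtVanish.of_smul_right {x : R} {f : B →ₗ[R] D} {i : ℕ}
    (h : IsSES (LinearMap.lsmul R B x) f) (hx : ∀ m : M, x • m = 0)
    (hD : ExtVanish R i M D) : ExtVanish R i M B := by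
  refine subsingleton_of_forall_eq 0 fun e => ?_
  obtain ⟨e₁, rfl⟩ := ext_exists_smul_right h hD e
  exact ext_smul_eq_zero_left hx e₁

/-- Nakayama's lemma for `Ext` of finite modules over a Noetherian local ring. -/
lemma ExtVanish.of_smul_left [IsNoetherianRing R] [IsLocalRing R] [Module.Finite R B]
    [Module.Finite R N] {x : R} {f : B →ₗ[R] D} {i : ℕ}
    (h : IsSES (LinearMap.lsmul R B x) f) (hx : x ∈ IsLocalRing.maximalIdeal R)
    (hD : ExtVanish R (i + 1) D N) : ExtVanish R i B N := by
  have : Module.Finite R (ModuleCat.of R B) := ‹Module.Finite R B›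
  have : Module.Finite R (ModuleCat.of R N) := ‹Module.Finite R N›
  have hfin : Module.Finite R (Abelian.Ext (ModuleCat.of R B) (ModuleCat.of R N) i) :=
    inferInstance
  refine Submodule.subsingleton_iff R |>.1 (subsingleton_of_bot_eq_top ?_)
  refine (Submodule.eq_bot_of_le_smul_of_le_jacobson_bot (IsLocalRing.maximalIdeal R) ⊤
    hfin.fg_top ?_ (IsLocalRing.maximalIdeal_le_jacobson _)).symm
  intro e _
  obtain ⟨e', rfl⟩ := ext_exists_smul_left h hD e
  exact Submodule.smul_mem_smul hx trivial

end

section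
variable {R : Type u} [CommRing R]

namespace LC

section transition
variable (a : Ideal R) (i : ℕ) (M : Type u) [AddCommGroup M] [Module R M]

abbrev term (n : ℕ) : Type u :=
  Abelian.Ext (ModuleCat.of R (R ⧸ a ^ n)) (ModuleCat.of R M) i

abbrev fac {n m : ℕ} (h : n ≤ m) : ModuleCat.of R (R ⧸ a ^ m) ⟶ ModuleCat.of R (R ⧸ a ^ n) :=
  ModuleCat.ofHom (Submodule.mapQ _ _ LinearMap.id (Ideal.pow_le_pow_right h))

lemma fac_self (n : ℕ) : fac a (le_refl n) = 𝟙 _ := by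
  ext; rfl

lemma fac_comp {n m k : ℕ} (h : n ≤ m) (h' : m ≤ k) :
    fac a h' ≫ fac a h = fac a (h.trans h') := by
  ext; rfl

def trans (n m : ℕ) (h : n ≤ m) : term a i M n →ₗ[R] term a i M m :=
  Abelian.Ext.precompOfLinear (Abelian.Ext.mk₀ (fac a h)) R _ (zero_add i)

lemma trans_apply {n m : ℕ} (h : n ≤ m) (e : term a i M n) :
    trans a i M n m h e = (Abelian.Ext.mk₀ (fac a h)).comp e (zero_add i) := rfl

instance : DirectedSystem (term a i M) (fun n m h => trans a i M n m h) where
  map_self n e := by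
    rw [trans_apply, fac_self, Abelian.Ext.mk₀_id_comp]
  map_map n m k h h' e := by
    rw [trans_apply, trans_apply, trans_apply, Abelian.Ext.mk₀_comp_mk₀_assoc, fac_comp]

end transition

end LC

/-- Local cohomology of a module, as a direct limit of Ext modules indexed by `ℕ`. -/
def LC (a : Ideal R) (i : ℕ) (M : Type u) [AddCommGroup M] [Module R M] : Type u :=
  Module.DirectLimit (LC.term a i M) (LC.trans a i M)

namespace LC
variable (a : Ideal R) (i : ℕ) {M N K : Type u} [AddCommGroup M] [Module R M]
  [AddCommGroup N] [Module R N] [AddCommGroup K] [Module R K]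

instance : AddCommGroup (LC a i M) :=
  inferInstanceAs (AddCommGroup (Module.DirectLimit (LC.term a i M) (LC.trans a i M)))
instance : Module R (LC a i M) :=
  inferInstanceAs (Module R (Module.DirectLimit (LC.term a i M) (LC.trans a i M)))

def ι (n : ℕ) : term a i M n →ₗ[R] LC a i M :=
  Module.DirectLimit.of R ℕ (LC.term a i M) (LC.trans a i M) n

lemma exists_rep (z : LC a i M) : ∃ n, ∃ e : term a i M n, ι a i n e = z :=
  Module.DirectLimit.exists_of z

lemma ι_trans {n m : ℕ} (h : n ≤ m) (e : term a i M n) :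
    ι a i m (trans a i M n m h e) = ι a i n e :=
  Module.DirectLimit.of_f

lemma exists_of_ι_eq_zero {n : ℕ} (e : term a i M n) (h : ι a i n e = 0) :
    ∃ m, ∃ hm : n ≤ m, trans a i M n m hm e = 0 :=
  Module.DirectLimit.of.zero_exact h

def map (f : M →ₗ[R] N) : LC a i M →ₗ[R] LC a i N :=
  Module.DirectLimit.map (fun n => Abelian.Ext.postcompOfLinear
    (Abelian.Ext.mk₀ (ModuleCat.ofHom f)) R _ (add_zero i)) (by
    intro n m h
    ext e
    exact Abelian.Ext.comp_assoc_of_third_deg_zero (Abelian.Ext.mk₀ (fac a h)) e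
      (Abelian.Ext.mk₀ (ModuleCat.ofHom f)) (zero_add i))

lemma map_ι (f : M →ₗ[R] N) (n : ℕ) (e : term a i M n) :
    map a i f (ι a i n e) =
      ι a i n (e.comp (Abelian.Ext.mk₀ (ModuleCat.ofHom f)) (add_zero i)) :=
  Module.DirectLimit.map_apply_of _ _ _

lemma map_id : map a i (LinearMap.id : M →ₗ[R] M) = LinearMap.id := by
  ext z
  obtain ⟨n, e, rfl⟩ := exists_rep a i z
  rw [map_ι]
  exact congrArg _ (Abelian.Ext.comp_mk₀_id e)

lemma map_comp (g : N →ₗ[R] K) (f : M →ₗ[R] N) : map a i (g ∘ₗ f) = map a i g ∘ₗ map a i f := by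
  ext z
  obtain ⟨n, e, rfl⟩ := exists_rep a i z
  rw [LinearMap.comp_apply, map_ι, map_ι, map_ι, Abelian.Ext.comp_assoc_of_third_deg_zero,
    Abelian.Ext.mk₀_comp_mk₀]
  rfl

lemma map_comp_apply (g : N →ₗ[R] K) (f : M →ₗ[R] N) (z : LC a i M) :
    map a i g (map a i f z) = map a i (g ∘ₗ f) z := by
  rw [map_comp]; rfl

lemma map_add (f g : M →ₗ[R] N) : map a i (f + g) = map a i f + map a i g := by
  ext z
  obtain ⟨n, e, rfl⟩ := exists_rep a i z
  rw [LinearMap.add_apply, map_ι, map_ι, map_ι, ← _root_.map_add, ← Abelian.Ext.comp_add,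
    ← Abelian.Ext.mk₀_add]
  rfl

lemma map_smul (r : R) (f : M →ₗ[R] N) : map a i (r • f) = r • map a i f := by
  ext z
  obtain ⟨n, e, rfl⟩ := exists_rep a i z
  rw [LinearMap.smul_apply, map_ι, map_ι, ← _root_.map_smul, ← Abelian.Ext.comp_smul,
    ← Abelian.Ext.mk₀_smul]
  rfl

lemma map_zero : map a i (0 : M →ₗ[R] N) = 0 := by
  have := map_smul a i (0 : R) (0 : M →ₗ[R] N)
  simpa using this

lemma map_lsmul (r : R) (z : LC a i M) : map a i (LinearMap.lsmul R M r) z = r • z := by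
  have : LinearMap.lsmul R M r = r • LinearMap.id := by ext; rfl
  rw [this, map_smul, map_id]; rfl

section connecting
variable {A B D : Type u} [AddCommGroup A] [AddCommGroup B] [AddCommGroup D] [Module R A]
  [Module R B] [Module R D] {f : A →ₗ[R] B} {g : B →ₗ[R] D} (h : IsSES f g)

def δ : LC a i D →ₗ[R] LC a (i + 1) A :=
  Module.DirectLimit.map (fun n => Abelian.Ext.postcompOfLinear
    (h.shortExact.extClass : Abelian.Ext (ModuleCat.of R D) (ModuleCat.of R A) 1) R _ rfl) (by
    intro n m hnm
    ext e
    exact Abelian.Ext.comp_assoc (Abelian.Ext.mk₀ (fac a hnm)) e h.shortExact.extClass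
      (zero_add i) rfl (by lia))

lemma δ_ι (n : ℕ) (e : term a i D n) :
    δ a i h (ι a i n e) = ι a (i + 1) n (e.comp h.shortExact.extClass rfl) :=
  Module.DirectLimit.map_apply_of _ _ _

include h in
lemma exact_mid : Function.Exact (map a i f) (map a i g) := by
  intro z
  constructor
  · intro hz
    obtain ⟨n, e, rfl⟩ := exists_rep a i z
    rw [map_ι] at hz
    obtain ⟨m, hm, hz⟩ := exists_of_ι_eq_zero a i _ hz
    obtain ⟨y, hy⟩ := Abelian.Ext.covariant_sequence_exact₂ _ h.shortExact (trans a i _ n m hm e)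
      (by rw [trans_apply] at hz ⊢
          rw [Abelian.Ext.comp_assoc_of_third_deg_zero]; exact hz)
    refine ⟨ι a i m y, ?_⟩
    rw [map_ι]
    exact (congrArg _ hy).trans (ι_trans a i hm e)
  · rintro ⟨y, rfl⟩
    rw [map_comp_apply]
    have : g ∘ₗ f = 0 := by ext x; exact h.exact.apply_apply_eq_zero x
    rw [this, map_zero]; rfl

lemma exact_right : Function.Exact (map a i g) (δ a i h) := by
  intro z
  constructor
  · intro hz
    obtain ⟨n, e, rfl⟩ := exists_rep a i z
    rw [δ_ι] at hz
    obtain ⟨m, hm, hz⟩ := exists_of_ι_eq_zero a (i + 1) _ hz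
    obtain ⟨y, hy⟩ := Abelian.Ext.covariant_sequence_exact₃ _ h.shortExact (trans a i _ n m hm e)
      rfl (by rw [trans_apply] at hz ⊢
              rw [Abelian.Ext.comp_assoc _ _ _ _ _ (by lia)]; exact hz)
    refine ⟨ι a i m y, ?_⟩
    rw [map_ι]
    exact (congrArg _ hy).trans (ι_trans a i hm e)
  · rintro ⟨y, rfl⟩
    obtain ⟨n, e, rfl⟩ := exists_rep a i y
    rw [map_ι, δ_ι, Abelian.Ext.comp_assoc_of_second_deg_zero]
    have := h.shortExact.comp_extClass
    dsimp at this
    rw [this, Abelian.Ext.comp_zero, _root_.map_zero]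

lemma exact_left : Function.Exact (δ a i h) (map a (i + 1) f) := by
  intro z
  constructor
  · intro hz
    obtain ⟨n, e, rfl⟩ := exists_rep a (i + 1) z
    rw [map_ι] at hz
    obtain ⟨m, hm, hz⟩ := exists_of_ι_eq_zero a (i + 1) _ hz
    obtain ⟨y, hy⟩ := Abelian.Ext.covariant_sequence_exact₁ _ h.shortExact
      (trans a (i + 1) _ n m hm e)
      (by rw [trans_apply] at hz ⊢
          rw [Abelian.Ext.comp_assoc_of_third_deg_zero]; exact hz) rfl
    refine ⟨ι a i m y, ?_⟩
    rw [δ_ι]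
    exact (congrArg _ hy).trans (ι_trans a (i + 1) hm e)
  · rintro ⟨y, rfl⟩
    obtain ⟨n, e, rfl⟩ := exists_rep a i y
    rw [δ_ι, map_ι, Abelian.Ext.comp_assoc_of_third_deg_zero]
    have := h.shortExact.extClass_comp
    dsimp at this
    rw [this, Abelian.Ext.comp_zero, _root_.map_zero]

end connecting

lemma exists_pow_smul (z : LC a i M) : ∃ n : ℕ, ∀ r ∈ a ^ n, r • z = 0 := by
  obtain ⟨n, e, rfl⟩ := exists_rep a i z
  refine ⟨n, fun r hr => ?_⟩
  rw [← _root_.map_smul, ext_smul_eq_zero_left, _root_.map_zero]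
  intro x
  obtain ⟨x, rfl⟩ := Ideal.Quotient.mk_surjective x
  exact Ideal.Quotient.eq_zero_iff_mem.2 (Ideal.mul_mem_right _ _ hr)

lemma subsingleton_of_injective (hM : Module.Injective R M) : Subsingleton (LC a (i + 1) M) := by
  refine subsingleton_of_forall_eq 0 fun z => ?_
  obtain ⟨n, e, rfl⟩ := exists_rep a (i + 1) z
  rw [(ExtVanish.of_injective (M := R ⧸ a ^ n) i hM).elim e 0, _root_.map_zero]

def congr (e : M ≃ₗ[R] N) : LC a i M ≃ₗ[R] LC a i N :=
  LinearEquiv.ofLinearMap (map a i e.toLinearMap) (map a i e.symm.toLinearMap)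
    (by rw [← map_comp, ← map_id]; congr 1; ext; simp)
    (by rw [← map_comp, ← map_id]; congr 1; ext; simp)

end LC

/-- The submodule of elements killed by a power of `a`. -/
def tors (a : Ideal R) (M : Type u) [AddCommGroup M] [Module R M] : Submodule R M where
  carrier := {m | ∃ n : ℕ, ∀ r ∈ a ^ n, r • m = 0}
  zero_mem' := ⟨0, fun r _ => smul_zero r⟩
  add_mem' := by
    rintro x y ⟨n, hn⟩ ⟨m, hm⟩
    refine ⟨n + m, fun r hr => ?_⟩
    rw [smul_add, hn r (Ideal.pow_le_pow_right (by lia) hr),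
      hm r (Ideal.pow_le_pow_right (by lia) hr), add_zero]
  smul_mem' := by
    rintro c x ⟨n, hn⟩
    exact ⟨n, fun r hr => by rw [smul_comm, hn r hr, smul_zero]⟩

lemma mem_tors {a : Ideal R} {M : Type u} [AddCommGroup M] [Module R M] {m : M} :
    m ∈ tors a M ↔ ∃ n : ℕ, ∀ r ∈ a ^ n, r • m = 0 := Iff.rfl

namespace LC
variable (a : Ideal R) {M N : Type u} [AddCommGroup M] [Module R M]
  [AddCommGroup N] [Module R N]

variable (M) in
def evTerm (n : ℕ) : term a 0 M n →ₗ[R] M where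
  toFun e := (Abelian.Ext.linearEquiv₀ (R := R) e).hom (Ideal.Quotient.mk (a ^ n) 1)
  map_add' x y := by rw [_root_.map_add]; rfl
  map_smul' r x := by rw [_root_.map_smul]; rfl

lemma evTerm_mk₀ (n : ℕ) (φ : ModuleCat.of R (R ⧸ a ^ n) ⟶ ModuleCat.of R M) :
    evTerm a M n (Abelian.Ext.mk₀ φ) = φ (Ideal.Quotient.mk (a ^ n) 1) := by
  have h1 : Abelian.Ext.linearEquiv₀ (R := R) (Abelian.Ext.mk₀ φ) = φ :=
      (Abelian.Ext.linearEquiv₀ (R := R)).apply_symm_apply φ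
  change (Abelian.Ext.linearEquiv₀ (R := R) (Abelian.Ext.mk₀ φ)).hom _ = _
  rw [h1]

/-- Evaluation at `1`. -/
def ev : LC a 0 M →ₗ[R] M :=
  Module.DirectLimit.lift R ℕ _ _ (evTerm a M) (by
    intro n m h e
    obtain ⟨φ, rfl⟩ := (Abelian.Ext.mk₀_bijective _ _).2 e
    rw [trans_apply, Abelian.Ext.mk₀_comp_mk₀, evTerm_mk₀, evTerm_mk₀]
    rfl)

lemma ev_ι (n : ℕ) (φ : ModuleCat.of R (R ⧸ a ^ n) ⟶ ModuleCat.of R M) :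
    ev a (ι a 0 n (Abelian.Ext.mk₀ φ)) = φ (Ideal.Quotient.mk (a ^ n) 1) :=
  (Module.DirectLimit.lift_of _ _ _).trans (evTerm_mk₀ a n φ)

lemma ev_injective : Function.Injective (ev a : LC a 0 M →ₗ[R] M) := by
  rw [← LinearMap.ker_eq_bot, LinearMap.ker_eq_bot']
  intro z hz
  obtain ⟨n, e, rfl⟩ := exists_rep a 0 z
  obtain ⟨φ, rfl⟩ := (Abelian.Ext.mk₀_bijective _ _).2 e
  rw [ev_ι] at hz
  have : φ = 0 := by
    ext
    exact hz
  rw [this, Abelian.Ext.mk₀_zero, _root_.map_zero]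

lemma range_ev : LinearMap.range (ev a : LC a 0 M →ₗ[R] M) = tors a M := by
  ext m
  constructor
  · rintro ⟨z, rfl⟩
    obtain ⟨n, hn⟩ := exists_pow_smul a 0 z
    exact ⟨n, fun r hr => by rw [← _root_.map_smul, hn r hr, _root_.map_zero]⟩
  · rintro ⟨n, hn⟩
    refine ⟨ι a 0 n (Abelian.Ext.mk₀ (ModuleCat.ofHom (Submodule.liftQ (a ^ n)
      (LinearMap.toSpanSingleton R M m) fun r hr => hn r hr))), ?_⟩
    rw [ev_ι]
    change (1 : R) • m = m
    exact one_smul _ _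

lemma ev_map (f : M →ₗ[R] N) (z : LC a 0 M) : ev a (map a 0 f z) = f (ev a z) := by
  obtain ⟨n, e, rfl⟩ := exists_rep a 0 z
  obtain ⟨φ, rfl⟩ := (Abelian.Ext.mk₀_bijective _ _).2 e
  rw [map_ι, Abelian.Ext.mk₀_comp_mk₀, ev_ι, ev_ι]
  rfl

def zeroEquiv : LC a 0 M ≃ₗ[R] tors a M :=
  LinearEquiv.ofInjective (ev a) (ev_injective a) ≪≫ₗ LinearEquiv.ofEq _ _ (range_ev a)

lemma zeroEquiv_apply (z : LC a 0 M) : (zeroEquiv a z : M) = ev a z := rfl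

variable (M) in
/-- Comparison with Mathlib's local cohomology. -/
lemma nonempty_equiv (i : ℕ) (M : ModuleCat.{u} R) :
    Nonempty (LC a i M ≃ₗ[R] (localCohomology a i).obj M) := by
  let F := localCohomology.diagram (localCohomology.idealPowersDiagram a) i
  let G : (ℕᵒᵖ)ᵒᵖ ⥤ ModuleCat.{u} R := F ⋙ (evaluation _ _).obj M
  have : Limits.PreservesFilteredColimitsOfSize.{0, 0} (forget (ModuleCat.{u} R)) :=
    Limits.preservesSmallestFilteredColimits_of_preservesFilteredColimits _
  have : Limits.PreservesColimit G (forget (ModuleCat.{u} R)) :=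
    (Limits.PreservesFilteredColimitsOfSize.preserves_filtered_colimits
      (F := forget (ModuleCat.{u} R)) ((ℕᵒᵖ)ᵒᵖ)).preservesColimit
  let e0 : (localCohomology a i).obj M ≅ Limits.colimit G :=
    Limits.colimitObjIsoColimitCompEvaluation F M
  let c : ∀ n, term a i M n ≃ₗ[R] G.obj (Opposite.op (Opposite.op n)) := fun n =>
    (ExtBridge.equiv (ModuleCat.of R (R ⧸ a ^ n)) M i).symm
  have hc : ∀ n m (h : n ≤ m) x, c m (trans a i M n m h x) =
      G.map (homOfLE h).op.op (c n x) := by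
    intro n m h x
    refine (LinearEquiv.symm_apply_eq _).2 ?_
    refine Eq.trans ?_ (ExtBridge.equiv_naturality M i (fac a h) (c n x)).symm
    rw [show ExtBridge.equiv (ModuleCat.of R (R ⧸ a ^ n)) M i (c n x) = x from
      LinearEquiv.apply_symm_apply _ x]
    rfl
  let L : LC a i M →ₗ[R] (Limits.colimit G : ModuleCat.{u} R) :=
    Module.DirectLimit.lift R ℕ _ _ (fun n =>
      (Limits.colimit.ι G (Opposite.op (Opposite.op n))).hom ∘ₗ (c n).toLinearMap) (by
      intro n m h x
      change Limits.colimit.ι G _ (c m (trans a i M n m h x)) = Limits.colimit.ι G _ (c n x)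
      rw [hc]
      exact Limits.Concrete.colimit_rep_eq_of_exists G _ _
        ⟨Opposite.op (Opposite.op m), 𝟙 _, (homOfLE h).op.op, by simp⟩)
  have hL : ∀ n x, L (ι a i n x) = Limits.colimit.ι G (Opposite.op (Opposite.op n)) (c n x) :=
    fun n x => Module.DirectLimit.lift_of _ _ _
  refine ⟨LinearEquiv.ofBijective L ⟨?_, ?_⟩ ≪≫ₗ e0.symm.toLinearEquiv⟩
  · rw [← LinearMap.ker_eq_bot, LinearMap.ker_eq_bot']
    intro z hz
    obtain ⟨n, x, rfl⟩ := exists_rep a i z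
    rw [hL] at hz
    have := (Limits.Concrete.colimit_rep_eq_iff_exists G (i := Opposite.op (Opposite.op n))
      (j := Opposite.op (Opposite.op n)) (c n x) 0).1 (hz.trans (_root_.map_zero _).symm)
    obtain ⟨k, f, g, hk⟩ := this
    have hh : n ≤ k.unop.unop := leOfHom f.unop.unop
    have : c _ (trans a i M n _ hh x) = 0 := by
      rw [hc]
      exact hk.trans (_root_.map_zero (G.map g).hom)
    rw [LinearEquiv.map_eq_zero_iff] at this
    rw [← ι_trans a i hh, this, _root_.map_zero]
  · intro y
    obtain ⟨⟨⟨n⟩⟩, y, rfl⟩ := Limits.Concrete.colimit_exists_rep G y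
    exact ⟨ι a i n ((c n).symm y), by rw [hL, LinearEquiv.apply_symm_apply]⟩

end LC
end

section
variable {R : Type u} [CommRing R]

lemma exists_injective_embedding (M : Type u) [AddCommGroup M] [Module R M] :
    ∃ (I : ModuleCat.{u} R) (f : M →ₗ[R] I), Module.Injective R I ∧ Function.Injective f :=
  ⟨Injective.under (ModuleCat.of R M), (Injective.ι (ModuleCat.of R M)).hom,
    (Module.injective_iff_injective_object R _).2
      (inferInstanceAs (Injective (Injective.under (ModuleCat.of R M)))),
    (ModuleCat.mono_iff_injective _).1 inferInstance⟩

section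
variable {A B I J : Type u} [AddCommGroup A] [Module R A] [AddCommGroup B] [Module R B]
  [AddCommGroup I] [Module R I] [AddCommGroup J] [Module R J]

lemma Module.Injective.exists_comp_eq (hI : Module.Injective R I) (f : A →ₗ[R] B)
    (hf : Function.Injective f) (g : A →ₗ[R] I) : ∃ h : B →ₗ[R] I, h ∘ₗ f = g := by
  obtain ⟨h, hh⟩ := hI.out f hf g
  exact ⟨h, LinearMap.ext hh⟩

lemma Module.Injective.of_retract (hI : Module.Injective R I) (s : J →ₗ[R] I) (r : I →ₗ[R] J)
    (h : r ∘ₗ s = LinearMap.id) : Module.Injective R J where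
  out X Y _ _ _ _ f hf g := by
    obtain ⟨k, hk⟩ := hI.out f hf (s ∘ₗ g)
    refine ⟨r ∘ₗ k, fun x => ?_⟩
    rw [LinearMap.comp_apply, hk]
    exact LinearMap.congr_fun h (g x)

lemma Module.Injective.congr (hI : Module.Injective R I) (e : I ≃ₗ[R] J) :
    Module.Injective R J :=
  hI.of_retract e.symm.toLinearMap e.toLinearMap (by ext; simp)

/-- A surjection with injective kernel splits. -/
lemma IsSES.exists_section {f : I →ₗ[R] A} {g : A →ₗ[R] B} (h : IsSES f g)
    (hI : Module.Injective R I) : ∃ s : B →ₗ[R] A, g ∘ₗ s = LinearMap.id :=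
  ExtVanish.exists_lift h (ExtVanish.of_injective 0 hI) LinearMap.id

lemma IsSES.injective_right {f : I →ₗ[R] A} {g : A →ₗ[R] B} (h : IsSES f g)
    (hI : Module.Injective R I) (hA : Module.Injective R A) : Module.Injective R B := by
  obtain ⟨s, hs⟩ := h.exists_section hI
  exact hA.of_retract s g hs

variable (C : Type u) [AddCommGroup C] [Module R C] in
lemma IsSES.hom_of_injective {f : I →ₗ[R] A} {g : A →ₗ[R] B} (h : IsSES f g)
    (hE : ExtVanish R 1 C I) :
    IsSES (LinearMap.compRight R f : (C →ₗ[R] I) →ₗ[R] _) (LinearMap.compRight R g) where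
  inj a b hab := LinearMap.ext fun x => h.inj (LinearMap.congr_fun hab x)
  exact φ := by
    constructor
    · intro hφ
      have : ∀ x, φ x ∈ LinearMap.range f := fun x => (h.exact _).1 (LinearMap.congr_fun hφ x)
      refine ⟨(LinearEquiv.ofInjective f h.inj).symm.toLinearMap ∘ₗ φ.codRestrict _ this, ?_⟩
      ext x
      exact congrArg Subtype.val
        ((LinearEquiv.ofInjective f h.inj).apply_symm_apply (φ.codRestrict _ this x))
    · rintro ⟨ψ, rfl⟩
      ext x
      exact h.exact.apply_apply_eq_zero _
  surj φ := ExtVanish.exists_lift h hE φ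

end

section lc
variable (a : Ideal R) {i : ℕ} {A B D M N I : Type u} [AddCommGroup A] [AddCommGroup B]
  [AddCommGroup D] [Module R A] [Module R B] [Module R D] [AddCommGroup M] [Module R M]
  [AddCommGroup N] [Module R N] [AddCommGroup I] [Module R I]
  {f : A →ₗ[R] B} {g : B →ₗ[R] D}

namespace LC

lemma sub_mid (h : IsSES f g) (h1 : Subsingleton (LC a i A)) (h2 : Subsingleton (LC a i D)) :
    Subsingleton (LC a i B) := by
  refine subsingleton_of_forall_eq 0 fun z => ?_
  obtain ⟨y, rfl⟩ := (exact_mid a i h z).1 (Subsingleton.elim _ _)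
  rw [Subsingleton.elim y 0, _root_.map_zero]

lemma sub_right (h : IsSES f g) (h1 : Subsingleton (LC a i B))
    (h2 : Subsingleton (LC a (i + 1) A)) : Subsingleton (LC a i D) := by
  refine subsingleton_of_forall_eq 0 fun z => ?_
  obtain ⟨y, rfl⟩ := (exact_right a i h z).1 (Subsingleton.elim _ _)
  rw [Subsingleton.elim y 0, _root_.map_zero]

lemma sub_left (h : IsSES f g) (h1 : Subsingleton (LC a i D))
    (h2 : Subsingleton (LC a (i + 1) B)) : Subsingleton (LC a (i + 1) A) := by
  refine subsingleton_of_forall_eq 0 fun z => ?_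
  obtain ⟨y, rfl⟩ := (exact_left a i h z).1 (Subsingleton.elim _ _)
  rw [Subsingleton.elim y 0, _root_.map_zero]

lemma sub_congr (e : M ≃ₗ[R] N) : Subsingleton (LC a i M) ↔ Subsingleton (LC a i N) :=
  (congr a i e).toEquiv.subsingleton_congr

lemma map_bijective (h : IsSES f g) (h1 : Subsingleton (LC a (i + 1) A))
    (h2 : Subsingleton (LC a (i + 2) A)) : Function.Bijective (map a (i + 1) g) := by
  constructor
  · rw [← LinearMap.ker_eq_bot, LinearMap.ker_eq_bot']
    intro z hz
    obtain ⟨y, rfl⟩ := (exact_mid a (i + 1) h z).1 hz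
    rw [Subsingleton.elim y 0, _root_.map_zero]
  · intro z
    exact (exact_right a (i + 1) h z).1 (Subsingleton.elim _ _)

lemma subsingleton_of_subsingleton [Subsingleton M] : Subsingleton (LC a i M) := by
  refine subsingleton_of_forall_eq 0 fun z => ?_
  have := map_id a i (M := M)
  rw [show (LinearMap.id : M →ₗ[R] M) = 0 from Subsingleton.elim _ _, map_zero] at this
  exact (LinearMap.congr_fun this z).symm

lemma subsingleton_of_smul_bijective {x : R} (hx : x ∈ a)
    (h : Function.Bijective (LinearMap.lsmul R M x)) : Subsingleton (LC a i M) := by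
  refine subsingleton_of_forall_eq 0 fun z => ?_
  have hinj : Function.Injective (LinearMap.lsmul R (LC a i M) x) := by
    have := (congr a i (LinearEquiv.ofBijective _ h)).injective
    intro z w hzw
    apply this
    exact (map_lsmul a i x z).trans (hzw.trans (map_lsmul a i x w).symm)
  obtain ⟨n, hn⟩ := exists_pow_smul a i z
  have h1 : x ^ n • z = 0 := hn _ (Ideal.pow_mem_pow hx n)
  clear hn
  induction n with
  | zero => simpa using h1
  | succ n ih =>
    apply ih
    apply hinj
    rw [_root_.map_zero, LinearMap.lsmul_apply, smul_smul, ← pow_succ', h1]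

lemma zero_subsingleton_iff : Subsingleton (LC a 0 M) ↔ tors a M = ⊥ := by
  rw [(zeroEquiv a).toEquiv.subsingleton_congr]
  exact Submodule.subsingleton_iff_eq_bot

end LC

lemma tors_eq_top_of_injective (hM : tors a N = ⊤) (f : M →ₗ[R] N) (hf : Function.Injective f) :
    tors a M = ⊤ := by
  rw [eq_top_iff]
  intro m _
  obtain ⟨n, hn⟩ := mem_tors.1 (hM ▸ Submodule.mem_top : f m ∈ tors a N)
  exact ⟨n, fun r hr => hf (by rw [map_smul, hn r hr, map_zero])⟩

lemma tors_eq_top_of_surjective (hM : tors a M = ⊤) (f : M →ₗ[R] N)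
    (hf : Function.Surjective f) : tors a N = ⊤ := by
  rw [eq_top_iff]
  intro m _
  obtain ⟨m, rfl⟩ := hf m
  obtain ⟨n, hn⟩ := mem_tors.1 (hM ▸ Submodule.mem_top : m ∈ tors a M)
  exact ⟨n, fun r hr => by rw [← map_smul, hn r hr, map_zero]⟩

lemma map_mem_tors (f : M →ₗ[R] N) {m : M} (hm : m ∈ tors a M) : f m ∈ tors a N := by
  obtain ⟨n, hn⟩ := hm
  exact ⟨n, fun r hr => by rw [← map_smul, hn r hr, map_zero]⟩

lemma tors_tors : tors a (tors a M) = ⊤ := by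
  rw [eq_top_iff]
  rintro ⟨m, n, hn⟩ _
  exact ⟨n, fun r hr => Subtype.ext (hn r hr)⟩

lemma tors_LC (i : ℕ) : tors a (LC a i M) = ⊤ := by
  rw [eq_top_iff]
  intro z _
  exact LC.exists_pow_smul a i z

lemma exists_pow_smul_of_fg [Module.Finite R M] (hM : tors a M = ⊤) :
    ∃ n : ℕ, ∀ r ∈ a ^ n, ∀ m : M, r • m = 0 := by
  obtain ⟨s, hs⟩ := (Module.Finite.fg_top : (⊤ : Submodule R M).FG)
  have h1 : ∀ m : M, ∃ n : ℕ, ∀ r ∈ a ^ n, r • m = 0 := fun m =>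
    mem_tors.1 (hM ▸ Submodule.mem_top)
  choose n hn using h1
  refine ⟨s.sup n, fun r hr m => ?_⟩
  have : m ∈ Submodule.span R (s : Set M) := hs ▸ Submodule.mem_top
  induction this using Submodule.span_induction with
  | mem x hx => exact hn x r (Ideal.pow_le_pow_right (Finset.le_sup hx) hr)
  | zero => exact smul_zero r
  | add x y _ _ hx hy => rw [smul_add, hx, hy, add_zero]
  | smul c x _ hx => rw [smul_comm, hx, smul_zero]

lemma tors_hom_eq_top [Module.Finite R M] (hI : tors a I = ⊤) : tors a (M →ₗ[R] I) = ⊤ := by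
  rw [eq_top_iff]
  intro φ _
  have : tors a (LinearMap.range φ) = ⊤ :=
    tors_eq_top_of_injective a hI (LinearMap.range φ).subtype Subtype.val_injective
  obtain ⟨n, hn⟩ := exists_pow_smul_of_fg a this
  refine ⟨n, fun r hr => ?_⟩
  ext m
  exact congrArg Subtype.val (hn r hr ⟨φ m, m, rfl⟩)

lemma tors_quotient_tors (hB : ∀ n : ℕ, (a ^ n).FG) : tors a (M ⧸ tors a M) = ⊥ := by
  rw [eq_bot_iff]
  intro z hz
  obtain ⟨m, rfl⟩ := Submodule.mkQ_surjective _ z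
  obtain ⟨n, hn⟩ := hz
  rw [Submodule.mem_bot, ← LinearMap.mem_ker, Submodule.ker_mkQ]
  have h1 : ∀ r ∈ a ^ n, r • m ∈ tors a M := fun r hr => by
    rw [← Submodule.ker_mkQ (tors a M), LinearMap.mem_ker, map_smul]
    exact hn r hr
  let φ : (a ^ n : Ideal R) →ₗ[R] tors a M :=
    ((LinearMap.toSpanSingleton R M m) ∘ₗ (a ^ n).subtype).codRestrict _ fun r => h1 r r.2
  have : Module.Finite R (a ^ n : Ideal R) := Module.Finite.iff_fg.2 (hB n)
  have h2 : φ ∈ tors a ((a ^ n : Ideal R) →ₗ[R] tors a M) := by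
    rw [tors_hom_eq_top a (tors_tors a)]; trivial
  obtain ⟨k, hk⟩ := h2
  refine ⟨k + n, fun r hr => ?_⟩
  rw [pow_add] at hr
  induction hr using Submodule.mul_induction_on' with
  | mem_mul_mem s hs t ht =>
    have := congrArg Subtype.val (LinearMap.congr_fun (hk s hs) ⟨t, ht⟩)
    rw [mul_smul]; exact this
  | add x _ y _ hx hy => rw [add_smul, hx, hy, add_zero]

variable [IsNoetherianRing R]

lemma injective_tors (hI : Module.Injective R I) : Module.Injective R (tors a I) := by
  apply Module.Baer.injective
  intro J φ
  have h2 : φ ∈ tors a (J →ₗ[R] tors a I) := by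
    rw [tors_hom_eq_top a (tors_tors a)]; trivial
  obtain ⟨n, hn⟩ := h2
  obtain ⟨k, hk⟩ := Ideal.exists_pow_inf_eq_pow_smul (M := R) a J
  have hk := hk (k + n) (by lia)
  obtain ⟨b, hb⟩ : ∃ b : Ideal R, b = a ^ (k + n) := ⟨_, rfl⟩
  have hker : ∀ j : J, (j : R) ∈ b → φ j = 0 := by
    intro j hj
    have h1 : (j : R) ∈ a ^ n • J := by
      have : (j : R) ∈ a ^ (k + n) • (⊤ : Submodule R R) ⊓ J :=
        ⟨by rw [smul_eq_mul, Ideal.mul_top, ← hb]; exact hj, j.2⟩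
      rw [hk, Nat.add_sub_cancel_left] at this
      exact Submodule.smul_mono le_rfl inf_le_right this
    obtain ⟨j, hjJ⟩ := j
    change j ∈ _ at h1
    refine Submodule.smul_induction_on' (p := fun j _ => ∀ h : j ∈ J, φ ⟨j, h⟩ = 0) h1 ?_ ?_ hjJ
    · intro r hr s hs h
      exact (map_smul φ r ⟨s, hs⟩).trans (LinearMap.congr_fun (hn r hr) ⟨s, hs⟩)
    · intro x hx y hy h1 h2 h
      have hx' : x ∈ J := Submodule.smul_le_right hx
      have hy' : y ∈ J := Submodule.smul_le_right hy
      have : φ ⟨x + y, h⟩ = φ ⟨x, hx'⟩ + φ ⟨y, hy'⟩ := by rw [← map_add]; rfl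
      rw [this, h1, h2, add_zero]
  let q : J →ₗ[R] R ⧸ b := b.mkQ ∘ₗ J.subtype
  have hq : LinearMap.ker q ≤ LinearMap.ker φ := by
    intro j hj
    refine hker j ?_
    have : b.mkQ (j : R) = 0 := hj
    rwa [← LinearMap.mem_ker, Submodule.ker_mkQ] at this
  let φ' : (J ⧸ LinearMap.ker q) →ₗ[R] tors a I := (LinearMap.ker q).liftQ φ hq
  let q' : (J ⧸ LinearMap.ker q) →ₗ[R] R ⧸ b := (LinearMap.ker q).liftQ q le_rfl
  have hq' : Function.Injective q' := by
    rw [← LinearMap.ker_eq_bot]; exact Submodule.ker_liftQ_eq_bot _ _ _ le_rfl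
  obtain ⟨ψ, hψ⟩ := hI.exists_comp_eq q' hq' ((tors a I).subtype ∘ₗ φ')
  have hψt : ∀ z, ψ z ∈ tors a I := by
    intro z
    refine map_mem_tors a ψ ⟨k + n, fun r hr => ?_⟩
    rw [← hb] at hr
    obtain ⟨z, rfl⟩ := Ideal.Quotient.mk_surjective z
    exact Ideal.Quotient.eq_zero_iff_mem.2 (Ideal.mul_mem_right _ _ hr)
  refine ⟨(ψ ∘ₗ b.mkQ).codRestrict _ fun z => hψt _, fun x hx => Subtype.ext ?_⟩
  exact LinearMap.congr_fun hψ (Submodule.Quotient.mk ⟨x, hx⟩)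

lemma LC.subsingleton_of_tors_eq_top (hM : tors a M = ⊤) : ∀ i, Subsingleton (LC a (i + 1) M) := by
  intro i
  induction i generalizing M with
  | zero =>
    obtain ⟨I, f, hI, hf⟩ := exists_injective_embedding (R := R) M
    have hmem : ∀ m, f m ∈ tors a I := fun m => map_mem_tors a f (hM ▸ Submodule.mem_top)
    have h := IsSES.of_injective (f.codRestrict (tors a I) hmem)
      fun x y hxy => hf (congrArg Subtype.val hxy)
    have hE := LC.subsingleton_of_injective a 0 (injective_tors a hI)
    refine subsingleton_of_forall_eq 0 fun z => ?_
    obtain ⟨y, rfl⟩ := (LC.exact_left a 0 h z).1 (Subsingleton.elim _ _)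
    refine (LC.exact_right a 0 h y).2 ?_
    obtain ⟨e, he⟩ := h.surj (LC.ev a y)
    have he' : e ∈ tors a (tors a I) := by rw [tors_tors]; trivial
    refine ⟨(LC.zeroEquiv a).symm ⟨e, he'⟩, LC.ev_injective a ?_⟩
    rw [LC.ev_map, ← LC.zeroEquiv_apply, LinearEquiv.apply_symm_apply, he]
  | succ i ih =>
    obtain ⟨I, f, hI, hf⟩ := exists_injective_embedding (R := R) M
    have hmem : ∀ m, f m ∈ tors a I := fun m => map_mem_tors a f (hM ▸ Submodule.mem_top)
    have h := IsSES.of_injective (f.codRestrict (tors a I) hmem)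
      fun x y hxy => hf (congrArg Subtype.val hxy)
    exact LC.sub_left a h (ih (tors_eq_top_of_surjective a (tors_tors a) _ h.surj))
      (LC.subsingleton_of_injective a _ (injective_tors a hI))

end lc
end

section
variable {R : Type u} [CommRing R] (a : Ideal R) {i : ℕ} {A B D M N I : Type u}
  [AddCommGroup A] [AddCommGroup B]
  [AddCommGroup D] [Module R A] [Module R B] [Module R D] [AddCommGroup M] [Module R M]
  [AddCommGroup N] [Module R N] [AddCommGroup I] [Module R I]

lemma smul_bijective_of_injective (hI : Module.Injective R I) {x : R}
    (hx : Function.Injective (LinearMap.lsmul R I x)) :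
    Function.Bijective (LinearMap.lsmul R I x) := by
  refine ⟨hx, fun y => ?_⟩
  obtain ⟨r, hr⟩ := hI.exists_comp_eq _ hx LinearMap.id
  refine ⟨r y, ?_⟩
  have := LinearMap.congr_fun hr y
  simpa using this

lemma mem_tors_span_singleton {x : R} {m : M} :
    m ∈ tors (Ideal.span {x}) M ↔ ∃ n : ℕ, x ^ n • m = 0 := by
  rw [mem_tors]
  refine exists_congr fun n => ?_
  rw [Ideal.span_singleton_pow]
  constructor
  · intro h
    exact h _ (Ideal.mem_span_singleton_self _)
  · intro h r hr
    obtain ⟨c, rfl⟩ := Ideal.mem_span_singleton'.1 hr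
    rw [mul_smul, h, smul_zero]

lemma smul_injective_of_tors_eq_bot {x : R} (h : tors (Ideal.span {x}) M = ⊥) :
    Function.Injective (LinearMap.lsmul R M x) := by
  rw [← LinearMap.ker_eq_bot, LinearMap.ker_eq_bot']
  intro m hm
  have : m ∈ tors (Ideal.span {x}) M := mem_tors_span_singleton.2 ⟨1, by simpa using hm⟩
  rwa [h] at this

lemma mem_tors_of_generators {t : Finset R} (ht : Ideal.span (t : Set R) = a) {m : M}
    (h : ∀ x ∈ t, m ∈ tors (Ideal.span {x}) M) : m ∈ tors a M := by
  have h1 : a ≤ Ideal.radical (LinearMap.ker (LinearMap.toSpanSingleton R M m)) := by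
    rw [← ht, Ideal.span_le]
    intro x hx
    obtain ⟨n, hn⟩ := mem_tors_span_singleton.1 (h x hx)
    exact ⟨n, hn⟩
  obtain ⟨n, hn⟩ := Ideal.exists_pow_le_of_le_radical_of_fg h1 ⟨t, ht⟩
  exact ⟨n, fun r hr => hn hr⟩

open scoped Pointwise in
lemma isSES_of_isSMulRegular {x : R} (hx : IsSMulRegular M x) :
    IsSES (LinearMap.lsmul R M x) (Submodule.mkQ (x • ⊤) : M →ₗ[R] QuotSMulTop x M) :=
  ⟨hx, by intro m; simp [Submodule.mem_smul_pointwise_iff_exists], Submodule.mkQ_surjective _⟩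

lemma LC.subsingleton_ker_smul_of_isSMulRegular {x : R} (hx : IsSMulRegular M x)
    (h : Subsingleton (LC a i (QuotSMulTop x M))) :
    Function.Injective (LinearMap.lsmul R (LC a (i + 1) M) x) := by
  have hses := isSES_of_isSMulRegular hx
  rw [← LinearMap.ker_eq_bot, LinearMap.ker_eq_bot']
  intro z hz
  obtain ⟨y, rfl⟩ := (LC.exact_left a i hses z).1 (by rw [LC.map_lsmul]; exact hz)
  rw [h.elim y 0, _root_.map_zero]

variable [IsNoetherianRing R]

lemma LC.subsingleton_hom_of_injective [Module.Finite R M] (hI : Module.Injective R I) (i : ℕ) :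
    Subsingleton (LC a (i + 1) (M →ₗ[R] I)) := by
  classical
  obtain ⟨t, ht⟩ := (IsNoetherian.noetherian a : a.FG)
  suffices H : ∀ s : Finset R, s ⊆ t → ∀ I : ModuleCat.{u} R, Module.Injective R I →
      (∀ x ∈ t, x ∉ s → tors (Ideal.span {x}) I = ⊤) →
      Subsingleton (LC a (i + 1) (M →ₗ[R] I)) from
    H t subset_rfl (ModuleCat.of R I) hI fun x hx hx' => absurd hx hx'
  intro s
  induction s using Finset.induction_on with
  | empty =>
    intro _ I hI h
    refine LC.subsingleton_of_tors_eq_top a (tors_hom_eq_top a ?_) i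
    rw [eq_top_iff]
    intro m _
    exact mem_tors_of_generators a ht fun x hx => by rw [h x hx (by simp)]; trivial
  | insert x s hx ih =>
    intro hs I hI h
    have hJ := injective_tors (Ideal.span {x}) hI
    have hses := IsSES.of_submodule (tors (Ideal.span {x}) I)
    have hQ := hses.injective_right hJ hI
    have hxQ := smul_bijective_of_injective hQ (smul_injective_of_tors_eq_bot
      (tors_quotient_tors (M := I) (Ideal.span {x}) fun n => IsNoetherian.noetherian _))
    refine LC.sub_mid a (hses.hom_of_injective M (ExtVanish.of_injective 0 hJ)) ?_ ?_
    · refine ih (fun y hy => hs (Finset.mem_insert_of_mem hy)) (ModuleCat.of R _) hJ ?_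
      intro y hy hys
      by_cases hxy : y = x
      · subst hxy; exact tors_tors _
      · exact tors_eq_top_of_injective _ (h y hy (by simp [hxy, hys]))
          (tors (Ideal.span {x}) I).subtype Subtype.val_injective
    · refine LC.subsingleton_of_smul_bijective a (x := x)
        (ht ▸ Ideal.subset_span (hs (Finset.mem_insert_self _ _))) ⟨?_, ?_⟩
      · intro φ ψ hφ
        ext m
        exact hxQ.1 (LinearMap.congr_fun hφ m)
      · intro φ
        refine ⟨(LinearEquiv.ofBijective _ hxQ).symm.toLinearMap ∘ₗ φ, ?_⟩
        ext m
        exact (LinearEquiv.ofBijective _ hxQ).apply_symm_apply (φ m)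

lemma exists_regular [Module.Finite R M] (h : tors a M = ⊥) : ∃ x ∈ a, IsSMulRegular M x := by
  have : Subsingleton ((R ⧸ a) →ₗ[R] M) := by
    refine subsingleton_of_forall_eq 0 fun φ => ?_
    have h1 : φ (Ideal.Quotient.mk a 1) = 0 := by
      rw [← Submodule.mem_bot R, ← h]
      refine ⟨1, fun r hr => ?_⟩
      rw [← map_smul, show r • Ideal.Quotient.mk a 1 = 0 from
        Ideal.Quotient.eq_zero_iff_mem.2 (by simpa using hr), map_zero]
    ext
    simpa using h1
  obtain ⟨x, hx, h⟩ := IsSMulRegular.subsingleton_linearMap_iff.1 this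
  exact ⟨x, by rwa [Ideal.annihilator_quotient] at hx, h⟩

lemma LC.map_mkQ_tors_bijective (i : ℕ) :
    Function.Bijective (LC.map a (i + 1) (tors a M).mkQ) :=
  LC.map_bijective a (IsSES.of_submodule _)
    (LC.subsingleton_of_tors_eq_top a (tors_tors a) _)
    (LC.subsingleton_of_tors_eq_top a (tors_tors a) _)

lemma LC.subsingleton_of_supportDim_lt [Module.Finite R M]
    (h : Module.supportDim R M < (i : WithBot ℕ∞)) : Subsingleton (LC a i M) := by
  induction i generalizing M with
  | zero =>
    have : Subsingleton M := by
      rw [← Module.supportDim_eq_bot_iff_subsingleton R]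
      by_contra hb
      obtain ⟨n, hn⟩ := WithBot.ne_bot_iff_exists.1 hb
      rw [← hn] at h
      exact absurd h (by rw [not_lt]; exact WithBot.coe_le_coe.2 bot_le)
    exact LC.subsingleton_of_subsingleton a
  | succ i ih =>
    suffices H : Subsingleton (LC a (i + 1) (M ⧸ tors a M)) from
      (LC.map_mkQ_tors_bijective (M := M) a i).1.subsingleton
    obtain ⟨x, hxa, hx⟩ := exists_regular a
      (tors_quotient_tors (M := M) a fun n => IsNoetherian.noetherian _)
    have hd : Module.supportDim R (QuotSMulTop x (M ⧸ tors a M)) < (i : WithBot ℕ∞) := by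
      have h1 := Module.supportDim_quotSMulTop_succ_le_of_notMem_minimalPrimes (M := M ⧸ tors a M)
        (x := x) fun _ => hx.notMem_of_mem_minimalPrimes
      have h2 := Module.supportDim_le_of_surjective _ (Submodule.mkQ_surjective (tors a M))
      have h3 := (h1.trans h2).trans_lt h
      push_cast at h3
      exact lt_of_add_lt_add_right h3
    have hinj := LC.subsingleton_ker_smul_of_isSMulRegular a hx (ih hd)
    refine subsingleton_of_forall_eq 0 fun z => ?_
    obtain ⟨n, hn⟩ := LC.exists_pow_smul a _ z
    have h1 : x ^ n • z = 0 := hn _ (Ideal.pow_mem_pow hxa n)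
    clear hn
    induction n with
    | zero => simpa using h1
    | succ n ihn =>
      apply ihn
      apply hinj
      rw [_root_.map_zero, LinearMap.lsmul_apply, smul_smul, ← pow_succ', h1]

/-- Classes in `Ext` out of a finitely generated module come from finitely generated
submodules. -/
lemma ext_exists_fg_submodule (A : Type u) [AddCommGroup A] [Module R A] [Module.Finite R A]
    (e : Abelian.Ext (ModuleCat.of R A) (ModuleCat.of R M) i) :
    ∃ (S : Submodule R M) (_ : S.FG) (e' : Abelian.Ext (ModuleCat.of R A) (ModuleCat.of R S) i),
      e'.comp (Abelian.Ext.mk₀ (ModuleCat.ofHom S.subtype)) (add_zero i) = e := by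
  induction i generalizing A with
  | zero =>
    obtain ⟨φ, rfl⟩ := (Abelian.Ext.mk₀_bijective _ _).2 e
    refine ⟨LinearMap.range φ.hom, Module.Finite.iff_fg.1 inferInstance,
      Abelian.Ext.mk₀ (ModuleCat.ofHom φ.hom.rangeRestrict), ?_⟩
    rw [Abelian.Ext.mk₀_comp_mk₀]
    rfl
  | succ i ih =>
    obtain ⟨n, f, hf⟩ := Module.Finite.exists_fin' R A
    obtain ⟨g, hg⟩ : ∃ g : (Fin n →₀ R) →ₗ[R] A, Function.Surjective g :=
      ⟨f ∘ₗ (Finsupp.linearEquivFunOnFinite R R (Fin n)).toLinearMap,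
        hf.comp (LinearEquiv.surjective _)⟩
    let P := ULift.{u} (Fin n) →₀ R
    obtain ⟨g, hg⟩ : ∃ g : P →ₗ[R] A, Function.Surjective g :=
      ⟨g ∘ₗ (Finsupp.domLCongr Equiv.ulift).toLinearMap, hg.comp (LinearEquiv.surjective _)⟩
    have h := IsSES.of_surjective g hg
    obtain ⟨y, rfl⟩ := Abelian.Ext.contravariant_sequence_exact₃ h.shortExact _ e
      ((ExtVanish.of_projective (M := P) (N := M) i).elim _ _) (add_comm 1 i)
    obtain ⟨S, hS, e', rfl⟩ := ih _ y
    refine ⟨S, hS, h.shortExact.extClass.comp e' (add_comm 1 i), ?_⟩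
    rw [Abelian.Ext.comp_assoc_of_third_deg_zero]

lemma LC.subsingleton_of_fg_submodules (h : ∀ S : Submodule R M, S.FG → Subsingleton (LC a i S)) :
    Subsingleton (LC a i M) := by
  refine subsingleton_of_forall_eq 0 fun z => ?_
  obtain ⟨n, e, rfl⟩ := LC.exists_rep a i z
  obtain ⟨S, hS, e, rfl⟩ := ext_exists_fg_submodule _ e
  rw [← LC.map_ι]
  rw [(h S hS).elim (LC.ι a i n e) 0, _root_.map_zero]

lemma LC.subsingleton_of_annihilator_le [Module.Finite R A]
    (hann : Module.annihilator R A ≤ Module.annihilator R M)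
    (h : Module.supportDim R A < (i : WithBot ℕ∞)) : Subsingleton (LC a i M) := by
  refine LC.subsingleton_of_fg_submodules a fun S hS => ?_
  have : Module.Finite R S := Module.Finite.iff_fg.2 hS
  refine LC.subsingleton_of_supportDim_lt a (lt_of_le_of_lt ?_ h)
  have hsub : Module.support R S ⊆ Module.support R A := by
    rw [Module.support_eq_zeroLocus, Module.support_eq_zeroLocus]
    refine PrimeSpectrum.zeroLocus_anti_mono (SetLike.coe_subset_coe.2 (hann.trans ?_))
    intro r hr
    rw [Module.mem_annihilator] at hr ⊢
    exact fun s => Subtype.ext (hr s)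
  exact Order.krullDim_le_of_strictMono (fun p => ⟨p.1, hsub p.2⟩) fun _ _ h => h

end

section
variable {R : Type u} [CommRing R] (a : Ideal R) {i : ℕ} {A B D M N : Type u}
  [AddCommGroup A] [AddCommGroup B]
  [AddCommGroup D] [Module R A] [Module R B] [Module R D] [AddCommGroup M] [Module R M]
  [AddCommGroup N] [Module R N] {f : A →ₗ[R] B} {g : B →ₗ[R] D}

lemma IsSES.isArtinian (h : IsSES f g) (hA : IsArtinian R A) (hD : IsArtinian R D) :
    IsArtinian R B :=
  isArtinian_of_range_eq_ker f g (LinearMap.exact_iff.1 h.exact).symm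

/-- Melkersson's criterion for one element. -/
lemma isArtinian_of_ker_smul {x : R} (htor : ∀ m : M, ∃ n : ℕ, x ^ n • m = 0)
    (h : IsArtinian R (LinearMap.ker (LinearMap.lsmul R M x))) : IsArtinian R M := by
  rw [← monotone_stabilizes_iff_artinian]
  intro F
  let N : ℕ → Submodule R M := fun k => OrderDual.ofDual (F k)
  have hN : ∀ {k l}, k ≤ l → N l ≤ N k := fun hkl => F.monotone hkl
  let K := LinearMap.ker (LinearMap.lsmul R M x)
  let V : ℕ → ℕ → Submodule R K := fun k j =>
    ((N k).map (LinearMap.lsmul R M (x ^ j))).comap K.subtype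
  have hV : ∀ {k l j j'}, k ≤ l → j ≤ j' → V l j' ≤ V k j := by
    intro k l j j' hkl hj v hv
    obtain ⟨n, hn, hnv⟩ := hv
    refine ⟨x ^ (j' - j) • n, (N k).smul_mem _ (hN hkl hn), ?_⟩
    rw [LinearMap.lsmul_apply, smul_smul, ← pow_add, Nat.add_sub_cancel' hj]
    exact hnv
  obtain ⟨k0, hk0⟩ := monotone_stabilizes_iff_artinian.2 h
    ⟨fun k => OrderDual.toDual (V k k), fun k l hkl => hV hkl hkl⟩
  have hk0 : ∀ m, k0 ≤ m → V k0 k0 = V m m := hk0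
  have h1 : ∀ j, ∃ k1, ∀ k, k1 ≤ k → V k1 j = V k j := fun j =>
    monotone_stabilizes_iff_artinian.2 h
      ⟨fun k => OrderDual.toDual (V k j), fun k l hkl => hV hkl le_rfl⟩
  choose k1 hk1 using h1
  let L := max k0 ((Finset.range k0).sup k1)
  have key : ∀ j k, L ≤ k → V L j ≤ V k j := by
    intro j k hk
    by_cases hj : j < k0
    · have : k1 j ≤ L := (Finset.le_sup (Finset.mem_range.2 hj)).trans (le_max_right _ _)
      rw [← hk1 j L this, ← hk1 j k (this.trans hk)]
    · push Not at hj
      calc V L j ≤ V k0 k0 := hV (le_max_left _ _) hj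
        _ = V (max k j) (max k j) := hk0 _ (hj.trans (le_max_right _ _))
        _ ≤ V k j := hV (le_max_left _ _) (le_max_right _ _)
  refine ⟨L, fun k hk => le_antisymm (hN hk : N k ≤ N L) (?_ : N L ≤ N k) |>.symm⟩
  have : ∀ j, ∀ n ∈ N L, x ^ j • n = 0 → n ∈ N k := by
    intro j
    induction j with
    | zero => intro n _ h0; rw [pow_zero, one_smul] at h0; rw [h0]; exact zero_mem _
    | succ j ih =>
      intro n hn h0
      obtain ⟨n', hn', he⟩ := key j k hk (show (⟨x ^ j • n, by
        rw [LinearMap.mem_ker, LinearMap.lsmul_apply, smul_smul, ← pow_succ', h0]⟩ : K) ∈ V L j from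
          ⟨n, hn, rfl⟩)
      have he : x ^ j • n' = x ^ j • n := he
      have : n - n' ∈ N k := ih _ (sub_mem hn (hN hk hn')) (by rw [smul_sub, he, sub_self])
      simpa using add_mem this hn'
  intro n hn
  obtain ⟨j, hj⟩ := htor n
  exact this j n hn hj

lemma LC.isArtinian_succ_of_regular {x : R} (hxa : x ∈ a) (hx : IsSMulRegular M x)
    (h : IsArtinian R (LC a i (QuotSMulTop x M))) : IsArtinian R (LC a (i + 1) M) := by
  refine isArtinian_of_ker_smul (x := x) (fun z => ?_) ?_
  · obtain ⟨n, hn⟩ := exists_pow_smul a _ z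
    exact ⟨n, hn _ (Ideal.pow_mem_pow hxa n)⟩
  · have hses := isSES_of_isSMulRegular hx
    have hmem : ∀ y, LC.δ a i hses y ∈
        LinearMap.ker (LinearMap.lsmul R (LC a (i + 1) M) x) := fun y => by
      exact LinearMap.mem_ker.2 ((LC.map_lsmul a (i + 1) x _).symm.trans
        ((LC.exact_left a i hses _).2 ⟨y, rfl⟩))
    refine isArtinian_of_surjective (LC a i (QuotSMulTop x M))
      ((LC.δ a i hses).codRestrict _ hmem) ?_
    rintro ⟨z, hz⟩
    obtain ⟨y, rfl⟩ := (LC.exact_left a i hses z).1 (by rw [LC.map_lsmul]; exact hz)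
    exact ⟨y, rfl⟩

lemma supportDim_quotSMulTop_tors_lt [Module.Finite R M] {n : ℕ} {x : R}
    (h : Module.supportDim R M < ((n + 1 : ℕ) : WithBot ℕ∞))
    (hx : IsSMulRegular (M ⧸ tors a M) x) :
    Module.supportDim R (QuotSMulTop x (M ⧸ tors a M)) < (n : WithBot ℕ∞) := by
  have h1 := Module.supportDim_quotSMulTop_succ_le_of_notMem_minimalPrimes (M := M ⧸ tors a M)
    (x := x) fun _ => hx.notMem_of_mem_minimalPrimes
  have h2 := Module.supportDim_le_of_surjective _ (Submodule.mkQ_surjective (tors a M))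
  have h3 := (h1.trans h2).trans_lt h
  push_cast at h3
  exact lt_of_add_lt_add_right h3

variable [IsNoetherianRing R]

lemma LC.isArtinian_zero (h : IsArtinian R M) : IsArtinian R (LC a 0 M) :=
  isArtinian_of_injective (ev a) (ev_injective a)

lemma LC.isArtinian_succ_of_quotient
    (h : IsArtinian R (LC a (i + 1) (M ⧸ tors a M))) : IsArtinian R (LC a (i + 1) M) :=
  isArtinian_of_injective (M := LC a (i + 1) M) _ (map_mkQ_tors_bijective a i).1

open IsLocalRing

variable [IsLocalRing R]

lemma isArtinian_of_support_subset [Module.Finite R M]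
    (h : Module.support R M ⊆ {closedPoint R}) : IsArtinian R M := by
  revert h
  refine IsNoetherianRing.induction_on_isQuotientEquivQuotientPrime R (M := M) inferInstance
    (motive := fun N _ _ _ => Module.support R N ⊆ {closedPoint R} → IsArtinian R N)
    ?_ ?_ ?_
  · intro N _ _ _ _ _; infer_instance
  · intro N _ _ _ p e hp
    have hmem : p ∈ Module.support R N := by
      rw [e.support_eq, Module.support_eq_zeroLocus, Ideal.annihilator_quotient]
      exact le_refl p.asIdeal
    have : p.asIdeal = maximalIdeal R := congrArg PrimeSpectrum.asIdeal (hp hmem)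
    have hs : IsSimpleModule R (R ⧸ p.asIdeal) := by
      rw [this]
      exact (isSimpleModule_iff_isCoatom).2 (Ideal.isMaximal_def.1 inferInstance)
    exact isArtinian_of_linearEquiv e.symm
  · intro N₁ _ _ _ N₂ _ _ _ N₃ _ _ _ f g hf hg hfg h1 h3 h2
    rw [Module.support_of_exact hfg hf hg, Set.union_subset_iff] at h2
    exact IsSES.isArtinian ⟨hf, hfg, hg⟩ (h1 h2.1) (h3 h2.2)

lemma support_subset_of_tors_eq_top [Module.Finite R M] (h : tors (maximalIdeal R) M = ⊤) :
    Module.support R M ⊆ {closedPoint R} := by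
  obtain ⟨n, hn⟩ := exists_pow_smul_of_fg _ h
  intro p hp
  rw [Module.support_eq_zeroLocus] at hp
  have h1 : maximalIdeal R ^ n ≤ p.asIdeal :=
    le_trans (fun r hr => Module.mem_annihilator.2 (hn r hr)) (show _ ≤ p.asIdeal from hp)
  have h2 := Ideal.IsPrime.le_of_pow_le h1
  exact PrimeSpectrum.ext (le_antisymm (le_maximalIdeal p.2.ne_top) h2)

lemma support_subset_of_supportDim_le [Module.Finite R M] (h : Module.supportDim R M ≤ 0) :
    Module.support R M ⊆ {closedPoint R} := by
  intro p hp
  by_contra hne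
  have hlt : p < closedPoint R :=
    lt_of_le_of_ne (le_maximalIdeal p.2.ne_top) hne
  have : Nontrivial M := Module.nonempty_support_iff.1 ⟨p, hp⟩
  have hlt' : (⟨p, hp⟩ : Module.support R M) < ⟨closedPoint R, closedPoint_mem_support R M⟩ := hlt
  have h1 : 0 < Order.krullDim (Module.support R M) := Order.krullDim_pos_iff.2 ⟨_, _, hlt'⟩
  exact absurd (h1.trans_le h) (lt_irrefl _)

lemma LC.isArtinian_maximalIdeal [Module.Finite R M] (i : ℕ) :
    IsArtinian R (LC (maximalIdeal R) i M) := by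
  induction i generalizing M with
  | zero =>
    have := isArtinian_of_support_subset (support_subset_of_tors_eq_top
      (tors_tors (M := M) (maximalIdeal R)))
    exact isArtinian_of_linearEquiv (zeroEquiv (maximalIdeal R) (M := M)).symm
  | succ i ih =>
    apply LC.isArtinian_succ_of_quotient
    obtain ⟨x, hxa, hx⟩ := exists_regular (maximalIdeal R)
      (tors_quotient_tors (M := M) (maximalIdeal R) fun n => IsNoetherian.noetherian _)
    exact LC.isArtinian_succ_of_regular _ hxa hx ih

lemma le_of_lt_one {x : WithBot ℕ∞} (h : x < ((1 : ℕ) : WithBot ℕ∞)) : x ≤ 0 := by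
  induction x with
  | bot => exact bot_le
  | coe x =>
    have h : x < 1 := WithBot.coe_lt_coe.1 h
    exact WithBot.coe_le_coe.2 (Order.lt_one_iff.1 h).le

lemma LC.isArtinian_top [Module.Finite R M] {i : ℕ}
    (h : Module.supportDim R M < ((i + 1 : ℕ) : WithBot ℕ∞)) : IsArtinian R (LC a i M) := by
  induction i generalizing M with
  | zero =>
    apply isArtinian_zero
    apply isArtinian_of_support_subset
    apply support_subset_of_supportDim_le
    rw [zero_add] at h
    exact le_of_lt_one h
  | succ i ih =>
    apply LC.isArtinian_succ_of_quotient
    obtain ⟨x, hxa, hx⟩ := exists_regular a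
      (tors_quotient_tors (M := M) a fun n => IsNoetherian.noetherian _)
    exact LC.isArtinian_succ_of_regular _ hxa hx (ih (supportDim_quotSMulTop_tors_lt a h hx))

end

section
variable {R : Type u} [CommRing R] (a : Ideal R) {i : ℕ} {A B D M N : Type u}
  [AddCommGroup A] [AddCommGroup B]
  [AddCommGroup D] [Module R A] [Module R B] [Module R D] [AddCommGroup M] [Module R M]
  [AddCommGroup N] [Module R N] {f : A →ₗ[R] B} {g : B →ₗ[R] D}

open Pointwise

namespace LC

lemma map_surjective (h : IsSES f g) (hA : Subsingleton (LC a (i + 1) A)) :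
    Function.Surjective (map a i g) := fun z =>
  (exact_right a i h z).1 (Subsingleton.elim _ _)

lemma map_surjective' (h : IsSES f g) (hD : Subsingleton (LC a i D)) :
    Function.Surjective (map a i f) := fun z =>
  (exact_mid a i h z).1 (Subsingleton.elim _ _)

lemma smul_surjective_of_supportDim [IsNoetherianRing R] [Module.Finite R M] {y : R}
    (h : Module.supportDim R M < ((i + 1 : ℕ) : WithBot ℕ∞))
    (hy : Module.supportDim R (QuotSMulTop y M) < (i : WithBot ℕ∞)) (z : LC a i M) :
    ∃ w, y • w = z := by
  let φ := LinearMap.lsmul R M y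
  have hr : LinearMap.range φ = y • (⊤ : Submodule R M) := by
    ext v
    simp [φ, Submodule.mem_smul_pointwise_iff_exists]
  have h1 : Function.Surjective (map a i φ.rangeRestrict) := by
    refine map_surjective a (IsSES.of_surjective _ φ.surjective_rangeRestrict)
      (subsingleton_of_supportDim_lt a ((Module.supportDim_le_of_injective _
        (Submodule.subtype_injective _)).trans_lt h))
  have h2 : Function.Surjective (map a i (LinearMap.range φ).subtype) := by
    refine map_surjective' a (IsSES.of_submodule _) (subsingleton_of_supportDim_lt a ?_)
    rw [hr]; exact hy
  obtain ⟨v, rfl⟩ := h2 z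
  obtain ⟨w, rfl⟩ := h1 v
  exact ⟨w, by rw [map_comp_apply, ← map_lsmul]; rfl⟩

/-- In its top degree `i + 1 ≥ 1`, local cohomology is divisible by some element of the ideal. -/
lemma exists_smul_surjective [IsNoetherianRing R] [Module.Finite R M]
    (h : Module.supportDim R M < ((i + 1 + 1 : ℕ) : WithBot ℕ∞)) :
    ∃ y ∈ a, ∀ z : LC a (i + 1) M, ∃ w, y • w = z := by
  obtain ⟨y, hya, hy⟩ := exists_regular a
    (tors_quotient_tors (M := M) a fun n => IsNoetherian.noetherian _)
  refine ⟨y, hya, fun z => ?_⟩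
  have hb := map_mkQ_tors_bijective (M := M) a i
  obtain ⟨w, hw⟩ := smul_surjective_of_supportDim (i := i + 1) a
    ((Module.supportDim_le_of_surjective _ (Submodule.mkQ_surjective (tors a M))).trans_lt h)
    (supportDim_quotSMulTop_tors_lt a h hy) (map a (i + 1) (tors a M).mkQ z)
  obtain ⟨w, rfl⟩ := hb.2 w
  exact ⟨w, hb.1 (by rw [_root_.map_smul, hw])⟩

end LC

/-- A divisible artinian module over a noetherian ring is divisible by all elements outside
finitely many primes not containing the ideal. -/
lemma exists_finite_primes [IsNoetherianRing R] [IsArtinian R M] (I : Ideal R) (U : Submodule R M)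
    (hU : I • U = U) : ∃ S : Set (Ideal R), S.Finite ∧ (∀ p ∈ S, p.IsPrime ∧ ¬ I ≤ p) ∧
      ∀ r : R, (∀ p ∈ S, r ∉ p) → r • U = U := by
  induction U using WellFoundedLT.induction with
  | ind U ih =>
  by_cases h0 : U = ⊥
  · exact ⟨∅, Set.finite_empty, by simp, fun r _ => by rw [h0]; simp⟩
  by_cases hirr : ∀ U1 U2 : Submodule R M, U1 ⊔ U2 = U → U1 = U ∨ U2 = U
  · have hle : ∀ r : R, r • U ≤ U := fun r => Submodule.smul_le_self_of_tower r U
    let p : Ideal R :=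
      { carrier := {r | r • U ≠ U}
        zero_mem' := by simpa using Ne.symm h0
        add_mem' := by
          intro r s hr hs hrs
          have : r • U ⊔ s • U = U := by
            refine le_antisymm (sup_le (hle r) (hle s)) (hrs.symm.le.trans ?_)
            rintro _ ⟨v, hv, rfl⟩
            have : (r + s) • v = r • v + s • v := add_smul _ _ _
            change (r + s) • v ∈ _
            rw [this]
            exact Submodule.add_mem_sup (Submodule.smul_mem_pointwise_smul v r U hv)
              (Submodule.smul_mem_pointwise_smul v s U hv)
          rcases hirr _ _ this with h | h
          · exact hr h
          · exact hs h
        smul_mem' := by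
          intro c r hr hrs
          apply hr
          refine le_antisymm (hle r) (hrs.symm.le.trans ?_)
          rw [smul_eq_mul, mul_comm, mul_smul]
          rintro _ ⟨v, hv, rfl⟩
          exact Submodule.smul_mem_pointwise_smul v r U (hle c hv) }
    have hp : ∀ r, r ∈ p ↔ r • U ≠ U := fun r => Iff.rfl
    have hprime : p.IsPrime := by
      refine ⟨fun h => ?_, fun {r s} hrs => ?_⟩
      · have : (1 : R) ∈ p := h ▸ Submodule.mem_top
        exact this (one_smul _ _)
      · by_contra hcon
        push Not at hcon
        simp only [hp, not_not] at hcon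
        exact hrs (by rw [mul_smul, hcon.2, hcon.1])
    have hIp : ∀ J : Ideal R, J.FG → J • U = U → ∃ r ∈ J, r • U = U := by
      intro J hJ
      refine Submodule.fg_induction (motive := fun J _ => J • U = U → ∃ r ∈ J, r • U = U)
        (fun x hx => ?_) (fun J1 J2 _ _ h1 h2 h => ?_) J hJ
      · exact ⟨x, Ideal.mem_span_singleton_self x, by
          rw [← hx]; exact (congrArg _ hx).trans (Submodule.ideal_span_singleton_smul x U).symm⟩
      · rw [Submodule.sup_smul] at h
        rcases hirr _ _ h with h | h
        · obtain ⟨r, hr, h⟩ := h1 h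
          exact ⟨r, Ideal.mem_sup_left hr, h⟩
        · obtain ⟨r, hr, h⟩ := h2 h
          exact ⟨r, Ideal.mem_sup_right hr, h⟩
    obtain ⟨r, hr, hrU⟩ := hIp I (IsNoetherian.noetherian I) hU
    refine ⟨{p}, Set.finite_singleton p, ?_, fun r hr => ?_⟩
    · rintro _ rfl
      exact ⟨hprime, fun h => h hr hrU⟩
    · exact not_not.1 (hr p rfl)
  · push Not at hirr
    obtain ⟨U1, U2, h12, h1, h2⟩ := hirr
    have hpow : ∀ n : ℕ, I ^ n • U = U := by
      intro n
      induction n with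
      | zero => simp
      | succ n ihn => rw [pow_succ, Submodule.mul_smul, hU, ihn]
    have hst : ∀ V : Submodule R M, ∃ n : ℕ, ∀ m, n ≤ m → I ^ n • V = I ^ m • V := fun V =>
      monotone_stabilizes_iff_artinian.2 inferInstance
        ⟨fun k => OrderDual.toDual (I ^ k • V), fun k l hkl =>
          Submodule.smul_mono_left (Ideal.pow_le_pow_right hkl)⟩
    have hst' : ∀ V : Submodule R M, ∃ n : ℕ, ∀ m, n ≤ m → I • (I ^ m • V) = I ^ m • V := by
      intro V
      obtain ⟨n, hn⟩ := hst V
      refine ⟨n, fun m hm => ?_⟩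
      rw [← Submodule.mul_smul, ← pow_succ', ← hn m hm, ← hn (m + 1) (by omega)]
    obtain ⟨n1, hn1⟩ := hst' U1
    obtain ⟨n2, hn2⟩ := hst' U2
    have hn1 := hn1 _ (le_max_left n1 n2)
    have hn2 := hn2 _ (le_max_right n1 n2)
    set n := max n1 n2
    have hlt1 : I ^ n • U1 < U := lt_of_le_of_lt Submodule.smul_le_right
      (lt_of_le_of_ne (h12 ▸ le_sup_left) h1)
    have hlt2 : I ^ n • U2 < U := lt_of_le_of_lt Submodule.smul_le_right
      (lt_of_le_of_ne (h12 ▸ le_sup_right) h2)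
    obtain ⟨S1, hS1, hp1, hr1⟩ := ih _ hlt1 hn1
    obtain ⟨S2, hS2, hp2, hr2⟩ := ih _ hlt2 hn2
    refine ⟨S1 ∪ S2, hS1.union hS2, ?_, fun r hr => ?_⟩
    · rintro p (h | h)
      exacts [hp1 p h, hp2 p h]
    · have hUe : U = I ^ n • U1 ⊔ I ^ n • U2 := by
        rw [← Submodule.smul_sup, h12, hpow]
      rw [hUe, Submodule.smul_sup', hr1 r fun p hp => hr p (Or.inl hp),
        hr2 r fun p hp => hr p (Or.inr hp)]

open IsLocalRing

lemma supportDim_quotient_tors [IsNoetherianRing R] [IsLocalRing R] [Module.Finite R M] {d : ℕ}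
    (h : Module.supportDim R M = ((d + 1 : ℕ) : WithBot ℕ∞)) :
    Module.supportDim R (M ⧸ tors (maximalIdeal R) M) = ((d + 1 : ℕ) : WithBot ℕ∞) := by
  refine le_antisymm (h ▸ Module.supportDim_le_of_surjective _
    (Submodule.mkQ_surjective (tors (maximalIdeal R) M))) (h ▸ ?_)
  have hs : Module.support R M ⊆
      {closedPoint R} ∪ Module.support R (M ⧸ tors (maximalIdeal R) M) := by
    have hses := IsSES.of_submodule (tors (maximalIdeal R) M)
    rw [Module.support_of_exact hses.exact hses.inj hses.surj]
    exact Set.union_subset_union_left _ (support_subset_of_tors_eq_top (tors_tors (maximalIdeal R)))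
  have hmono : ∀ S T : Set (PrimeSpectrum R), S ⊆ T → Order.krullDim S ≤ Order.krullDim T :=
    fun S T hST => Order.krullDim_le_of_strictMono (Set.inclusion hST) fun _ _ h => h
  rcases subsingleton_or_nontrivial (M ⧸ tors (maximalIdeal R) M) with h1 | h1
  · rw [Module.support_eq_empty_iff.2 h1, Set.union_empty] at hs
    have h2 := (hmono _ _ hs)
    have h3 : Order.krullDim ({closedPoint R} : Set (PrimeSpectrum R)) ≤ 0 :=
      Order.krullDim_nonpos_of_subsingleton
    have : Module.supportDim R M ≤ 0 := h2.trans h3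
    rw [h] at this
    exact absurd (Nat.cast_le.1 (this : ((d + 1 : ℕ) : WithBot ℕ∞) ≤ ((0 : ℕ) : WithBot ℕ∞)))
      (by omega)
  · refine hmono _ _ (hs.trans (Set.union_subset ?_ subset_rfl))
    rintro _ rfl
    exact closedPoint_mem_support R _

lemma add_one_cancel {x : WithBot ℕ∞} {d : ℕ} (h : x + 1 = (d : WithBot ℕ∞) + 1) :
    x = (d : WithBot ℕ∞) := by
  induction x with
  | bot =>
    rw [WithBot.bot_add] at h
    exact absurd h.symm (WithBot.coe_ne_bot (a := (d : ℕ∞) + 1))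
  | coe x =>
    have h : x + 1 = (d : ℕ∞) + 1 := WithBot.coe_injective h
    exact congrArg _ (ENat.add_left_injective_of_ne_top (ENat.natCast_ne_top 1) h)

/-- Grothendieck non-vanishing. -/
lemma LC.nontrivial_top [IsNoetherianRing R] [IsLocalRing R] [Module.Finite R M] {d : ℕ}
    (h : Module.supportDim R M = (d : WithBot ℕ∞)) : Nontrivial (LC (maximalIdeal R) d M) := by
  induction d generalizing M with
  | zero =>
    have hM : Nontrivial M := by
      rw [← not_subsingleton_iff_nontrivial, ← Module.supportDim_eq_bot_iff_subsingleton R, h]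
      exact WithBot.coe_ne_bot
    have hA := isArtinian_of_support_subset (support_subset_of_supportDim_le h.le)
    rw [← not_subsingleton_iff_nontrivial, zero_subsingleton_iff]
    intro hbot
    obtain ⟨x, hx, hreg⟩ := exists_regular (maximalIdeal R) hbot
    have hsurj : Function.Surjective (LinearMap.lsmul R M x) :=
      IsArtinian.surjective_of_injective_endomorphism _ hreg
    have : (⊤ : Submodule R M) ≤ maximalIdeal R • ⊤ := fun v _ => by
      obtain ⟨w, rfl⟩ := hsurj v
      exact Submodule.smul_mem_smul hx trivial
    have := Submodule.eq_bot_of_le_smul_of_le_jacobson_bot _ _ Module.Finite.fg_top this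
      (maximalIdeal_le_jacobson _)
    exact absurd this top_ne_bot
  | succ d ih =>
    set M' := M ⧸ tors (maximalIdeal R) M with hM'
    have hd := supportDim_quotient_tors h
    rw [← not_subsingleton_iff_nontrivial]
    intro hsub
    have hsub' : Subsingleton (LC (maximalIdeal R) (d + 1) M') :=
      (LinearEquiv.ofBijective _ (map_mkQ_tors_bijective (M := M) (maximalIdeal R) d)).symm.subsingleton
    have htor : tors (maximalIdeal R) M' = ⊥ :=
      tors_quotient_tors _ fun n => IsNoetherian.noetherian _
    have hnt : Nontrivial M' := by
      rw [← not_subsingleton_iff_nontrivial, ← Module.supportDim_eq_bot_iff_subsingleton R, hd]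
      exact WithBot.coe_ne_bot
    -- no regular element acts surjectively in degree `d`
    have hno : ∀ r ∈ maximalIdeal R, IsSMulRegular M' r →
        Module.supportDim R (QuotSMulTop r M') = (d : WithBot ℕ∞) ∧
        ¬ ∀ z : LC (maximalIdeal R) d M', ∃ w, r • w = z := by
      intro r hr hreg
      have h1 := Module.supportDim_quotSMulTop_succ_eq_supportDim hreg hr
      rw [hd] at h1
      have h2 : Module.supportDim R (QuotSMulTop r M') = (d : WithBot ℕ∞) := by
        push_cast at h1
        exact add_one_cancel h1
      refine ⟨h2, fun hsurj => ?_⟩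
      have := ih h2
      obtain ⟨z, hz⟩ := exists_ne (0 : LC (maximalIdeal R) d (QuotSMulTop r M'))
      have hses := isSES_of_isSMulRegular hreg
      obtain ⟨w, rfl⟩ := LC.map_surjective (maximalIdeal R) hses hsub' z
      obtain ⟨v, rfl⟩ := hsurj w
      apply hz
      rw [← LC.map_lsmul]
      exact LC.exact_mid (maximalIdeal R) d hses |>.apply_apply_eq_zero _
    have hT : IsArtinian R (LC (maximalIdeal R) d M') := LC.isArtinian_maximalIdeal d
    have hdiv : maximalIdeal R • (⊤ : Submodule R (LC (maximalIdeal R) d M')) = ⊤ := by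
      obtain ⟨r, hr, hreg⟩ := exists_regular (maximalIdeal R) htor
      obtain ⟨hdim, hns⟩ := hno r hr hreg
      rcases d with _ | e
      · exact absurd (fun z => ⟨0, by
          have := (zero_subsingleton_iff (maximalIdeal R) (M := M')).2 htor
          exact Subsingleton.elim _ _⟩) hns
      · obtain ⟨y, hy, hys⟩ := LC.exists_smul_surjective (i := e) (M := QuotSMulTop r M')
          (maximalIdeal R) (by rw [hdim]; exact_mod_cast Nat.lt_succ_self _)
        have hses := isSES_of_isSMulRegular hreg
        rw [eq_top_iff]
        rintro z -
        obtain ⟨w, hw⟩ := hys (LC.map _ _ (Submodule.mkQ _) z)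
        obtain ⟨v, rfl⟩ := LC.map_surjective (maximalIdeal R) hses hsub' w
        obtain ⟨u, hu⟩ := (LC.exact_mid (maximalIdeal R) (e + 1) hses (z - y • v)).1 (by
          rw [map_sub, _root_.map_smul, hw, sub_self])
        rw [LC.map_lsmul] at hu
        rw [← sub_add_cancel z (y • v), ← hu]
        exact add_mem (Submodule.smul_mem_smul hr trivial) (Submodule.smul_mem_smul hy trivial)
    obtain ⟨S, hS, hSp, hr⟩ := exists_finite_primes _ _ hdiv
    have hfin := associatedPrimes.finite R M'
    have : ∃ r ∈ maximalIdeal R, ∀ p ∈ S ∪ associatedPrimes R M', r ∉ p := by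
      by_contra! hcon
      have hsub : (maximalIdeal R : Set R) ⊆
          ⋃ p ∈ ((hS.union hfin).toFinset : Set (Ideal R)), ((p : Ideal R) : Set R) := fun r hr => by
        obtain ⟨p, hp, hrp⟩ := hcon r hr
        exact Set.mem_biUnion (by simpa using hp) hrp
      rw [Ideal.subset_union_prime (f := fun p => p) ⊥ ⊥] at hsub
      · obtain ⟨p, hp, hle⟩ := hsub
        rw [Set.Finite.mem_toFinset] at hp
        rcases hp with hp | hp
        · exact (hSp p hp).2 hle
        · obtain ⟨r, hr, hreg⟩ := exists_regular (maximalIdeal R) htor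
          have : r ∈ ⋃ p ∈ associatedPrimes R M', (p : Set R) := Set.mem_biUnion hp (hle hr)
          rw [biUnion_associatedPrimes_eq_compl_regular] at this
          exact this hreg
      · intro p hp _ _
        rw [Set.Finite.mem_toFinset] at hp
        rcases hp with hp | hp
        · exact (hSp p hp).1
        · exact hp.1
    obtain ⟨r, hrm, hrp⟩ := this
    have hreg : IsSMulRegular M' r := by
      by_contra hcon
      have : r ∈ ⋃ p ∈ associatedPrimes R M', (p : Set R) := by
        rw [biUnion_associatedPrimes_eq_compl_regular]; exact hcon
      obtain ⟨p, hp, hrp'⟩ := Set.mem_iUnion₂.1 this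
      exact hrp p (Or.inr hp) hrp'
    refine (hno r hrm hreg).2 fun z => ?_
    have : z ∈ r • (⊤ : Submodule R (LC (maximalIdeal R) d M')) := by
      rw [hr r fun p hp => hrp p (Or.inl hp)]; trivial
    obtain ⟨w, -, hw⟩ := this
    exact ⟨w, hw⟩

end

section
open TensorProduct
variable {R : Type u} [CommRing R] {A A' D Q : Type u}
  [AddCommGroup A] [AddCommGroup A'] [AddCommGroup D] [AddCommGroup Q]
  [Module R A] [Module R A'] [Module R D] [Module R Q]

variable (R A D Q) in
/-- Hom evaluation: `a ⊗ f ↦ (φ ↦ f (φ a))`. -/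
def homEval : A ⊗[R] (D →ₗ[R] Q) →ₗ[R] ((A →ₗ[R] D) →ₗ[R] Q) :=
  TensorProduct.lift (LinearMap.mk₂ R
    (fun a f => f ∘ₗ LinearMap.applyₗ a)
    (fun a a' f => by ext; simp) (fun r a f => by ext; simp)
    (fun a f f' => by ext; simp) (fun r a f => by ext; simp))

@[simp] lemma homEval_tmul (a : A) (f : D →ₗ[R] Q) (φ : A →ₗ[R] D) :
    homEval R A D Q (a ⊗ₜ f) φ = f (φ a) := rfl

lemma homEval_naturality (π : A →ₗ[R] A') (t : A ⊗[R] (D →ₗ[R] Q)) (φ : A' →ₗ[R] D) :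
    homEval R A' D Q (π.rTensor _ t) φ = homEval R A D Q t (φ ∘ₗ π) := by
  induction t with
  | zero => simp
  | add x y hx hy => simp only [map_add, LinearMap.add_apply, hx, hy]
  | tmul a f => simp

lemma homEval_pi_bijective (n : ℕ) : Function.Bijective (homEval R (Fin n → R) D Q) := by
  classical
  let inv : ((((Fin n → R) →ₗ[R] D)) →ₗ[R] Q) → (Fin n → R) ⊗[R] (D →ₗ[R] Q) := fun g =>
    ∑ i, (Pi.single i (1 : R)) ⊗ₜ (g ∘ₗ
      LinearMap.smulRightₗ (LinearMap.proj (R := R) (φ := fun _ : Fin n => R) i))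
  have hs : ∀ φ : (Fin n → R) →ₗ[R] D,
      ∑ i, (LinearMap.proj (R := R) (φ := fun _ : Fin n => R) i).smulRight (φ (Pi.single i 1)) =
        φ := by
    intro φ
    refine LinearMap.pi_ext' fun j => ?_
    ext
    simp [Pi.single_apply, ite_smul]
  refine ⟨Function.LeftInverse.injective (g := inv) fun t => ?_, fun g => ⟨inv g, ?_⟩⟩
  · induction t with
    | zero => simp [inv]
    | add x y hx hy =>
      rw [← hx, ← hy, hx, hy]
      conv_rhs => rw [← hx, ← hy]
      simp only [inv, map_add, LinearMap.add_comp, TensorProduct.tmul_add, Finset.sum_add_distrib]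
    | tmul p f =>
      have h1 : ∀ i, homEval R (Fin n → R) D Q (p ⊗ₜ f) ∘ₗ
          LinearMap.smulRightₗ (LinearMap.proj (R := R) (φ := fun _ : Fin n => R) i) = p i • f := by
        intro i
        ext v
        simp
      simp only [inv, h1, TensorProduct.tmul_smul, TensorProduct.smul_tmul']
      rw [← TensorProduct.sum_tmul]
      congr 1
      ext j
      simp [Finset.sum_apply, Pi.single_apply]
  · ext φ
    conv_rhs => rw [← hs φ]
    simp only [inv, map_sum, LinearMap.sum_apply, homEval_tmul]
    rfl

lemma homEval_surjective [Module.Finite R A] (hQ : Module.Injective R Q) :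
    Function.Surjective (homEval R A D Q) := by
  obtain ⟨n, π, hπ⟩ := Module.Finite.exists_fin' R A
  intro g
  obtain ⟨g', hg'⟩ := hQ.exists_comp_eq (LinearMap.lcomp R D π)
    (fun φ ψ h => by
      ext a; obtain ⟨p, rfl⟩ := hπ a; exact LinearMap.congr_fun h p) g
  obtain ⟨t, ht⟩ := (homEval_pi_bijective n).2 g'
  refine ⟨π.rTensor _ t, ?_⟩
  ext φ
  rw [homEval_naturality, ht, ← hg']
  rfl

/-- Hom evaluation is bijective for `A` finitely generated and `Q` injective. -/
lemma homEval_bijective [IsNoetherianRing R] [Module.Finite R A] (hQ : Module.Injective R Q) :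
    Function.Bijective (homEval R A D Q) := by
  refine ⟨?_, homEval_surjective hQ⟩
  obtain ⟨n, π, hπ⟩ := Module.Finite.exists_fin' R A
  rw [injective_iff_map_eq_zero]
  intro t ht
  obtain ⟨t', rfl⟩ := LinearMap.rTensor_surjective _ hπ t
  have hex : Function.Exact (LinearMap.ker π).subtype π := LinearMap.exact_subtype_ker_map π
  let res : ((Fin n → R) →ₗ[R] D) →ₗ[R] (LinearMap.ker π →ₗ[R] D) :=
    LinearMap.lcomp R D (LinearMap.ker π).subtype
  have hker : LinearMap.ker res ≤ LinearMap.ker (homEval R (Fin n → R) D Q t') := by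
    intro ψ hψ
    have hle : LinearMap.ker π ≤ LinearMap.ker ψ := fun x hx => LinearMap.congr_fun hψ ⟨x, hx⟩
    let φ : A →ₗ[R] D := (LinearMap.ker π).liftQ ψ hle ∘ₗ (π.quotKerEquivOfSurjective hπ).symm
    have hφ : φ ∘ₗ π = ψ := by
      ext x
      simp only [φ, LinearMap.comp_apply, LinearEquiv.coe_coe]
      rw [show (π.quotKerEquivOfSurjective hπ).symm (π (LinearMap.single R _ x 1)) =
        Submodule.Quotient.mk (LinearMap.single R _ x 1) from
        (LinearEquiv.symm_apply_eq _).2 rfl]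
      rfl
    rw [LinearMap.mem_ker, ← hφ, ← homEval_naturality, ht]
    rfl
  obtain ⟨g, hg⟩ := hQ.exists_comp_eq ((LinearMap.ker res).liftQ res le_rfl)
    (LinearMap.ker_eq_bot.1 (Submodule.ker_liftQ_eq_bot _ _ _ le_rfl))
    ((LinearMap.ker res).liftQ _ hker)
  obtain ⟨t'', ht''⟩ := homEval_surjective (A := LinearMap.ker π) hQ g
  have : (LinearMap.ker π).subtype.rTensor _ t'' = t' := by
    apply (homEval_pi_bijective n).1
    ext1 ψ
    rw [homEval_naturality, ht'']
    exact LinearMap.congr_fun hg (Submodule.Quotient.mk ψ)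
  rw [← this, ← LinearMap.comp_apply, ← LinearMap.rTensor_comp, hex.linearMap_comp_eq_zero,
    LinearMap.rTensor_zero, LinearMap.zero_apply]

end

/-- The module-theoretic form of the semidualizing condition. -/
structure Semidual (R : Type u) [CommRing R] (C : Type u) [AddCommGroup C] [Module R C] : Prop where
  finite : Module.Finite R C
  bij : Function.Bijective (LinearMap.lsmul R C)
  ext : ∀ i, ExtVanish R (i + 1) C C

section
open IsLocalRing Pointwise

variable {R : Type u} [CommRing R] [IsNoetherianRing R] [IsLocalRing R]
  {C A B : Type u} [AddCommGroup C] [AddCommGroup A] [AddCommGroup B]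
  [Module R C] [Module R A] [Module R B]

/-- The data accumulated along a `C`-regular sequence of length `s` generating an ideal `b`:
`A = R / b`, `B = C / b C` and their homological properties. -/
structure RegChain (d s : ℕ) (πA : R →ₗ[R] A) (πB : C →ₗ[R] B) : Prop where
  surjA : Function.Surjective πA
  surjB : Function.Surjective πB
  kerB : LinearMap.ker πB = LinearMap.ker πA • (⊤ : Submodule R C)
  hom_eq : ∀ φ : C →ₗ[R] B, ∃ r : R, φ = r • πB
  hom_zero : ∀ r : R, r • πB = 0 → πA r = 0
  extCB : ∀ i, ExtVanish R (i + 1) C B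
  pd : ∀ i, s ≤ i → ∀ (N : Type u) [AddCommGroup N] [Module R N], ExtVanish R (i + 1) A N
  extHom : ∀ (I : Type u) [AddCommGroup I] [Module R I], Module.Injective R I →
    ∀ i, ExtVanish R (i + 1) A (C →ₗ[R] I)
  injDim : ∀ (I : Type u) [AddCommGroup I] [Module R I], Module.Injective R I →
    ∀ i, s ≤ i → ∀ (N : Type u) [AddCommGroup N] [Module R N], ExtVanish R (i + 1) N (A →ₗ[R] I)
  dim : Module.supportDim R A + (s : WithBot ℕ∞) = (d : WithBot ℕ∞)
  desc : ∀ (N : Type u) [AddCommGroup N] [Module R N], (∀ r ∈ maximalIdeal R, ∀ n : N, r • n = 0) →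
    ∀ i, ExtVanish R i N B → ExtVanish R i N C
  depth : ∀ n, (∀ j < n, Subsingleton (LC (maximalIdeal R) j B)) →
    ∀ j < n + s, Subsingleton (LC (maximalIdeal R) j C)
  top : ∀ n k, k = n + s → (∀ j < n, Subsingleton (LC (maximalIdeal R) j A)) →
    ∃ φ : LC (maximalIdeal R) n A →ₗ[R] LC (maximalIdeal R) k R,
      LinearMap.range φ = Submodule.torsionBySet R _ (LinearMap.ker πA) ∧ Function.Injective φ
  divis : ∀ n, n + s = d → s ≤ 1 → ∃ φ : LC (maximalIdeal R) n A →ₗ[R] LC (maximalIdeal R) d R,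
    LinearMap.range φ = Submodule.torsionBySet R _ (LinearMap.ker πA) ∧
      (s = 0 → Function.Injective φ)

lemma RegChain.nil {d : ℕ} (hd : ringKrullDim R = (d : WithBot ℕ∞)) (hC : Semidual R C) :
    RegChain d 0 (LinearMap.id : R →ₗ[R] R) (LinearMap.id : C →ₗ[R] C) := by
  have htop : ∀ N : Type u, ∀ [AddCommGroup N] [Module R N],
      Submodule.torsionBySet R N (LinearMap.ker (LinearMap.id : R →ₗ[R] R)) = ⊤ := by
    intro N _ _
    rw [eq_top_iff]
    rintro z -
    rw [Submodule.mem_torsionBySet_iff]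
    rintro ⟨r, hr⟩
    have : r = 0 := hr
    simp [this]
  refine ⟨Function.surjective_id, Function.surjective_id, by simp, fun φ => ?_, fun r hr => ?_,
    hC.ext, fun i _ N _ _ => .of_projective i, fun I _ _ _ i => .of_projective i,
    fun I _ _ hI i _ N _ _ => ?_, ?_, fun _ _ _ _ _ h => h, fun n h => h, fun n k hk _ => ?_,
    fun n hn _ => ?_⟩
  · obtain ⟨r, hr⟩ := hC.bij.2 φ
    exact ⟨r, by rw [← hr]; rfl⟩
  · refine hC.bij.1 ?_
    rw [map_zero, ← hr]; rfl
  · exact .of_injective i (hI.congr (LinearMap.ringLmapEquivSelf R R I).symm)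
  · rw [Module.supportDim_self_eq_ringKrullDim, hd]; simp
  · obtain rfl : k = n := hk
    exact ⟨LinearMap.id, by rw [htop, LinearMap.range_id], Function.injective_id⟩
  · obtain rfl : n = d := hn
    exact ⟨LinearMap.id, by rw [htop, LinearMap.range_id], fun _ => Function.injective_id⟩

namespace RegChain

variable {d s : ℕ} {πA : R →ₗ[R] A} {πB : C →ₗ[R] B} (h : RegChain d s πA πB)
include h

lemma smul_B {r : R} (hr : πA r = 0) (b : B) : r • b = 0 := by
  obtain ⟨c, rfl⟩ := h.surjB b
  rw [← map_smul, ← LinearMap.mem_ker, h.kerB]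
  exact Submodule.smul_mem_smul hr trivial

/-- A regular element on `B` is regular on `A`. -/
lemma regular_A {x : R} (hx : IsSMulRegular B x) : IsSMulRegular A x := by
  rw [isSMulRegular_iff_right_eq_zero_of_smul]
  intro a ha
  obtain ⟨r, rfl⟩ := h.surjA a
  refine h.hom_zero r (LinearMap.ext fun c => ?_)
  have : x • r • πB c = 0 := by
    rw [smul_smul]
    exact h.smul_B (by rw [← smul_eq_mul, map_smul, ha]) _
  exact hx.right_eq_zero_of_smul this

/-- Maps `A → Hom(C, I)` are maps `B → I`. -/
lemma exists_of_hom {I : Type u} [AddCommGroup I] [Module R I] (φ : A →ₗ[R] (C →ₗ[R] I)) :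
    ∃ ψ : B →ₗ[R] I, ∀ c, ψ (πB c) = φ (πA 1) c := by
  have hle : LinearMap.ker πB ≤ LinearMap.ker (φ (πA 1)) := by
    rw [h.kerB, Submodule.smul_le]
    intro r hr c _
    rw [LinearMap.mem_ker, map_smul, ← LinearMap.smul_apply, ← map_smul, ← map_smul, smul_eq_mul,
      mul_one, LinearMap.mem_ker.1 hr, map_zero, LinearMap.zero_apply]
  refine ⟨(LinearMap.ker πB).liftQ _ hle ∘ₗ (πB.quotKerEquivOfSurjective h.surjB).symm,
    fun c => ?_⟩
  rw [LinearMap.comp_apply, LinearEquiv.coe_coe,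
    show (πB.quotKerEquivOfSurjective h.surjB).symm (πB c) = Submodule.Quotient.mk c from
      (LinearEquiv.symm_apply_eq _).2 rfl]
  rfl

lemma exists_to_hom {I : Type u} [AddCommGroup I] [Module R I] (ψ : B →ₗ[R] I) :
    ∃ φ : A →ₗ[R] (C →ₗ[R] I), ∀ r c, φ (πA r) c = ψ (πB (r • c)) := by
  let φ0 : R →ₗ[R] (C →ₗ[R] I) := LinearMap.toSpanSingleton R _ (ψ ∘ₗ πB)
  have hle : LinearMap.ker πA ≤ LinearMap.ker φ0 := by
    intro r hr
    ext c
    simp only [φ0, LinearMap.toSpanSingleton_apply, LinearMap.smul_apply, LinearMap.comp_apply]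
    rw [← map_smul, h.smul_B hr, map_zero, LinearMap.zero_apply]
  refine ⟨(LinearMap.ker πA).liftQ _ hle ∘ₗ (πA.quotKerEquivOfSurjective h.surjA).symm,
    fun r c => ?_⟩
  rw [LinearMap.comp_apply, LinearEquiv.coe_coe,
    show (πA.quotKerEquivOfSurjective h.surjA).symm (πA r) = Submodule.Quotient.mk r from
      (LinearEquiv.symm_apply_eq _).2 rfl]
  change r • ψ (πB c) = ψ (πB (r • c))
  rw [map_smul, map_smul]

lemma mem_torsionBySet_cons {N : Type u} [AddCommGroup N] [Module R N] (x : R) (z : N) :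
    z ∈ Submodule.torsionBySet R N (LinearMap.ker (Submodule.mkQ (x • ⊤ : Submodule R A) ∘ₗ πA)) ↔
      z ∈ Submodule.torsionBySet R N (LinearMap.ker πA) ∧ x • z = 0 := by
  simp only [Submodule.mem_torsionBySet_iff, Subtype.forall, SetLike.mem_coe, LinearMap.mem_ker,
    LinearMap.comp_apply, Submodule.mkQ_apply, Submodule.Quotient.mk_eq_zero]
  constructor
  · refine fun hz => ⟨fun r hr => hz r (by rw [hr]; exact zero_mem _), hz x ?_⟩
    have := Submodule.smul_mem_pointwise_smul (R := R) (πA 1) x (⊤ : Submodule R A) Submodule.mem_top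
    rwa [← map_smul, smul_eq_mul, mul_one] at this
  · rintro ⟨hz, hxz⟩ r ⟨a, -, ha⟩
    obtain ⟨r', rfl⟩ := h.surjA a
    have ha : x • πA r' = πA r := ha
    have := hz (r - x * r') (by rw [map_sub, ← ha, ← smul_eq_mul, map_smul, sub_self])
    rw [sub_smul, mul_comm, mul_smul, hxz, smul_zero, sub_zero] at this
    exact this

omit h in
lemma _root_.isSES_hom_quotSMulTop {I : Type u} [AddCommGroup I] [Module R I]
    (hI : Module.Injective R I) {x : R} (hx : IsSMulRegular A x) :
    IsSES (LinearMap.lcomp R I ((x • ⊤ : Submodule R A).mkQ : A →ₗ[R] QuotSMulTop x A) :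
        (QuotSMulTop x A →ₗ[R] I) →ₗ[R] (A →ₗ[R] I))
      (LinearMap.lsmul R (A →ₗ[R] I) x) := by
  have hses := isSES_of_isSMulRegular hx
  refine ⟨fun φ ψ hφ => ?_, fun φ => ⟨fun hφ => ?_, ?_⟩, fun φ => ?_⟩
  · ext a
    exact LinearMap.congr_fun hφ _
  · have hle : (x • ⊤ : Submodule R A) ≤ LinearMap.ker φ := by
      rintro _ ⟨a, -, rfl⟩
      exact (map_smul φ x a).trans (LinearMap.congr_fun hφ a)
    exact ⟨(x • ⊤ : Submodule R A).liftQ φ hle, Submodule.liftQ_mkQ _ φ hle⟩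
  · rintro ⟨ψ, rfl⟩
    ext a
    have : Submodule.mkQ (x • ⊤ : Submodule R A) (x • a) = 0 := hses.exact.apply_apply_eq_zero a
    change x • ψ (Submodule.mkQ _ a) = 0
    rw [← map_smul, ← map_smul, this, map_zero]
  · obtain ⟨ψ, hψ⟩ := hI.exists_comp_eq _ hses.inj φ
    refine ⟨ψ, ?_⟩
    ext a
    have := LinearMap.congr_fun hψ a
    simpa using this

lemma cons (hC : Semidual R C) {x : R} (hxm : x ∈ maximalIdeal R) (hx : IsSMulRegular B x) :
    RegChain d (s + 1) (Submodule.mkQ (x • ⊤ : Submodule R A) ∘ₗ πA)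
      (Submodule.mkQ (x • ⊤ : Submodule R B) ∘ₗ πB) := by
  have := hC.finite
  have hfA : Module.Finite R A := Module.Finite.of_surjective πA h.surjA
  have hfB : Module.Finite R B := Module.Finite.of_surjective πB h.surjB
  have hxA := h.regular_A hx
  have hA := isSES_of_isSMulRegular hxA
  have hB := isSES_of_isSMulRegular hx
  have hdepth : ∀ {N : Type u} [AddCommGroup N] [Module R N], IsSMulRegular N x →
      ∀ n, (∀ j < n, Subsingleton (LC (maximalIdeal R) j (QuotSMulTop x N))) →
        ∀ j < n + 1, Subsingleton (LC (maximalIdeal R) j N) := by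
    intro N _ _ hN n hn j hj
    have htriv : ∀ z : LC (maximalIdeal R) j N, x • z = 0 → z = 0 := by
      rcases j with _ | j
      · intro z hz
        apply (LC.zeroEquiv (maximalIdeal R)).injective
        rw [map_zero]
        have : x • LC.zeroEquiv (maximalIdeal R) z = 0 := by rw [← map_smul, hz, map_zero]
        exact Subtype.ext (hN.right_eq_zero_of_smul (congrArg Subtype.val this))
      · intro z hz
        refine LC.subsingleton_ker_smul_of_isSMulRegular (maximalIdeal R) hN (hn j (by omega)) ?_
        rw [map_zero]; exact hz
    refine subsingleton_of_forall_eq 0 fun z => ?_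
    obtain ⟨k, hk⟩ : ∃ k : ℕ, x ^ k • z = 0 := by
      obtain ⟨k, hk⟩ := LC.exists_pow_smul (maximalIdeal R) _ z
      exact ⟨k, hk _ (Ideal.pow_mem_pow hxm k)⟩
    clear hj hn
    induction k with
    | zero => simpa using hk
    | succ k ih => exact ih (htriv _ (by rwa [smul_smul, ← pow_succ']))
  have hrange : ∀ {n k : ℕ} {φ : LC (maximalIdeal R) (n + 1) A →ₗ[R] LC (maximalIdeal R) k R},
      LinearMap.range φ = Submodule.torsionBySet R _ (LinearMap.ker πA) → Function.Injective φ →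
      LinearMap.range (φ ∘ₗ LC.δ (maximalIdeal R) n hA) = Submodule.torsionBySet R _
        (LinearMap.ker (Submodule.mkQ (x • ⊤ : Submodule R A) ∘ₗ πA)) := by
    intro n k φ hφ hinj
    ext z
    rw [h.mem_torsionBySet_cons, ← hφ]
    constructor
    · rintro ⟨y, rfl⟩
      refine ⟨⟨_, rfl⟩, ?_⟩
      rw [LinearMap.comp_apply, ← map_smul, ← LC.map_lsmul,
        (LC.exact_left (maximalIdeal R) n hA).apply_apply_eq_zero, map_zero]
    · rintro ⟨⟨y, rfl⟩, hy⟩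
      have hy : x • y = 0 := hinj (by rw [map_smul, hy, map_zero])
      obtain ⟨w, rfl⟩ := (LC.exact_left (maximalIdeal R) n hA y).1 (by rw [LC.map_lsmul, hy])
      exact ⟨w, rfl⟩
  refine ⟨(Submodule.mkQ_surjective _).comp h.surjA, (Submodule.mkQ_surjective _).comp h.surjB,
    ?_, fun φ => ?_, fun r hr => ?_, fun i => ?_, fun i hi N _ _ => ?_, fun I _ _ hI i => ?_,
    fun I _ _ hI i hi N _ _ => ?_, ?_, fun N _ _ hN i hi => ?_, fun n hn j hj => ?_,
    fun n k hk hn => ?_, fun n hn hs => ?_⟩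
  · apply le_antisymm
    · intro c hc
      obtain ⟨b, -, hb⟩ := (Submodule.Quotient.mk_eq_zero _).1 hc
      obtain ⟨c', rfl⟩ := h.surjB b
      have hb : x • πB c' = πB c := hb
      have h1 : c - x • c' ∈ LinearMap.ker πB := by
        rw [LinearMap.mem_ker, map_sub, map_smul, hb, sub_self]
      rw [h.kerB] at h1
      rw [← sub_add_cancel c (x • c')]
      refine add_mem (Submodule.smul_mono_left (LinearMap.ker_le_ker_comp _ _) h1)
        (Submodule.smul_mem_smul ?_ trivial)
      rw [LinearMap.mem_ker, LinearMap.comp_apply, Submodule.mkQ_apply,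
        Submodule.Quotient.mk_eq_zero,
        show πA x = x • πA 1 by rw [← map_smul, smul_eq_mul, mul_one]]
      exact Submodule.smul_mem_pointwise_smul (R := R) (πA 1) x (⊤ : Submodule R A) Submodule.mem_top
    · rw [Submodule.smul_le]
      intro r hr c _
      obtain ⟨a, -, ha⟩ := (Submodule.Quotient.mk_eq_zero _).1 hr
      obtain ⟨r', rfl⟩ := h.surjA a
      have ha : πA (r - x * r') = 0 := by
        rw [map_sub, sub_eq_zero, ← smul_eq_mul, map_smul]; exact ha.symm
      have h2 := h.smul_B ha (πB c)
      rw [sub_smul, sub_eq_zero] at h2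
      rw [LinearMap.mem_ker, LinearMap.comp_apply, Submodule.mkQ_apply,
        Submodule.Quotient.mk_eq_zero, map_smul, h2, mul_smul]
      exact Submodule.smul_mem_pointwise_smul _ _ _ Submodule.mem_top
  · obtain ⟨ψ, hψ⟩ := ExtVanish.exists_lift hB (h.extCB 0) φ
    obtain ⟨r, rfl⟩ := h.hom_eq ψ
    exact ⟨r, by rw [← hψ, LinearMap.comp_smul]⟩
  · -- `r • πB` is divisible by `x`
    have hmem : ∀ c, ∃ b, x • b = r • πB c := fun c => by
      have := LinearMap.congr_fun hr c
      rw [LinearMap.smul_apply, LinearMap.comp_apply, ← map_smul] at this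
      obtain ⟨b, -, hb⟩ := (Submodule.Quotient.mk_eq_zero _).1 this
      exact ⟨b, hb⟩
    let e := LinearEquiv.ofInjective (LinearMap.lsmul R B x) hB.inj
    have hr' : ∀ c, (r • πB) c ∈ LinearMap.range (LinearMap.lsmul R B x) := hmem
    obtain ⟨r', hr'⟩ := h.hom_eq (e.symm.toLinearMap ∘ₗ (r • πB).codRestrict _ hr')
    have h3 : (r - x * r') • πB = 0 := by
      ext c
      have h4 := LinearMap.congr_fun hr' c
      have h5 := congrArg Subtype.val ((LinearEquiv.symm_apply_eq e).1 h4)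
      rw [sub_smul, LinearMap.sub_apply, mul_smul, LinearMap.smul_apply, LinearMap.smul_apply,
        LinearMap.zero_apply, sub_eq_zero]
      exact h5
    have h4 := h.hom_zero _ h3
    rw [map_sub, sub_eq_zero, ← smul_eq_mul, map_smul] at h4
    rw [LinearMap.comp_apply, h4, Submodule.mkQ_apply, Submodule.Quotient.mk_eq_zero]
    exact Submodule.smul_mem_pointwise_smul _ _ _ Submodule.mem_top
  · exact .co_right hB (h.extCB i) (h.extCB (i + 1))
  · obtain ⟨i, rfl⟩ : ∃ j, i = j + 1 := ⟨i - 1, by omega⟩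
    exact .contra_right hA (h.pd i (by omega) N) (h.pd (i + 1) (by omega) N)
  · rcases i with _ | i
    · refine .one_of_extend hA (h.extHom I hI 0) fun φ => ?_
      obtain ⟨ψ, hψ⟩ := h.exists_of_hom φ
      obtain ⟨ψ', hψ'⟩ := hI.exists_comp_eq _ hB.inj ψ
      obtain ⟨φ', hφ'⟩ := h.exists_to_hom ψ'
      refine ⟨φ', LinearMap.ext fun a => ?_⟩
      obtain ⟨r, rfl⟩ := h.surjA a
      ext c
      rw [LinearMap.comp_apply, LinearMap.lsmul_apply, ← map_smul, hφ']
      conv_rhs => rw [← mul_one r, ← smul_eq_mul, map_smul, map_smul, LinearMap.smul_apply,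
        ← hψ, ← map_smul, ← map_smul, ← hψ']
      rw [LinearMap.comp_apply, LinearMap.lsmul_apply, ← map_smul, smul_eq_mul, mul_smul]
    · exact .contra_right hA (h.extHom I hI i) (h.extHom I hI (i + 1))
  · obtain ⟨i, rfl⟩ : ∃ j, i = j + 1 := ⟨i - 1, by omega⟩
    exact .co_left (isSES_hom_quotSMulTop hI hxA) (h.injDim I hI i (by omega) N)
      (h.injDim I hI (i + 1) (by omega) N)
  · have h1 := Module.supportDim_quotSMulTop_succ_eq_supportDim hxA hxm
    rw [← h.dim, ← h1]
    push_cast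
    rw [add_assoc, add_comm (1 : WithBot ℕ∞)]
  · exact h.desc N hN i (.of_smul_right hB (hN x hxm) hi)
  · exact h.depth (n + 1) (hdepth hx n hn) j (by omega)
  · have h1 := hdepth hxA n hn
    obtain ⟨φ, hφ, hinj⟩ := h.top (n + 1) k (by omega) h1
    have h2 := h1 n (by omega)
    refine ⟨φ ∘ₗ LC.δ (maximalIdeal R) n hA, hrange hφ hinj, hinj.comp ?_⟩
    change Function.Injective (LC.δ (maximalIdeal R) n hA)
    rw [injective_iff_map_eq_zero]
    intro z hz
    obtain ⟨w, rfl⟩ := (LC.exact_right (maximalIdeal R) n hA z).1 hz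
    rw [Subsingleton.elim w 0, map_zero]
  · obtain ⟨φ, hφ, hinj⟩ := h.divis (n + 1) (by omega) (by omega)
    exact ⟨φ ∘ₗ LC.δ (maximalIdeal R) n hA, hrange hφ (hinj (by omega)), fun h0 => by omega⟩

end RegChain
end

section
open IsLocalRing Pointwise TensorProduct

section
variable {R : Type u} [CommRing R] {A B D : Type u} [AddCommGroup A] [AddCommGroup B]
  [AddCommGroup D] [Module R A] [Module R B] [Module R D]

lemma exists_tors_lift (a : Ideal R) {f : A →ₗ[R] B} {g : B →ₗ[R] D} (h : IsSES f g)
    (hA : Subsingleton (LC a 1 A)) {z : D} (hz : z ∈ tors a D) : ∃ w ∈ tors a B, g w = z := by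
  obtain ⟨y, hy⟩ := LC.map_surjective a h hA ((LC.zeroEquiv a).symm ⟨z, hz⟩)
  refine ⟨LC.zeroEquiv a y, (LC.zeroEquiv a y).2, ?_⟩
  have := congrArg (fun t => (LC.zeroEquiv a t : D)) hy
  simp only [LinearEquiv.apply_symm_apply] at this
  rw [← this, LC.zeroEquiv_apply, LC.zeroEquiv_apply, LC.ev_map]

lemma exists_socle (a : Ideal R) {z : D} (hz : z ∈ tors a D) (h0 : z ≠ 0) :
    ∃ r : R, r • z ≠ 0 ∧ ∀ x ∈ a, x • r • z = 0 := by
  obtain ⟨n, hn⟩ := mem_tors.1 hz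
  induction n generalizing z with
  | zero => exact absurd (by simpa using hn 1 (by simp)) h0
  | succ n ih =>
    by_cases h : ∀ r ∈ a ^ n, r • z = 0
    · exact ih hz h0 h
    · push Not at h
      obtain ⟨r, hr, hrz⟩ := h
      refine ⟨r, hrz, fun x hx => ?_⟩
      rw [smul_smul]
      exact hn _ (by rw [pow_succ']; exact Ideal.mul_mem_mul hx hr)

/-- A surjection splits on submodules killed by the maximal ideal. -/
lemma exists_section_socle [IsLocalRing R] (h : A →ₗ[R] B)
    (hA : ∀ r ∈ maximalIdeal R, ∀ x : A, r • x = 0)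
    (hB : ∀ r ∈ maximalIdeal R, ∀ x : B, r • x = 0) (hs : Function.Surjective h) :
    ∃ g : B →ₗ[R] A, h ∘ₗ g = LinearMap.id := by
  have hA' : Module.IsTorsionBySet R A (maximalIdeal R) := fun x r => hA r r.2 x
  have hB' : Module.IsTorsionBySet R B (maximalIdeal R) := fun x r => hB r r.2 x
  let := hA'.module
  let := hB'.module
  let : Field (R ⧸ maximalIdeal R) := Ideal.Quotient.field _
  let h' : A →ₗ[R ⧸ maximalIdeal R] B :=
    { toFun := h
      map_add' := map_add h
      map_smul' := fun r x => by
        obtain ⟨r, rfl⟩ := Ideal.Quotient.mk_surjective r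
        exact map_smul h r x }
  obtain ⟨g, hg⟩ := h'.exists_rightInverse_of_surjective (LinearMap.range_eq_top.2 hs)
  refine ⟨{ toFun := g, map_add' := map_add g,
            map_smul' := fun r x => map_smul g (Ideal.Quotient.mk _ r) x }, ?_⟩
  ext x
  exact LinearMap.congr_fun hg x

end

variable {R : Type u} [CommRing R] [IsNoetherianRing R]

section
variable {C : Type u} [AddCommGroup C] [Module R C]

/-- Evaluation `C ⊗ Hom(C, I) → I`. -/
def evalHom (C I : Type u) [AddCommGroup C] [Module R C] [AddCommGroup I] [Module R I] :
    C ⊗[R] (C →ₗ[R] I) →ₗ[R] I :=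
  TensorProduct.lift LinearMap.applyₗ

@[simp] lemma evalHom_tmul {I : Type u} [AddCommGroup I] [Module R I] (c : C) (f : C →ₗ[R] I) :
    evalHom C I (c ⊗ₜ f) = f c := rfl

variable {I J : Type u} [AddCommGroup I] [Module R I] [AddCommGroup J] [Module R J]

lemma Semidual.evalHom_bijective (hC : Semidual R C) (hI : Module.Injective R I) :
    Function.Bijective (evalHom (R := R) C I) := by
  have := hC.finite
  let e := LinearEquiv.ofBijective _ hC.bij
  let e' : ((C →ₗ[R] C) →ₗ[R] I) ≃ₗ[R] I :=
    (e.congrLeft I R).symm ≪≫ₗ LinearMap.ringLmapEquivSelf R R I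
  have : evalHom (R := R) C I = e'.toLinearMap ∘ₗ homEval R C C I := by
    ext c f
    simp [e', LinearEquiv.congrLeft, e]
  rw [this]
  exact e'.bijective.comp (homEval_bijective hI)

lemma Semidual.exists_hom (hC : Semidual R C) (hJ : Module.Injective R J)
    (φ : (C →ₗ[R] J) →ₗ[R] (C →ₗ[R] I)) : ∃ h : J →ₗ[R] I, ∀ f, φ f = h ∘ₗ f := by
  let e := LinearEquiv.ofBijective _ (hC.evalHom_bijective hJ)
  refine ⟨evalHom C I ∘ₗ φ.lTensor C ∘ₗ e.symm.toLinearMap, fun f => ?_⟩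
  ext c
  have : e.symm (f c) = c ⊗ₜ f := (LinearEquiv.symm_apply_eq e).2 rfl
  simp [this]

/-- `N` has a resolution of length `n` by modules `Hom(C, I)` with `I` injective. -/
def Resolved (R : Type u) [CommRing R] (C : Type u) [AddCommGroup C] [Module R C] :
    ℕ → ∀ (N : Type u) [AddCommGroup N] [Module R N], Prop
  | 0, _, _, _ => True
  | n + 1, N, _, _ => ∃ (I : ModuleCat.{u} R) (p : (C →ₗ[R] I) →ₗ[R] N),
      Module.Injective R I ∧ Function.Surjective p ∧ Resolved R C n (LinearMap.ker p)

end

variable [IsLocalRing R]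

namespace RegChain
variable {C A B : Type u} [AddCommGroup C] [AddCommGroup A] [AddCommGroup B]
  [Module R C] [Module R A] [Module R B]
  {d s : ℕ} {πA : R →ₗ[R] A} {πB : C →ₗ[R] B} (h : RegChain d s πA πB)
include h

lemma finite_A : Module.Finite R A := .of_surjective πA h.surjA

lemma annihilator_A {r : R} (hr : πA r = 0) (a : A) : r • a = 0 := by
  obtain ⟨x, rfl⟩ := h.surjA a
  rw [← map_smul, smul_eq_mul, mul_comm, ← smul_eq_mul, map_smul, hr, smul_zero]

lemma hom_torsion {X : Type u} [AddCommGroup X] [Module R X] (φ : A →ₗ[R] X) {r : R}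
    (hr : πA r = 0) : r • φ (πA 1) = 0 := by
  rw [← map_smul, h.annihilator_A hr, map_zero]

lemma exists_hom_of_torsion {X : Type u} [AddCommGroup X] [Module R X] {x : X}
    (hx : ∀ r, πA r = 0 → r • x = 0) : ∃ φ : A →ₗ[R] X, φ (πA 1) = x := by
  have hle : LinearMap.ker πA ≤ LinearMap.ker (LinearMap.toSpanSingleton R X x) :=
    fun r hr => hx r hr
  refine ⟨(LinearMap.ker πA).liftQ _ hle ∘ₗ (πA.quotKerEquivOfSurjective h.surjA).symm, ?_⟩
  rw [LinearMap.comp_apply, LinearEquiv.coe_coe,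
    show (πA.quotKerEquivOfSurjective h.surjA).symm (πA 1) = Submodule.Quotient.mk 1 from
      (LinearEquiv.symm_apply_eq _).2 rfl]
  exact one_smul R x

lemma exists_factor {I : Type u} [AddCommGroup I] [Module R I] (f : C →ₗ[R] I)
    (hf : ∀ r, πA r = 0 → r • f = 0) : ∃ ψ : B →ₗ[R] I, ψ ∘ₗ πB = f := by
  obtain ⟨φ, hφ⟩ := h.exists_hom_of_torsion hf
  obtain ⟨ψ, hψ⟩ := h.exists_of_hom φ
  exact ⟨ψ, LinearMap.ext fun c => by rw [← hφ]; exact hψ c⟩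

lemma extVanish_resolved {n : ℕ} : ∀ {N : Type u} [AddCommGroup N] [Module R N],
    Resolved R C n N → ∀ i, s < i + 1 + n → ExtVanish R (i + 1) A N := by
  induction n with
  | zero => exact fun _ i hi => h.pd i (by omega) _
  | succ n ih =>
    rintro N _ _ ⟨I, p, hI, hp, hk⟩ i hi
    exact .co_right (IsSES.of_surjective p hp) (h.extHom I hI i) (ih hk (i + 1) (by omega))

lemma subsingleton_LC_hom {n : ℕ} : ∀ {N : Type u} [AddCommGroup N] [Module R N],
    Resolved R C n N → ∀ i, d < i + 1 + n → s ≤ d → ∀ [Module.Finite R C],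
      Subsingleton (LC (maximalIdeal R) (i + 1) (A →ₗ[R] N)) := by
  have := h.finite_A
  have key : ∀ (N : Type u) [AddCommGroup N] [Module R N] (i : ℕ), d < i + 1 + s →
      Subsingleton (LC (maximalIdeal R) (i + 1) (A →ₗ[R] N)) := by
    intro N _ _ i hi
    refine LC.subsingleton_of_annihilator_le (A := A) _ ?_ ?_
    · intro r hr
      rw [Module.mem_annihilator] at hr ⊢
      intro φ
      ext a
      rw [LinearMap.smul_apply, ← map_smul, hr, map_zero, LinearMap.zero_apply]
    · have h1 := h.dim
      by_contra hlt
      rw [not_lt] at hlt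
      have h2 : (((i + 1 : ℕ) : WithBot ℕ∞) + (s : WithBot ℕ∞)) ≤ (d : WithBot ℕ∞) := by
        rw [← h1]; gcongr
      have h3 : i + 1 + s ≤ d := by exact_mod_cast h2
      omega
  induction n with
  | zero => exact fun _ i hi _ => key _ i (by omega)
  | succ n ih =>
    rintro N _ _ ⟨I, p, hI, hp, hk⟩ i hi hs _
    by_cases his : d < i + 1 + s
    · exact key _ i his
    · have hses := (IsSES.of_surjective p hp).hom_of_injective A
        (h.extVanish_resolved hk 0 (by omega))
      refine LC.sub_right _ hses ?_ (ih hk (i + 1) (by omega) hs)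
      have e : (A ⊗[R] C →ₗ[R] I) ≃ₗ[R] (A →ₗ[R] C →ₗ[R] I) :=
        (TensorProduct.lift.equiv (RingHom.id R) A C I).symm
      have h0 : Subsingleton (LC (maximalIdeal R) (i + 1) (A ⊗[R] C →ₗ[R] I)) :=
        LC.subsingleton_hom_of_injective _ hI i
      exact (LC.sub_congr (maximalIdeal R) e).1 h0

/-- The key step: as long as the local cohomology is divisible, the module `B` has positive
depth. -/
lemma tors_eq_bot (hC : Semidual R C) {H I₁ I₂ : Type u} [AddCommGroup H] [Module R H]
    [AddCommGroup I₁] [Module R I₁] [AddCommGroup I₂] [Module R I₂]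
    (hI₁ : Module.Injective R I₁) (hI₂ : Module.Injective R I₂)
    {p : (C →ₗ[R] I₁) →ₗ[R] H} (hp : Function.Surjective p)
    {q : (C →ₗ[R] I₂) →ₗ[R] LinearMap.ker p} (hq : Function.Surjective q)
    (h1 : ExtVanish R 1 A (LinearMap.ker p)) (h2 : ExtVanish R 1 A (LinearMap.ker q))
    (h3 : Subsingleton (LC (maximalIdeal R) 1 (A →ₗ[R] LinearMap.ker p)))
    (hH : tors (maximalIdeal R) H = ⊤) {y : R} (hy : y ∈ maximalIdeal R)
    (hdiv : ∀ z : H, (∀ r, πA r = 0 → r • z = 0) →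
      ∃ w, (∀ r, πA r = 0 → r • w = 0) ∧ y • w = z)
    (hne : ∃ z : H, z ≠ 0 ∧ ∀ r, πA r = 0 → r • z = 0) :
    tors (maximalIdeal R) B = ⊥ := by
  have hfA := h.finite_A
  have := hC.finite
  by_contra hB
  obtain ⟨c', hc', hc0'⟩ := (Submodule.ne_bot_iff _).1 hB
  obtain ⟨r, hc0, hmc⟩ := exists_socle _ hc' hc0'
  obtain ⟨c, hc⟩ := h.surjB (r • c')
  rw [← hc] at hc0 hmc
  clear hc hc' hc0' c' r
  obtain ⟨t, ht⟩ := hC.exists_hom hI₂ ((LinearMap.ker p).subtype ∘ₗ q)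
  have hpt : ∀ g : C →ₗ[R] I₂, p (t ∘ₗ g) = 0 := fun g => by
    rw [← ht]; exact (q g).2
  -- lifting along `t`
  have S2 : ∀ f : C →ₗ[R] I₁, (∀ r, πA r = 0 → r • f = 0) → p f = 0 →
      ∃ g : C →ₗ[R] I₂, (∀ r, πA r = 0 → r • g = 0) ∧ t ∘ₗ g = f := by
    intro f hf hpf
    obtain ⟨φ, hφ⟩ := h.exists_hom_of_torsion (x := (⟨f, hpf⟩ : LinearMap.ker p))
      fun r hr => Subtype.ext (hf r hr)
    obtain ⟨ψ, hψ⟩ := ExtVanish.exists_lift (IsSES.of_surjective q hq) h2 φ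
    refine ⟨ψ (πA 1), fun r hr => h.hom_torsion ψ hr, ?_⟩
    rw [← ht, LinearMap.comp_apply, ← LinearMap.comp_apply q, hψ, hφ]
    rfl
  have S0 : ∀ z : H, (∀ r, πA r = 0 → r • z = 0) →
      ∃ f : C →ₗ[R] I₁, (∀ r, πA r = 0 → r • f = 0) ∧ p f = z ∧
        f ∈ tors (maximalIdeal R) (C →ₗ[R] I₁) := by
    intro z hz
    obtain ⟨φ, hφ⟩ := h.exists_hom_of_torsion hz
    obtain ⟨ψ, hψt, hψ⟩ := exists_tors_lift (maximalIdeal R)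
      ((IsSES.of_surjective p hp).hom_of_injective A h1) h3
      (z := φ) (by rw [tors_hom_eq_top _ hH]; trivial)
    refine ⟨ψ (πA 1), fun r hr => h.hom_torsion ψ hr, ?_, ?_⟩
    · rw [← hφ, ← hψ]; rfl
    · exact map_mem_tors _ (LinearMap.applyₗ (πA 1)) hψt
  let m := maximalIdeal R
  let S₁ : Submodule R I₁ := Submodule.torsionBySet R I₁ m
  let S₂ : Submodule R I₂ := Submodule.torsionBySet R I₂ m
  have hS₁ : ∀ r ∈ m, ∀ x : S₁, r • x = 0 := fun r hr x =>
    Subtype.ext ((Submodule.mem_torsionBySet_iff _ _).1 x.2 ⟨r, hr⟩)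
  have hS₂ : ∀ r ∈ m, ∀ x : S₂, r • x = 0 := fun r hr x =>
    Subtype.ext ((Submodule.mem_torsionBySet_iff _ _).1 x.2 ⟨r, hr⟩)
  have hres : ∀ x ∈ S₂, t x ∈ S₁ := fun x hx => by
    rw [Submodule.mem_torsionBySet_iff] at hx ⊢
    intro r
    rw [← map_smul, hx, map_zero]
  have hkey : ∀ r ∈ m, ∀ (I : Type u) [AddCommGroup I] [Module R I]
      (f : C →ₗ[R] I), (∀ r, πA r = 0 → r • f = 0) → f (r • c) = 0 := by
    intro r hr I _ _ f hf
    obtain ⟨ψ, rfl⟩ := h.exists_factor f hf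
    rw [LinearMap.comp_apply, map_smul, hmc r hr, map_zero]
  have honto : Function.Surjective (t.restrict hres) := by
    rintro ⟨x, hx⟩
    rw [Submodule.mem_torsionBySet_iff] at hx
    obtain ⟨ψ, hψ⟩ : ∃ ψ : B →ₗ[R] I₁, ψ (πB c) = x := by
      let f0 := LinearMap.toSpanSingleton R B (πB c)
      have hle : LinearMap.ker f0.rangeRestrict ≤
          LinearMap.ker (LinearMap.toSpanSingleton R I₁ x) := by
        intro r hr
        rw [LinearMap.ker_rangeRestrict] at hr
        have hr : r • πB c = 0 := hr
        refine hx ⟨r, ?_⟩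
        by_contra hu
        rw [SetLike.mem_coe, mem_maximalIdeal, mem_nonunits_iff, not_not] at hu
        exact hc0 (hu.smul_eq_zero.1 hr)
      let e := f0.rangeRestrict.quotKerEquivOfSurjective f0.surjective_rangeRestrict
      obtain ⟨ψ, hψ⟩ := hI₁.exists_comp_eq (LinearMap.range f0).subtype Subtype.val_injective
        ((LinearMap.ker f0.rangeRestrict).liftQ _ hle ∘ₗ e.symm.toLinearMap)
      refine ⟨ψ, ?_⟩
      have h5 := LinearMap.congr_fun hψ (f0.rangeRestrict 1)
      rw [LinearMap.comp_apply, LinearMap.comp_apply, LinearEquiv.coe_coe,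
        show e.symm (f0.rangeRestrict 1) = Submodule.Quotient.mk 1 from
          (LinearEquiv.symm_apply_eq _).2 rfl] at h5
      have h6 : ((f0.rangeRestrict 1 : LinearMap.range f0) : B) = πB c := one_smul R _
      rw [Submodule.subtype_apply, h6] at h5
      rw [h5]
      exact one_smul R x
    have hf : ∀ r, πA r = 0 → r • (ψ ∘ₗ πB) = 0 := fun r hr => by
      ext c'
      rw [LinearMap.smul_apply, LinearMap.comp_apply, ← map_smul, h.smul_B hr, map_zero,
        LinearMap.zero_apply]
    obtain ⟨w, hw, hyw⟩ := hdiv (p (ψ ∘ₗ πB)) fun r hr => by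
      rw [← map_smul, hf r hr, map_zero]
    obtain ⟨f₂, hf₂, hpf₂, -⟩ := S0 w hw
    obtain ⟨g, hg, hgf⟩ := S2 (ψ ∘ₗ πB - y • f₂)
      (fun r hr => by rw [smul_sub, hf r hr, smul_comm, hf₂ r hr, smul_zero, sub_zero])
      (by rw [map_sub, map_smul, hpf₂, hyw, sub_self])
    have hgc : g c ∈ S₂ := by
      rw [Submodule.mem_torsionBySet_iff]
      rintro ⟨r, hr⟩
      change r • g c = 0
      rw [← map_smul]
      exact hkey r hr _ g hg
    refine ⟨⟨g c, hgc⟩, Subtype.ext ?_⟩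
    have h7 := LinearMap.congr_fun hgf c
    rw [LinearMap.sub_apply, LinearMap.smul_apply, ← map_smul f₂, hkey y hy _ f₂ hf₂,
      sub_zero, LinearMap.comp_apply, LinearMap.comp_apply, hψ] at h7
    exact h7
  obtain ⟨σ, hσ⟩ := exists_section_socle (t.restrict hres) hS₂ hS₁ honto
  obtain ⟨g, hg⟩ := hI₂.exists_comp_eq S₁.subtype Subtype.val_injective (S₂.subtype ∘ₗ σ)
  have hu : ∀ x ∈ S₁, t (g x) = x := fun x hx => by
    have h5 : g x = σ ⟨x, hx⟩ := LinearMap.congr_fun hg ⟨x, hx⟩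
    have h6 := congrArg Subtype.val (LinearMap.congr_fun hσ ⟨x, hx⟩)
    rw [h5]
    exact h6
  have hfac : ∀ n : ℕ, ∀ f : C →ₗ[R] I₁, (∀ r ∈ m ^ n, r • f = 0) →
      ∃ g' : C →ₗ[R] I₂, t ∘ₗ g' = f := by
    intro n
    induction n with
    | zero =>
      intro f hf
      exact ⟨0, by simpa using (hf 1 (by simp)).symm⟩
    | succ n ih =>
      intro f hf
      obtain ⟨g', hg'⟩ := ih (f - t ∘ₗ g ∘ₗ f) (by
        intro r hr
        ext c'
        have h8 : r • f c' ∈ S₁ := by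
          rw [Submodule.mem_torsionBySet_iff]
          rintro ⟨x, hx⟩
          have h9 := LinearMap.congr_fun
            (hf (x * r) (by rw [pow_succ']; exact Ideal.mul_mem_mul hx hr)) c'
          rwa [mul_smul] at h9
        simp only [LinearMap.smul_apply, LinearMap.sub_apply, LinearMap.comp_apply,
          LinearMap.zero_apply]
        rw [smul_sub, ← map_smul t, ← map_smul g, hu _ h8, sub_self])
      exact ⟨g' + g ∘ₗ f, by rw [LinearMap.comp_add, hg', sub_add_cancel]⟩
  obtain ⟨z, hz0, hz⟩ := hne
  obtain ⟨f, -, rfl, n, hn⟩ := S0 z hz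
  obtain ⟨g', rfl⟩ := hfac n f hn
  exact hz0 (hpt g')

end RegChain
end

section
open IsLocalRing Pointwise TensorProduct

variable {R : Type u} [CommRing R] [IsNoetherianRing R] [IsLocalRing R]

lemma tors_eq_top_of_supportDim_le {M : Type u} [AddCommGroup M] [Module R M] [Module.Finite R M]
    (h : Module.supportDim R M ≤ 0) : tors (maximalIdeal R) M = ⊤ := by
  obtain ⟨x, hx, hreg⟩ := exists_regular (maximalIdeal R)
    (tors_quotient_tors (M := M) (maximalIdeal R) fun n => IsNoetherian.noetherian _)
  have h1 := Module.supportDim_quotSMulTop_succ_eq_supportDim hreg hx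
  have h2 : Module.supportDim R (QuotSMulTop x (M ⧸ tors (maximalIdeal R) M)) + 1 ≤ 0 := by
    rw [h1]
    exact (Module.supportDim_le_of_surjective _ (Submodule.mkQ_surjective _)).trans h
  have h3 : Module.supportDim R (QuotSMulTop x (M ⧸ tors (maximalIdeal R) M)) = ⊥ := by
    cases hA : Module.supportDim R (QuotSMulTop x (M ⧸ tors (maximalIdeal R) M)) with
    | bot => rfl
    | coe a =>
      rw [hA] at h2
      have h3 : a + 1 ≤ 0 := by exact_mod_cast h2
      simp at h3
  rw [h3, WithBot.bot_add, eq_comm, Module.supportDim_eq_bot_iff_subsingleton,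
    Submodule.Quotient.subsingleton_iff] at h1
  exact h1

namespace RegChain
variable {C A B : Type u} [AddCommGroup C] [AddCommGroup A] [AddCommGroup B]
  [Module R C] [Module R A] [Module R B]
  {d s : ℕ} {πA : R →ₗ[R] A} {πB : C →ₗ[R] B} (h : RegChain d s πA πB)
include h

/-- The homothety isomorphism `A ≃ Hom(C, B)`. -/
lemma exists_homEquiv : Nonempty (A ≃ₗ[R] (C →ₗ[R] B)) := by
  let φ : R →ₗ[R] (C →ₗ[R] B) := LinearMap.toSpanSingleton R _ πB
  have hφ : Function.Surjective φ := fun ψ => by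
    obtain ⟨r, hr⟩ := h.hom_eq ψ
    exact ⟨r, hr.symm⟩
  have hker : LinearMap.ker πA = LinearMap.ker φ := by
    ext r
    refine ⟨fun hr => LinearMap.ext fun c => h.smul_B hr _, fun hr => h.hom_zero r hr⟩
  exact ⟨(πA.quotKerEquivOfSurjective h.surjA).symm ≪≫ₗ
    Submodule.quotEquivOfEq _ _ hker ≪≫ₗ φ.quotKerEquivOfSurjective hφ⟩

/-- At the end of the chain the module `B` is a retract of the injective hull of `A`. -/
lemma extVanish_B [Module.Finite R C] {H I : Type u} [AddCommGroup H] [Module R H]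
    [AddCommGroup I] [Module R I] (hI : Module.Injective R I)
    {p : (C →ₗ[R] I) →ₗ[R] H} (hp : Function.Surjective p)
    (h1 : ExtVanish R 1 A (LinearMap.ker p))
    {ψ : A →ₗ[R] H} (hψ : LinearMap.range ψ = Submodule.torsionBySet R H (LinearMap.ker πA))
    (hinj : Function.Injective ψ) {i : ℕ} (hi : s ≤ i) (N : Type u) [AddCommGroup N]
    [Module R N] : ExtVanish R (i + 1) N B := by
  obtain ⟨φ, hφ⟩ := ExtVanish.exists_lift (IsSES.of_surjective p hp) h1 ψ
  obtain ⟨f, hf⟩ := h.exists_factor (φ (πA 1)) fun r hr => h.hom_torsion φ hr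
  -- the map `Hom(B, I) → A`
  have hmem : ∀ g : B →ₗ[R] I, (p ∘ₗ LinearMap.lcomp R I πB) g ∈ LinearMap.range ψ := by
    intro g
    rw [hψ, Submodule.mem_torsionBySet_iff]
    rintro ⟨r, hr⟩
    change r • p (g ∘ₗ πB) = 0
    have : r • (g ∘ₗ πB) = 0 := by
      ext c
      rw [LinearMap.smul_apply, LinearMap.comp_apply, ← map_smul, h.smul_B hr, map_zero,
        LinearMap.zero_apply]
    rw [← map_smul, this, map_zero]
  let e := LinearEquiv.ofInjective ψ hinj
  let β : (B →ₗ[R] I) →ₗ[R] A := e.symm.toLinearMap ∘ₗ LinearMap.codRestrict _ _ hmem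
  have hβ : β f = πA 1 := by
    refine (LinearEquiv.symm_apply_eq e).2 (Subtype.ext ?_)
    change p (f ∘ₗ πB) = ψ (πA 1)
    rw [hf]
    exact LinearMap.congr_fun hφ _
  have hleB : LinearMap.ker πB ≤
      LinearMap.ker ((TensorProduct.mk R C (B →ₗ[R] I)).flip f) := by
    rw [h.kerB, Submodule.smul_le]
    intro r hr c _
    change (r • c) ⊗ₜ[R] f = 0
    have : r • f = 0 := by
      ext b
      rw [LinearMap.smul_apply, ← map_smul, h.smul_B hr, map_zero, LinearMap.zero_apply]
    rw [TensorProduct.smul_tmul, this, TensorProduct.tmul_zero]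
  let eB := πB.quotKerEquivOfSurjective h.surjB
  let σ : B →ₗ[R] C ⊗[R] (B →ₗ[R] I) := (LinearMap.ker πB).liftQ _ hleB ∘ₗ eB.symm.toLinearMap
  have hσ : ∀ c, σ (πB c) = c ⊗ₜ f := fun c => by
    have : eB.symm (πB c) = Submodule.Quotient.mk c := (LinearEquiv.symm_apply_eq _).2 rfl
    simp only [σ, LinearMap.comp_apply, LinearEquiv.coe_coe, this]
    rfl
  have hleA : LinearMap.ker πA ≤ LinearMap.ker (LinearMap.toSpanSingleton R (C →ₗ[R] B) πB) := by
    intro r hr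
    exact LinearMap.ext fun c => h.smul_B hr _
  let eA := πA.quotKerEquivOfSurjective h.surjA
  let γ : A →ₗ[R] (C →ₗ[R] B) := (LinearMap.ker πA).liftQ _ hleA ∘ₗ eA.symm.toLinearMap
  have hγ : γ (πA 1) = πB := by
    have : eA.symm (πA 1) = Submodule.Quotient.mk 1 := (LinearEquiv.symm_apply_eq _).2 rfl
    simp only [γ, LinearMap.comp_apply, LinearEquiv.coe_coe, this]
    exact one_smul R πB
  let ρ : C ⊗[R] (B →ₗ[R] I) →ₗ[R] B := TensorProduct.lift (γ ∘ₗ β).flip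
  have hρσ : ρ ∘ₗ σ = LinearMap.id := by
    ext b
    obtain ⟨c, rfl⟩ := h.surjB b
    rw [LinearMap.comp_apply, hσ]
    change γ (β f) c = πB c
    rw [hβ, hγ]
  obtain ⟨e1⟩ := h.exists_homEquiv
  let e2 : C ⊗[R] (B →ₗ[R] I) ≃ₗ[R] ((C →ₗ[R] B) →ₗ[R] I) :=
    LinearEquiv.ofBijective _ (homEval_bijective hI)
  let e3 : ((C →ₗ[R] B) →ₗ[R] I) ≃ₗ[R] (A →ₗ[R] I) := e1.symm.congrLeft I R
  exact .retract_right σ ρ hρσ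
    ((ExtVanish.congr_right (e2 ≪≫ₗ e3)).2 (h.injDim I hI i hi N))

end RegChain

section
variable {C : Type u} [AddCommGroup C] [Module R C]

/-- Vanishing of `Ext` from the residue field gives vanishing for all finite modules. -/
lemma ExtVanish.of_residueField [Module.Finite R C] {n : ℕ}
    (hC : ∀ i, n ≤ i → ExtVanish R (i + 1) (R ⧸ maximalIdeal R) C)
    (N : Type u) [AddCommGroup N] [Module R N] [Module.Finite R N] {i : ℕ} (hi : n ≤ i) :
    ExtVanish R (i + 1) N C := by
  suffices H : ∀ (J : Ideal R) (N : Type u) [AddCommGroup N] [Module R N] [Module.Finite R N],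
      J ≤ Module.annihilator R N → ∀ i, n ≤ i → ExtVanish R (i + 1) N C from
    H ⊥ N bot_le i hi
  intro J
  induction J using WellFoundedGT.induction with
  | ind J ih =>
  intro N _ _ hN
  induction hN using IsNoetherianRing.induction_on_isQuotientEquivQuotientPrime R with
  | subsingleton N => exact fun _ i _ => .of_subsingleton_left
  | quotient N p e =>
    intro hJ i hi
    rw [ExtVanish.congr_left e]
    rw [e.annihilator_eq, Ideal.annihilator_quotient] at hJ
    by_cases hp : p.1 = maximalIdeal R
    · rw [hp]; exact hC i hi
    · obtain ⟨x, hx, hxp⟩ := Set.exists_of_ssubset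
        ((le_maximalIdeal p.2.ne_top).lt_of_ne hp)
      have hreg : IsSMulRegular (R ⧸ p.1) x := by
        rw [isSMulRegular_iff_right_eq_zero_of_smul]
        intro z hz
        obtain ⟨r, rfl⟩ := Ideal.Quotient.mk_surjective z
        have h2 : x * r ∈ p.1 := Ideal.Quotient.eq_zero_iff_mem.1 hz
        exact Ideal.Quotient.eq_zero_iff_mem.2 ((p.2.mem_or_mem h2).resolve_left hxp)
      refine .of_smul_left (isSES_of_isSMulRegular hreg) hx (i := i + 1) ?_
      refine ih (Module.annihilator R (QuotSMulTop x (R ⧸ p.1))) ?_ _ le_rfl (i + 1) (by omega)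
      refine lt_of_le_of_lt hJ (lt_of_le_of_ne ?_ ?_)
      · intro r hr
        rw [Module.mem_annihilator]
        intro z
        obtain ⟨z, rfl⟩ := Submodule.mkQ_surjective _ z
        obtain ⟨z, rfl⟩ := Ideal.Quotient.mk_surjective z
        rw [← map_smul]
        have : r • Ideal.Quotient.mk p.1 z = 0 :=
          Ideal.Quotient.eq_zero_iff_mem.2 (p.1.mul_mem_right z hr)
        rw [this, map_zero]
      · intro heq
        have : x ∈ Module.annihilator R (QuotSMulTop x (R ⧸ p.1)) := by
          rw [Module.mem_annihilator]
          intro z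
          obtain ⟨z, rfl⟩ := Submodule.mkQ_surjective _ z
          exact (isSES_of_isSMulRegular hreg).exact.apply_apply_eq_zero z
        exact hxp (heq ▸ this)
  | exact N₁ N₂ N₃ f g hf hg hfg h₁ h₃ =>
    intro hJ i hi
    exact .contra_mid ⟨hf, hfg, hg⟩ (h₁ (hJ.trans (f.annihilator_le_of_injective hf)) i hi)
      (h₃ (hJ.trans (g.annihilator_le_of_surjective hg)) i hi)

lemma RegChain.exists_of_resolved {d : ℕ} (hd : ringKrullDim R = (d : WithBot ℕ∞)) (hd2 : d ≤ 2)
    (hC : Semidual R C) (hH : Resolved R C (d + 1) (LC (maximalIdeal R) d R)) :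
    ∀ s ≤ d, ∃ (A B : ModuleCat.{u} R) (πA : R →ₗ[R] A) (πB : C →ₗ[R] B),
      RegChain d s πA πB := by
  have := hC.finite
  intro s
  induction s with
  | zero => exact fun _ => ⟨.of R R, .of R C, _, _, .nil hd hC⟩
  | succ s ih =>
    intro hs
    obtain ⟨A, B, πA, πB, h⟩ := ih (by omega)
    obtain ⟨d, rfl⟩ : ∃ k, d = k + 1 := ⟨d - 1, by omega⟩
    obtain ⟨I₁, p, hI₁, hp, hp'⟩ := hH
    have hp'' := hp'
    obtain ⟨I₂, q, hI₂, hq, hq'⟩ := hp''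
    have hfA := h.finite_A
    obtain ⟨n, rfl⟩ : ∃ n, d = n + s := ⟨d - s, by omega⟩
    obtain ⟨φ, hφ, -⟩ := h.divis (n + 1) (by omega) (by omega)
    have hdim : Module.supportDim R A < ((n + 1 + 1 : ℕ) : WithBot ℕ∞) := by
      have h1 := h.dim
      by_contra hlt
      rw [not_lt] at hlt
      have h2 : (((n + 1 + 1 : ℕ) : WithBot ℕ∞) + (s : WithBot ℕ∞)) ≤
          ((n + s + 1 : ℕ) : WithBot ℕ∞) := by
        rw [← h1]; gcongr
      have h3 : n + 1 + 1 + s ≤ n + s + 1 := by exact_mod_cast h2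
      omega
    obtain ⟨y, hy, hys⟩ := LC.exists_smul_surjective (maximalIdeal R) hdim
    have hrange : ∀ z, z ∈ LinearMap.range φ ↔ ∀ r, πA r = 0 → r • z = 0 := fun z => by
      rw [hφ, Submodule.mem_torsionBySet_iff, Subtype.forall]; rfl
    have hB := h.tors_eq_bot hC hI₁ hI₂ hp hq (h.extVanish_resolved hp' 0 (by omega))
      (h.extVanish_resolved hq' 0 (by omega)) (h.subsingleton_LC_hom hp' 0 (by omega) (by omega))
      (tors_LC _ _) hy (fun z hz => by
        obtain ⟨w, rfl⟩ := (hrange z).2 hz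
        obtain ⟨v, rfl⟩ := hys w
        exact ⟨φ v, (hrange _).1 ⟨v, rfl⟩, (map_smul φ y v).symm⟩) (by
        have := LC.nontrivial_top (M := R) (d := n + s + 1)
          (by rw [Module.supportDim_self_eq_ringKrullDim, hd])
        obtain ⟨z, hz⟩ := exists_ne (0 : LC (maximalIdeal R) (n + s + 1) R)
        obtain ⟨r, hr, hrm⟩ := exists_socle (maximalIdeal R)
          (by rw [tors_LC]; trivial : z ∈ tors (maximalIdeal R) _) hz
        refine ⟨r • z, hr, fun x hx => hrm x ?_⟩
        rw [mem_maximalIdeal, mem_nonunits_iff]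
        intro hu
        have hA : Subsingleton A := by
          refine subsingleton_of_forall_eq 0 fun a => ?_
          exact hu.smul_eq_zero.1 (h.annihilator_A hx a)
        have h1 := h.dim
        rw [(Module.supportDim_eq_bot_iff_subsingleton R _).2 hA, WithBot.bot_add] at h1
        exact absurd h1 (WithBot.bot_ne_coe))
    have hfB : Module.Finite R B := .of_surjective πB h.surjB
    obtain ⟨x, hxm, hx⟩ := exists_regular _ hB
    exact ⟨.of R (QuotSMulTop x A), .of R (QuotSMulTop x B), _, _, h.cons hC hxm hx⟩

/-- If `H_m^d(R)` has a resolution of length `d + 1` by `C`-injective modules then `C` has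
finite injective dimension. -/
theorem Semidual.extVanish_of_resolved {d : ℕ} (hd : ringKrullDim R = (d : WithBot ℕ∞))
    (hd2 : d ≤ 2) (hC : Semidual R C)
    (hH : Resolved R C (d + 1) (LC (maximalIdeal R) d R)) (N : Type u) [AddCommGroup N]
    [Module R N] [Module.Finite R N] {i : ℕ} (hi : d ≤ i) : ExtVanish R (i + 1) N C := by
  have := hC.finite
  refine .of_residueField (fun i hi => ?_) N hi
  obtain ⟨A, B, πA, πB, h⟩ := RegChain.exists_of_resolved hd hd2 hC hH d le_rfl
  have hfA := h.finite_A
  refine h.desc _ (fun r hr z => ?_) _ ?_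
  · obtain ⟨z, rfl⟩ := Ideal.Quotient.mk_surjective z
    exact Ideal.Quotient.eq_zero_iff_mem.2 ((maximalIdeal R).mul_mem_right z hr)
  obtain ⟨I, p, hI, hp, hp'⟩ := hH
  obtain ⟨ψ, hψ, hinj⟩ := h.top 0 d (by omega) (fun j hj => absurd hj (by omega))
  have hAt : tors (maximalIdeal R) A = ⊤ := by
    have h1 := h.dim
    have h2 : Module.supportDim R A ≤ 0 := by
      cases hA : Module.supportDim R A with
      | bot => exact bot_le
      | coe a =>
        rw [hA] at h1
        have h3 : a + d = d := by exact_mod_cast h1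
        have h4 : a = 0 := by
          have : a + (d : ℕ∞) = 0 + d := by rw [h3, zero_add]
          exact WithTop.add_right_cancel (ENat.natCast_ne_top d) this
        rw [h4]; rfl
    exact tors_eq_top_of_supportDim_le h2
  let e : A ≃ₗ[R] LC (maximalIdeal R) 0 A :=
    (LinearEquiv.ofTop _ hAt).symm ≪≫ₗ (LC.zeroEquiv _).symm
  refine h.extVanish_B hI hp (h.extVanish_resolved hp' 0 (by omega)) (ψ := ψ ∘ₗ e.toLinearMap)
    ?_ (hinj.comp e.injective) hi _
  rw [LinearMap.range_comp, LinearEquiv.range, Submodule.map_top, hψ]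

end
end

section
open IsLocalRing Pointwise TensorProduct

variable {R : Type u} [CommRing R]

section
variable {M N K : Type u} [AddCommGroup M] [Module R M] [AddCommGroup N] [Module R N]
  [AddCommGroup K] [Module R K]

/-- Baer's criterion in terms of `Ext`. -/
lemma injective_of_extVanish (h : ∀ I : Ideal R, ExtVanish R 1 (R ⧸ I) K) :
    Module.Injective R K := by
  apply Module.Baer.injective
  intro I g
  obtain ⟨ψ, hψ⟩ := ExtVanish.exists_extend (IsSES.of_submodule I) (h I) g
  exact ⟨ψ, fun x hx => LinearMap.congr_fun hψ ⟨x, hx⟩⟩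

/-- Vanishing of `Ext` on finite modules implies vanishing on all modules. -/
lemma ExtVanish.of_finite {n : ℕ}
    (h : ∀ (A : Type u) [AddCommGroup A] [Module R A] [Module.Finite R A],
      ExtVanish R (n + 1) A K) : ExtVanish R (n + 1) M K := by
  induction n generalizing K with
  | zero => exact .of_injective 0 (injective_of_extVanish fun I => h _)
  | succ n ih =>
    obtain ⟨I, f, hI, hf⟩ := exists_injective_embedding (R := R) K
    have hs := IsSES.of_injective f hf
    exact .co_left hs (ih fun A _ _ _ => .co_right hs (.of_injective n hI) (h A))
      (.of_injective _ hI)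

end

variable {C : Type u} [AddCommGroup C] [Module R C] [Module.Finite R C] [IsNoetherianRing R]

/-- `K` is `Ext(C, -)`-acyclic and of injective dimension at most `n`. -/
structure CoAcyclic (R : Type u) [CommRing R] (C : Type u) [AddCommGroup C] [Module R C] (n : ℕ)
    (K : Type u) [AddCommGroup K] [Module R K] : Prop where
  inj : ∀ i, n ≤ i → ∀ (N : Type u) [AddCommGroup N] [Module R N], ExtVanish R (i + 1) N K
  acyclic : ∀ i, ExtVanish R (i + 1) C K

namespace CoAcyclic
variable {K I Q : Type u} [AddCommGroup K] [Module R K] [AddCommGroup I] [Module R I]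
  [AddCommGroup Q] [Module R Q] {f : K →ₗ[R] I} {g : I →ₗ[R] Q} {n : ℕ}

lemma injective (h : CoAcyclic R C 0 K) : Module.Injective R K :=
  injective_of_extVanish fun _ => h.inj 0 le_rfl _

lemma right (h : CoAcyclic R C (n + 1) K) (hs : IsSES f g) (hI : Module.Injective R I) :
    CoAcyclic R C n Q where
  inj i hi _ _ _ := .co_right hs (.of_injective i hI) (h.inj (i + 1) (by omega) _)
  acyclic i := .co_right hs (.of_injective i hI) (h.acyclic (i + 1))

/-- Local cohomology of `Hom(C, K)` vanishes above the injective dimension of `K`. -/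
lemma subsingleton_LC (a : Ideal R) (h : CoAcyclic R C n K) {i : ℕ} (hi : n < i) :
    Subsingleton (LC a i (C →ₗ[R] K)) := by
  induction n generalizing K i with
  | zero =>
    obtain ⟨i, rfl⟩ : ∃ j, i = j + 1 := ⟨i - 1, by omega⟩
    exact LC.subsingleton_hom_of_injective a h.injective i
  | succ n ih =>
    obtain ⟨I, f, hI, hf⟩ := exists_injective_embedding (R := R) K
    have hs := IsSES.of_injective f hf
    obtain ⟨i, rfl⟩ : ∃ j, i = j + 1 := ⟨i - 1, by omega⟩
    exact LC.sub_left a (hs.hom_of_injective C (h.acyclic 0))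
      (ih (h.right hs hI) (by omega)) (LC.subsingleton_hom_of_injective a hI i)

omit [IsNoetherianRing R] in
lemma _root_.nonempty_tors_hom_equiv (a : Ideal R) :
    Nonempty (tors a (C →ₗ[R] K) ≃ₗ[R] (C →ₗ[R] tors a K)) := by
  have h1 : ∀ φ : tors a (C →ₗ[R] K), ∀ c, (φ : C →ₗ[R] K) c ∈ tors a K := fun φ c =>
    map_mem_tors a (LinearMap.applyₗ c) φ.2
  let F : tors a (C →ₗ[R] K) →ₗ[R] (C →ₗ[R] tors a K) :=
    { toFun := fun φ => (φ : C →ₗ[R] K).codRestrict _ (h1 φ)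
      map_add' := fun _ _ => rfl
      map_smul' := fun _ _ => rfl }
  refine ⟨LinearEquiv.ofBijective F ⟨fun φ ψ h => ?_, fun ψ => ?_⟩⟩
  · refine Subtype.ext (LinearMap.ext fun c => ?_)
    exact congrArg Subtype.val (LinearMap.congr_fun h c)
  · refine ⟨⟨(tors a K).subtype ∘ₗ ψ, ?_⟩, rfl⟩
    refine map_mem_tors a (LinearMap.compRight R (tors a K).subtype) (m := ψ) ?_
    rw [tors_hom_eq_top a (tors_tors a)]
    trivial

/-- If `K` has injective dimension and depth `n`, then `H^n(Hom(C, K)) = Hom(C, H^n(K))` with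
`H^n(K)` injective. -/
lemma injective_LC (a : Ideal R) (h : CoAcyclic R C n K)
    (hK : ∀ j < n, Subsingleton (LC a j K)) :
    Module.Injective R (LC a n K) ∧
      Nonempty (LC a n (C →ₗ[R] K) ≃ₗ[R] (C →ₗ[R] LC a n K)) := by
  induction n generalizing K with
  | zero =>
    refine ⟨(injective_tors a h.injective).congr (LC.zeroEquiv a).symm, ?_⟩
    obtain ⟨e⟩ := nonempty_tors_hom_equiv (C := C) (K := K) a
    exact ⟨LC.zeroEquiv a ≪≫ₗ e ≪≫ₗ (LC.zeroEquiv a).symm.congrRight⟩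
  | succ n ih =>
    obtain ⟨I', f', hI', hf'⟩ := exists_injective_embedding (R := R) K
    let I := I' ⧸ tors a I'
    let f : K →ₗ[R] I := (tors a I').mkQ ∘ₗ f'
    have hI : Module.Injective R I :=
      (IsSES.of_submodule (tors a I')).injective_right (injective_tors a hI') hI'
    have hIt : tors a I = ⊥ := tors_quotient_tors a fun n => IsNoetherian.noetherian _
    have hKt : tors a K = ⊥ := (LC.zero_subsingleton_iff a).1 (hK 0 (by omega))
    have hf : Function.Injective f := by
      rw [injective_iff_map_eq_zero]
      intro x hx
      obtain ⟨m, hm⟩ := mem_tors.1 ((Submodule.Quotient.mk_eq_zero _).1 hx)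
      rw [← Submodule.mem_bot R, ← hKt]
      exact mem_tors.2 ⟨m, fun r hr => hf' (by rw [map_smul, hm r hr, map_zero])⟩
    have hs := IsSES.of_injective f hf
    have hs' := hs.hom_of_injective C (h.acyclic 0)
    have h0 : ∀ j, Subsingleton (LC a j I) := by
      rintro (_ | j)
      · exact (LC.zero_subsingleton_iff a).2 hIt
      · exact LC.subsingleton_of_injective a j hI
    have h0' : ∀ j, Subsingleton (LC a j (C →ₗ[R] I)) := by
      rintro (_ | j)
      · rw [LC.zero_subsingleton_iff, eq_bot_iff]
        intro φ hφ
        refine LinearMap.ext fun c => ?_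
        have : φ c ∈ tors a I := map_mem_tors a (LinearMap.applyₗ c) hφ
        rw [hIt] at this
        exact this
      · exact LC.subsingleton_hom_of_injective a hI j
    have e : ∀ {A B D : Type u} [AddCommGroup A] [AddCommGroup B] [AddCommGroup D]
        [Module R A] [Module R B] [Module R D] {f : A →ₗ[R] B} {g : B →ₗ[R] D}
        (_ : IsSES f g) (_ : ∀ j, Subsingleton (LC a j B)) (j : ℕ),
        Nonempty (LC a j D ≃ₗ[R] LC a (j + 1) A) := by
      intro A B D _ _ _ _ _ _ f g hs hB j
      refine ⟨LinearEquiv.ofBijective (LC.δ a j hs) ⟨?_, fun z => ?_⟩⟩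
      · rw [injective_iff_map_eq_zero]
        intro z hz
        have := hB j
        obtain ⟨w, rfl⟩ := (LC.exact_right a j hs z).1 hz
        rw [Subsingleton.elim w 0, map_zero]
      · have := hB (j + 1)
        exact (LC.exact_left a j hs z).1 (Subsingleton.elim _ _)
    obtain ⟨h1, ⟨e1⟩⟩ := ih (h.right hs hI) fun j hj => by
      obtain ⟨e0⟩ := e hs h0 j
      have := hK (j + 1) (by omega)
      exact e0.toEquiv.subsingleton
    obtain ⟨e0⟩ := e hs h0 n
    obtain ⟨e0'⟩ := e hs' h0' n
    exact ⟨h1.congr e0, ⟨e0'.symm ≪≫ₗ e1 ≪≫ₗ e0.congrRight⟩⟩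

/-- The top local cohomology of `Hom(C, K)` is the cokernel of a map between modules
`Hom(C, J)` with `J` injective. -/
lemma exists_presentation (a : Ideal R) (h : CoAcyclic R C n K) :
    ∃ (J₁ J₀ : ModuleCat.{u} R) (φ : (C →ₗ[R] J₁) →ₗ[R] (C →ₗ[R] J₀))
      (ψ : (C →ₗ[R] J₀) →ₗ[R] LC a n (C →ₗ[R] K)), Module.Injective R J₁ ∧ Module.Injective R J₀ ∧
        Function.Exact φ ψ ∧ Function.Surjective ψ := by
  have key : ∀ {I : Type u} [AddCommGroup I] [Module R I],
      Nonempty ((C →ₗ[R] tors a I) ≃ₗ[R] LC a 0 (C →ₗ[R] I)) := by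
    intro I _ _
    obtain ⟨e⟩ := nonempty_tors_hom_equiv (C := C) (K := I) a
    exact ⟨e.symm ≪≫ₗ (LC.zeroEquiv a).symm⟩
  induction n generalizing K with
  | zero =>
    obtain ⟨e⟩ := key (I := K)
    refine ⟨.of R PUnit, .of R (tors a K), 0, e.toLinearMap, ⟨fun X Y _ _ _ _ f hf g =>
      ⟨0, fun x => Subsingleton.elim _ _⟩⟩, injective_tors a h.injective, ?_, e.surjective⟩
    intro x
    refine ⟨fun hx => ⟨0, ?_⟩, ?_⟩
    · rw [LinearMap.zero_apply]
      exact (e.injective (by rw [map_zero]; exact hx)).symm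
    · rintro ⟨y, rfl⟩
      rw [LinearMap.zero_apply, map_zero]
  | succ n ih =>
    obtain ⟨I, f, hI, hf⟩ := exists_injective_embedding (R := R) K
    have hs := IsSES.of_injective f hf
    have hs' := hs.hom_of_injective C (h.acyclic 0)
    have hδ : Function.Surjective (LC.δ a n hs') := fun z => by
      have := LC.subsingleton_hom_of_injective (M := C) a hI n
      exact (LC.exact_left a n hs' z).1 (Subsingleton.elim _ _)
    rcases n with _ | n
    · obtain ⟨e⟩ := key (I := I)
      obtain ⟨e'⟩ := key (I := I ⧸ LinearMap.range f)
      refine ⟨.of R (tors a I), .of R (tors a (I ⧸ LinearMap.range f)),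
        e'.symm.toLinearMap ∘ₗ LC.map a 0 (LinearMap.compRight R (LinearMap.range f).mkQ) ∘ₗ
          e.toLinearMap, LC.δ a 0 hs' ∘ₗ e'.toLinearMap, injective_tors a hI,
        injective_tors a (h.right hs hI).injective, fun x => ?_, hδ.comp e'.surjective⟩
      rw [LinearMap.comp_apply, LC.exact_right a 0 hs' _]
      constructor
      · rintro ⟨y, hy⟩
        refine ⟨e.symm y, ?_⟩
        simp only [LinearMap.comp_apply, LinearEquiv.coe_coe, LinearEquiv.apply_symm_apply]
        rw [hy]
        exact e'.symm_apply_apply x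
      · rintro ⟨y, rfl⟩
        exact ⟨e y, by simp⟩
    · obtain ⟨J₁, J₀, φ, ψ, h₁, h₀, hex, hsu⟩ := ih (h.right hs hI)
      have hinj : Function.Injective (LC.δ a (n + 1) hs') := by
        rw [injective_iff_map_eq_zero]
        intro z hz
        have := LC.subsingleton_hom_of_injective (M := C) a hI n
        obtain ⟨w, rfl⟩ := (LC.exact_right a (n + 1) hs' z).1 hz
        rw [Subsingleton.elim w 0, map_zero]
      refine ⟨J₁, J₀, φ, LC.δ a (n + 1) hs' ∘ₗ ψ, h₁, h₀, fun x => ?_, hδ.comp hsu⟩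
      rw [LinearMap.comp_apply, map_eq_zero_iff _ hinj]
      exact hex x

end CoAcyclic

variable [IsLocalRing R]

/-- A maximal chain: the module `B` has depth zero. -/
lemma RegChain.exists_maximal {d : ℕ} (hd : ringKrullDim R = (d : WithBot ℕ∞))
    (hC : Semidual R C) : ∃ (s : ℕ) (A B : ModuleCat.{u} R) (πA : R →ₗ[R] A) (πB : C →ₗ[R] B),
      RegChain d s πA πB ∧ s ≤ d ∧ tors (maximalIdeal R) B ≠ ⊥ := by
  by_contra! hcon
  have hle : ∀ (s : ℕ) (A B : ModuleCat.{u} R) (πA : R →ₗ[R] A) (πB : C →ₗ[R] B),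
      RegChain d s πA πB → s ≤ d := by
    intro s A B πA πB h
    have h1 := h.dim
    cases hA : Module.supportDim R A with
    | bot => rw [hA, WithBot.bot_add] at h1; exact absurd h1 WithBot.bot_ne_coe
    | coe a =>
      rw [hA] at h1
      have h3 : a + s = d := by exact_mod_cast h1
      have : (s : ℕ∞) ≤ d := by rw [← h3]; exact le_add_self
      exact_mod_cast this
  have hall : ∀ s : ℕ, ∃ (A B : ModuleCat.{u} R) (πA : R →ₗ[R] A) (πB : C →ₗ[R] B),
      RegChain d s πA πB := by
    intro s
    induction s with
    | zero => exact ⟨.of R R, .of R C, _, _, .nil hd hC⟩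
    | succ s ih =>
      obtain ⟨A, B, πA, πB, h⟩ := ih
      have hfB : Module.Finite R B := .of_surjective πB h.surjB
      obtain ⟨x, hxm, hx⟩ := exists_regular _ (hcon s A B πA πB h (hle _ _ _ _ _ h))
      exact ⟨.of R (QuotSMulTop x A), .of R (QuotSMulTop x B), _, _, h.cons hC hxm hx⟩
  obtain ⟨A, B, πA, πB, h⟩ := hall (d + 1)
  exact absurd (hle _ _ _ _ _ h) (by omega)

lemma Semidual.exists_surjective_residue (hC : Semidual R C) :
    ∃ f : C →ₗ[R] (R ⧸ maximalIdeal R), Function.Surjective f := by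
  have := hC.finite
  obtain hN | ⟨N, hN, -⟩ := eq_top_or_exists_le_coatom (⊥ : Submodule R C)
  · have : Subsingleton C := (Submodule.subsingleton_iff R).1 (subsingleton_of_bot_eq_top hN)
    exact absurd (hC.bij.1 (Subsingleton.elim (LinearMap.lsmul R C 1) (LinearMap.lsmul R C 0)))
      one_ne_zero
  · have := isSimpleModule_iff_isCoatom.2 hN
    obtain ⟨I, hI, ⟨e⟩⟩ := isSimpleModule_iff_quot_maximal.1 this
    obtain rfl := eq_maximalIdeal hI
    exact ⟨e ∘ₗ N.mkQ, e.surjective.comp N.mkQ_surjective⟩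

/-- If `C` has finite injective dimension then this dimension is `d`, and so is the depth of
`C`. -/
lemma Semidual.coAcyclic {d n : ℕ} (hd : ringKrullDim R = (d : WithBot ℕ∞))
    (hC : Semidual R C) (hn : ∀ i, n ≤ i → ∀ (N : Type u) [AddCommGroup N] [Module R N],
      ExtVanish R (i + 1) N C) :
    CoAcyclic R C d C ∧ ∀ j < d, Subsingleton (LC (maximalIdeal R) j C) := by
  obtain ⟨s, A, B, πA, πB, h, hsd, hB⟩ := RegChain.exists_maximal hd hC
  -- a socle element of `A`
  obtain ⟨a, ha0, ham⟩ : ∃ a : A, a ≠ 0 ∧ ∀ x ∈ maximalIdeal R, x • a = 0 := by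
    obtain ⟨b', hb', hb0'⟩ := (Submodule.ne_bot_iff _).1 hB
    obtain ⟨r', hb0, hmb⟩ := exists_socle _ hb' hb0'
    obtain ⟨f, hf⟩ := hC.exists_surjective_residue
    have hle : maximalIdeal R ≤ LinearMap.ker (LinearMap.toSpanSingleton R B (r' • b')) :=
      fun x hx => hmb x hx
    obtain ⟨r, hr⟩ := h.hom_eq (Submodule.liftQ (maximalIdeal R) _ hle ∘ₗ f)
    refine ⟨πA r, fun h0 => hb0 ?_, fun x hx => ?_⟩
    · obtain ⟨c, hc⟩ := hf (Submodule.Quotient.mk 1)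
      have := LinearMap.congr_fun hr c
      rw [LinearMap.comp_apply, hc, Submodule.liftQ_apply, LinearMap.toSpanSingleton_apply,
        one_smul, LinearMap.smul_apply, h.smul_B h0] at this
      exact this
    · rw [← map_smul, smul_eq_mul]
      refine h.hom_zero _ ?_
      rw [mul_smul, ← hr]
      ext c
      obtain ⟨t, ht⟩ := Submodule.Quotient.mk_surjective _ (f c)
      rw [LinearMap.smul_apply, LinearMap.comp_apply, ← ht, Submodule.liftQ_apply,
        LinearMap.toSpanSingleton_apply, smul_comm, hmb x hx, smul_zero, LinearMap.zero_apply]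
  have hstep : ∀ m : ℕ, (∀ i, s + m ≤ i → ∀ (N : Type u) [AddCommGroup N] [Module R N]
      [Module.Finite R N], ExtVanish R (i + 1) N C) →
      ∀ i, s ≤ i → ∀ (N : Type u) [AddCommGroup N] [Module R N]
      [Module.Finite R N], ExtVanish R (i + 1) N C := by
    intro m
    induction m with
    | zero => exact id
    | succ m ih =>
      refine fun hm => ih fun i hi N _ _ _ => .of_residueField (n := s + m) (fun j hj => ?_) N hi
      rcases hj.lt_or_eq with hj | rfl
      · exact hm j (by omega) _
      have hfA := h.finite_A
      have hle : maximalIdeal R ≤ LinearMap.ker (LinearMap.toSpanSingleton R A a) :=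
        fun r hr => ham r hr
      let f : (R ⧸ maximalIdeal R) →ₗ[R] A := Submodule.liftQ _ _ hle
      have hf : Function.Injective f := by
        rw [← LinearMap.ker_eq_bot, Submodule.ker_liftQ_eq_bot]
        intro r hr
        by_contra hu
        rw [mem_maximalIdeal, mem_nonunits_iff, not_not] at hu
        exact ha0 (hu.smul_eq_zero.1 hr)
      exact .contra_left (IsSES.of_injective f hf) (h.pd _ (by omega) _) (hm _ (by omega) _)
  have hs : CoAcyclic R C s C :=
    ⟨fun i hi N _ _ => .of_finite fun A _ _ _ =>
      hstep n (fun i hi N _ _ _ => hn i (by omega) N) i hi A, hC.ext⟩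
  have hds : d ≤ s := by
    by_contra hlt
    have h1 := LC.nontrivial_top (M := R) (d := d)
      (by rw [Module.supportDim_self_eq_ringKrullDim, hd])
    have h2 := hs.subsingleton_LC (maximalIdeal R) (i := d) (by omega)
    have h3 := (LC.sub_congr (maximalIdeal R) (i := d) (LinearEquiv.ofBijective _ hC.bij)).2 h2
    exact not_subsingleton _ h3
  obtain rfl : s = d := le_antisymm hsd hds
  exact ⟨hs, fun j hj => h.depth 0 (fun j hj => absurd hj (by omega)) j (by omega)⟩

end

section
open TensorProduct

variable {R : Type u} [CommRing R]

section
variable {A B D I : Type u} [AddCommGroup A] [Module R A] [AddCommGroup B] [Module R B]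
  [AddCommGroup D] [Module R D] [AddCommGroup I] [Module R I]

/-- `Hom(-, I)` is exact for `I` injective. -/
lemma IsSES.lcomp {f : A →ₗ[R] B} {g : B →ₗ[R] D} (h : IsSES f g) (hI : Module.Injective R I) :
    IsSES (LinearMap.lcomp R I g) (LinearMap.lcomp R I f) where
  inj φ ψ hab := by
    ext d
    obtain ⟨b, rfl⟩ := h.surj d
    exact LinearMap.congr_fun hab b
  exact φ := by
    constructor
    · intro hφ
      have hle : LinearMap.ker g ≤ LinearMap.ker φ := by
        intro b hb
        obtain ⟨a, rfl⟩ := (h.exact b).1 hb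
        exact LinearMap.congr_fun hφ a
      refine ⟨(LinearMap.ker g).liftQ φ hle ∘ₗ (g.quotKerEquivOfSurjective h.surj).symm, ?_⟩
      ext b
      rw [LinearMap.lcomp_apply, LinearMap.comp_apply, LinearEquiv.coe_coe,
        show (g.quotKerEquivOfSurjective h.surj).symm (g b) = Submodule.Quotient.mk b from
          (g.quotKerEquivOfSurjective h.surj).symm_apply_eq.2 rfl, Submodule.liftQ_apply]
    · rintro ⟨ψ, rfl⟩
      ext a
      simp only [LinearMap.lcomp_apply, LinearMap.zero_apply]
      rw [(h.exact (f a)).2 ⟨a, rfl⟩, map_zero]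
  surj φ := by
    obtain ⟨ψ, hψ⟩ := hI.exists_comp_eq f h.inj φ
    exact ⟨ψ, hψ⟩

lemma linearCombination_id_surjective :
    Function.Surjective (Finsupp.linearCombination R (id : A → A)) :=
  Finsupp.linearCombination_surjective _ Function.surjective_id

lemma injective_finsupp_hom (hI : Module.Injective R I) :
    Module.Injective R ((A →₀ R) →ₗ[R] I) :=
  .congr (Module.Injective.pi R fun _ : A => I) (Finsupp.llift I R R A)

/-- The symmetry `Ext(X, Hom(Y, I)) ≅ Ext(Y, Hom(X, I))`, for vanishing. -/
lemma ExtVanish.symm_hom (hI : Module.Injective R I) {i : ℕ}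
    (h : ExtVanish R (i + 1) A (B →ₗ[R] I)) : ExtVanish R (i + 1) B (A →ₗ[R] I) := by
  induction i generalizing B with
  | zero =>
    have hs := IsSES.of_surjective _ (linearCombination_id_surjective (R := R) (A := B))
    refine one_of_extend hs (.of_projective 0) fun φ => ?_
    obtain ⟨ψ, hψ⟩ := exists_lift (hs.lcomp hI) h φ.flip
    exact ⟨ψ.flip, by ext k a; exact LinearMap.congr_fun (LinearMap.congr_fun hψ a) k⟩
  | succ i ih =>
    have hs := IsSES.of_surjective _ (linearCombination_id_surjective (R := R) (A := B))
    exact .contra_right hs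
      (ih (.co_right (hs.lcomp hI) (.of_injective i (injective_finsupp_hom hI)) h))
      (.of_projective (i + 1))

end

section
variable {A D I J : Type u} [AddCommGroup A] [Module R A]
  [AddCommGroup D] [Module R D] [AddCommGroup I] [Module R I] [AddCommGroup J] [Module R J]

lemma ExtVanish.double_dual [IsNoetherianRing R] [Module.Finite R A] (hJ : Module.Injective R J)
    (hI : Module.Injective R I) {i : ℕ} (h : ExtVanish R (i + 1) A D) :
    ExtVanish R (i + 1) A ((D →ₗ[R] J) →ₗ[R] I) := by
  induction i generalizing A with
  | zero =>
    obtain ⟨n, p, hp⟩ := Module.Finite.exists_fin' R A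
    have hs := IsSES.of_surjective p hp
    set K := LinearMap.ker p
    refine one_of_extend hs (.of_projective 0) fun φ => ?_
    let e := LinearEquiv.ofBijective (homEval R K D J) (homEval_bijective hJ)
    let χ : ((K →ₗ[R] D) →ₗ[R] J) →ₗ[R] I := TensorProduct.lift φ ∘ₗ e.symm
    obtain ⟨χ', hχ'⟩ := hI.exists_comp_eq
      (LinearMap.lcomp R J (LinearMap.lcomp R D K.subtype)) (fun φ ψ hab => by
        ext k
        obtain ⟨k', rfl⟩ := exists_extend hs h k
        exact LinearMap.congr_fun hab k') χ
    refine ⟨TensorProduct.curry (χ' ∘ₗ homEval R (Fin n → R) D J), ?_⟩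
    ext k t
    have h1 : homEval R (Fin n → R) D J (K.subtype k ⊗ₜ t) =
        LinearMap.lcomp R J (LinearMap.lcomp R D K.subtype) (e (k ⊗ₜ t)) := by
      ext ψ; rfl
    have h2 := LinearMap.congr_fun hχ' (e (k ⊗ₜ t))
    simp only [LinearMap.comp_apply, TensorProduct.curry_apply] at h2 ⊢
    rw [h1, h2]
    simp [χ]
  | succ i ih =>
    obtain ⟨n, p, hp⟩ := Module.Finite.exists_fin' R A
    have hs := IsSES.of_surjective p hp
    exact .contra_right hs (ih (.contra_left hs (.of_projective i) h)) (.of_projective (i + 1))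

lemma injective_double_dual [IsNoetherianRing R] {E : Type u} [AddCommGroup E] [Module R E]
    (hE : Module.Injective R E) (hI : Module.Injective R I) :
    Module.Injective R ((I →ₗ[R] E) →ₗ[R] E) :=
  injective_of_extVanish fun _ => .double_dual hE hE (.of_injective 0 hI)

end

section
variable {C I J E : Type u} [AddCommGroup C] [Module R C] [AddCommGroup I] [Module R I]
  [AddCommGroup J] [Module R J] [AddCommGroup E] [Module R E] [IsNoetherianRing R]

/-- Vanishing of `Ext` between `C`-injective modules. -/
lemma Semidual.extVanish_hom (hC : Semidual R C) (hJ : Module.Injective R J)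
    (hI : Module.Injective R I) (i : ℕ) :
    ExtVanish R (i + 1) (C →ₗ[R] J) (C →ₗ[R] I) :=
  have := hC.finite
  (ExtVanish.double_dual hJ hI (hC.ext i)).symm_hom hI

lemma CoAcyclic.extVanish_hom {n i : ℕ} (hC : CoAcyclic R C n C) (hJ : Module.Injective R J)
    (hI : Module.Injective R I) (hi : n ≤ i) (X : Type u) [AddCommGroup X] [Module R X] :
    ExtVanish R (i + 1) (C →ₗ[R] J) (X →ₗ[R] I) :=
  (ExtVanish.of_finite fun _ _ _ _ => .double_dual hJ hI (hC.inj i hi _)).symm_hom hI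

lemma nonempty_double_dual_hom_equiv [Module.Finite R C] (hE : Module.Injective R E) :
    Nonempty ((((C →ₗ[R] I) →ₗ[R] E) →ₗ[R] E) ≃ₗ[R] (C →ₗ[R] ((I →ₗ[R] E) →ₗ[R] E))) := by
  let e : C ⊗[R] (I →ₗ[R] E) ≃ₗ[R] ((C →ₗ[R] I) →ₗ[R] E) :=
    LinearEquiv.ofBijective (homEval R C I E) (homEval_bijective hE)
  let e1 : (((C →ₗ[R] I) →ₗ[R] E) →ₗ[R] E) ≃ₗ[R] (C ⊗[R] (I →ₗ[R] E) →ₗ[R] E) :=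
    LinearEquiv.congrLeft E R e.symm
  let e2 : (C →ₗ[R] ((I →ₗ[R] E) →ₗ[R] E)) ≃ₗ[R] (C ⊗[R] (I →ₗ[R] E) →ₗ[R] E) :=
    TensorProduct.lift.equiv (RingHom.id R) C (I →ₗ[R] E) E
  exact ⟨e1.trans e2.symm⟩

variable {T₁ T₀ N J₁ J₀ : Type u} [AddCommGroup T₁] [Module R T₁] [AddCommGroup T₀] [Module R T₀]
  [AddCommGroup N] [Module R N] [AddCommGroup J₁] [Module R J₁] [AddCommGroup J₀] [Module R J₀]

/-- If `C` has injective dimension at most two and `N` has a presentation by `C`-injective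
modules, then the double dual of `N` is right orthogonal to the `C`-injective modules. -/
lemma Semidual.extVanish_double_dual (hC : Semidual R C) {d : ℕ} (hd : d ≤ 2)
    (hCd : CoAcyclic R C d C) (hE : Module.Injective R E)
    (h₁ : Module.Injective R J₁) (h₀ : Module.Injective R J₀)
    (e₁ : T₁ ≃ₗ[R] (C →ₗ[R] J₁)) (e₀ : T₀ ≃ₗ[R] (C →ₗ[R] J₀))
    {φ : T₁ →ₗ[R] T₀} {ψ : T₀ →ₗ[R] N} (hφψ : Function.Exact φ ψ) (hψ : Function.Surjective ψ)
    (hJ : Module.Injective R J) (i : ℕ) :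
    ExtVanish R (i + 1) (C →ₗ[R] J) ((N →ₗ[R] E) →ₗ[R] E) := by
  have := hC.finite
  have key : ∀ {T J' : Type u} [AddCommGroup T] [Module R T] [AddCommGroup J'] [Module R J'],
      Module.Injective R J' → (T ≃ₗ[R] (C →ₗ[R] J')) → ∀ i,
      ExtVanish R (i + 1) (C →ₗ[R] J) ((T →ₗ[R] E) →ₗ[R] E) := by
    intro T J' _ _ _ _ hJ' e i
    obtain ⟨e'⟩ := nonempty_double_dual_hom_equiv (C := C) (I := J') hE
    let e'' : ((T →ₗ[R] E) →ₗ[R] E) ≃ₗ[R] (((C →ₗ[R] J') →ₗ[R] E) →ₗ[R] E) :=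
      LinearEquiv.congrLeft E R (LinearEquiv.congrLeft E R e)
    exact (ExtVanish.congr_right (e''.trans e')).2
      (hC.extVanish_hom hJ (injective_double_dual hE hJ') i)
  have hs0 := ((IsSES.of_surjective ψ hψ).lcomp hE).lcomp hE
  have hmem : ∀ x, φ x ∈ LinearMap.ker ψ := fun x => (hφψ _).2 ⟨x, rfl⟩
  have hs1 := ((IsSES.of_surjective (φ.codRestrict _ hmem) fun ⟨y, hy⟩ => by
    obtain ⟨x, rfl⟩ := (hφψ y).1 hy
    exact ⟨x, rfl⟩).lcomp hE).lcomp hE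
  refine .co_right hs0 (key h₀ e₀ i) (.co_right hs1 (key h₁ e₁ (i + 1)) ?_)
  exact hCd.extVanish_hom hJ hE (by omega) _

end
end

section
open TensorProduct IsLocalRing

variable {R : Type u} [CommRing R]

variable (R) in
/-- An injective cogenerator over a local ring. -/
lemma exists_injective_cogenerator [IsLocalRing R] :
    ∃ E : ModuleCat.{u} R, Module.Injective R E ∧ ∀ (X : Type u) [AddCommGroup X] [Module R X]
      (x : X), x ≠ 0 → ∃ f : X →ₗ[R] E, f x ≠ 0 := by
  obtain ⟨E, j, hE, hj⟩ := exists_injective_embedding (R := R) (R ⧸ maximalIdeal R)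
  refine ⟨E, hE, fun X _ _ x hx => ?_⟩
  let s := LinearMap.toSpanSingleton R X x
  have hle : LinearMap.ker s ≤ maximalIdeal R := le_maximalIdeal fun h => hx <| by
    have : (1 : R) ∈ LinearMap.ker s := h ▸ trivial
    simpa [s] using this
  have hinj : Function.Injective ((LinearMap.ker s).liftQ s le_rfl) := by
    rw [← LinearMap.ker_eq_bot, Submodule.ker_liftQ_eq_bot]
    exact le_rfl
  obtain ⟨f, hf⟩ := hE.exists_comp_eq _ hinj (j ∘ₗ Submodule.factor hle)
  refine ⟨f, fun h0 => ?_⟩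
  have h1 := LinearMap.congr_fun hf (Submodule.Quotient.mk 1)
  have h2 : (LinearMap.ker s).liftQ s le_rfl (Submodule.Quotient.mk 1) = x := by
    rw [Submodule.liftQ_apply]; simp [s]
  rw [LinearMap.comp_apply, h2, h0, LinearMap.comp_apply, eq_comm,
    map_eq_zero_iff _ hj] at h1
  have h3 : (Submodule.Quotient.mk (1 : R) : R ⧸ maximalIdeal R) = 0 := h1
  rw [Submodule.Quotient.mk_eq_zero] at h3
  exact (Ideal.ne_top_iff_one _).1 (maximalIdeal.isMaximal R).ne_top h3

variable {N B : Type u} [AddCommGroup N] [Module R N] [AddCommGroup B] [Module R B]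

/-- The map `N → B ⧸ V` induced by `ι` is a pure monomorphism (over a Noetherian ring). -/
def IsPureMod (ι : N →ₗ[R] B) (V : Submodule R B) : Prop :=
  ∀ F : Submodule R B, F.FG → ∃ ρ : F →ₗ[R] N, ∀ (f : F) (n : N), (f : B) - ι n ∈ V → ρ f = n

namespace IsPureMod
variable {ι : N →ₗ[R] B} {V : Submodule R B}

lemma eq_zero (h : IsPureMod ι V) {n : N} (hn : ι n ∈ V) : n = 0 := by
  obtain ⟨ρ, hρ⟩ := h (R ∙ ι n) ⟨{ι n}, by simp⟩
  rw [← hρ ⟨ι n, Submodule.mem_span_singleton_self _⟩ n (by simp),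
    hρ ⟨ι n, Submodule.mem_span_singleton_self _⟩ 0 (by simpa using hn)]

lemma sSup [IsNoetherianRing R] {c : Set (Submodule R B)} (hc : IsChain (· ≤ ·) c)
    (hne : c.Nonempty) (h : ∀ V ∈ c, IsPureMod ι V) : IsPureMod ι (sSup c) := by
  intro F hF
  have : Module.Finite R F := Module.Finite.iff_fg.2 hF
  obtain ⟨W, ⟨V₀, hV₀, rfl⟩, hmax⟩ := set_has_maximal_iff_noetherian.2
    (inferInstance : IsNoetherian R F)
    ((fun V => (LinearMap.range ι ⊔ V).comap F.subtype) '' c) (hne.image _)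
  have hle : ∀ V ∈ c, (LinearMap.range ι ⊔ V).comap F.subtype ≤
      (LinearMap.range ι ⊔ V₀).comap F.subtype := by
    intro V hV
    rcases hc.total hV hV₀ with hle | hle
    · exact Submodule.comap_mono (sup_le_sup_left hle _)
    · have h1 : (LinearMap.range ι ⊔ V₀).comap F.subtype ≤
        (LinearMap.range ι ⊔ V).comap F.subtype := Submodule.comap_mono (sup_le_sup_left hle _)
      exact (h1.eq_of_not_lt (hmax _ ⟨V, hV, rfl⟩)).ge
  obtain ⟨ρ, hρ⟩ := h V₀ hV₀ F hF
  refine ⟨ρ, fun f n hfn => ?_⟩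
  obtain ⟨V, hV, hfV⟩ := (Submodule.mem_sSup_of_directed hne hc.directedOn).1 hfn
  have hf : f ∈ (LinearMap.range ι ⊔ V₀).comap F.subtype := by
    refine hle V hV (Submodule.mem_comap.2 (Submodule.mem_sup.2 ⟨ι n, ⟨n, rfl⟩, _, hfV, ?_⟩))
    simp
  obtain ⟨_, ⟨n', rfl⟩, v, hv, hnv⟩ := Submodule.mem_sup.1 (Submodule.mem_comap.1 hf)
  have h1 : (f : B) - ι n' ∈ V₀ := by
    rw [Submodule.subtype_apply] at hnv
    rw [← hnv, add_sub_cancel_left]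
    exact hv
  rw [hρ f n' h1]
  have h2 : ∃ V' ∈ c, V ≤ V' ∧ V₀ ≤ V' := by
    rcases hc.total hV hV₀ with hle | hle
    · exact ⟨V₀, hV₀, hle, le_rfl⟩
    · exact ⟨V, hV, le_rfl, hle⟩
  obtain ⟨V', hV', hVV', hV₀V'⟩ := h2
  have h3 : ι (n' - n) ∈ V' := by
    have := V'.sub_mem (hVV' hfV) (hV₀V' h1)
    rw [map_sub]
    convert this using 1
    abel
  exact sub_eq_zero.1 ((h V' hV').eq_zero h3)

/-- The submodule of values at `b` of maps which vanish on `N + V`. -/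
def values (ι : N →ₗ[R] B) (V : Submodule R B) (b : B) (F : Submodule R B) (hb : b ∈ F) :
    Submodule R N where
  carrier := {z | ∃ ρ : F →ₗ[R] N, (∀ (f : F) (n : N), (f : B) - ι n ∈ V → ρ f = 0) ∧
    ρ ⟨b, hb⟩ = z}
  add_mem' := by
    rintro _ _ ⟨ρ, hρ, rfl⟩ ⟨σ, hσ, rfl⟩
    exact ⟨ρ + σ, fun f n h => by rw [LinearMap.add_apply, hρ f n h, hσ f n h, add_zero], rfl⟩
  zero_mem' := ⟨0, fun _ _ _ => rfl, rfl⟩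
  smul_mem' := by
    rintro r _ ⟨ρ, hρ, rfl⟩
    exact ⟨r • ρ, fun f n h => by rw [LinearMap.smul_apply, hρ f n h, smul_zero], rfl⟩

lemma values_anti {b : B} {F F' : Submodule R B} (hF : F ≤ F') (hb : b ∈ F) :
    values ι V b F' (hF hb) ≤ values ι V b F hb := by
  rintro _ ⟨ρ, hρ, rfl⟩
  exact ⟨ρ ∘ₗ Submodule.inclusion hF, fun f n h => hρ (Submodule.inclusion hF f) n h, rfl⟩

/-- A pure extension of an artinian module can be enlarged to one hitting a given element. -/
lemma exists_value [IsArtinian R N] (h : IsPureMod ι V) (b : B) :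
    ∃ n : N, IsPureMod ι (V ⊔ R ∙ (b - ι n)) := by
  let S : Set (Submodule R N) := {D | ∃ (F : Submodule R B) (hb : b ∈ F), F.FG ∧
    D = values ι V b F hb}
  obtain ⟨_, ⟨F₀, hb₀, hF₀, rfl⟩, hmin⟩ := set_has_minimal_iff_artinian.2
    (inferInstance : IsArtinian R N) S
    ⟨_, R ∙ b, Submodule.mem_span_singleton_self b, ⟨{b}, by simp⟩, rfl⟩
  obtain ⟨ρ₀, hρ₀⟩ := h F₀ hF₀
  set n := ρ₀ ⟨b, hb₀⟩
  have key : ∀ F : Submodule R B, F.FG → ∀ hb : F₀ ≤ F, ∃ ρ : F →ₗ[R] N,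
      (∀ (f : F) (n : N), (f : B) - ι n ∈ V → ρ f = n) ∧ ρ ⟨b, hb hb₀⟩ = n := by
    intro F hF hle
    obtain ⟨ρ, hρ⟩ := h F hF
    have h1 : values ι V b F (hle hb₀) = values ι V b F₀ hb₀ :=
      (values_anti hle hb₀).eq_of_not_lt (hmin _ ⟨F, hle hb₀, hF, rfl⟩)
    have h2 : n - ρ ⟨b, hle hb₀⟩ ∈ values ι V b F₀ hb₀ :=
      ⟨ρ₀ - ρ ∘ₗ Submodule.inclusion hle, fun f m hf => by
        rw [LinearMap.sub_apply, hρ₀ f m hf, LinearMap.comp_apply,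
          hρ (Submodule.inclusion hle f) m hf, sub_self], rfl⟩
    rw [← h1] at h2
    obtain ⟨σ, hσ, hσb⟩ := h2
    refine ⟨ρ + σ, fun f m hf => by rw [LinearMap.add_apply, hρ f m hf, hσ f m hf, add_zero], ?_⟩
    rw [LinearMap.add_apply, hσb, add_sub_cancel]
  refine ⟨n, fun F hF => ?_⟩
  have hfg : (R ∙ ι n).FG := ⟨{ι n}, by simp⟩
  obtain ⟨ρ, hρ, hρb⟩ := key (F₀ ⊔ F ⊔ R ∙ ι n) ((hF₀.sup hF).sup hfg)
    (le_sup_left.trans le_sup_left)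
  have hle : F ≤ F₀ ⊔ F ⊔ R ∙ ι n := le_sup_right.trans le_sup_left
  refine ⟨ρ ∘ₗ Submodule.inclusion hle, fun f m hf => ?_⟩
  obtain ⟨v, hv, w, hw, hvw⟩ := Submodule.mem_sup.1 hf
  obtain ⟨r, rfl⟩ := Submodule.mem_span_singleton.1 hw
  let b' : ↥(F₀ ⊔ F ⊔ R ∙ ι n) := ⟨b, (le_sup_left.trans le_sup_left : F₀ ≤ _) hb₀⟩
  let n' : ↥(F₀ ⊔ F ⊔ R ∙ ι n) := ⟨ι n, (le_sup_right : R ∙ ι n ≤ _)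
    (Submodule.mem_span_singleton_self _)⟩
  have h1 : ρ n' = n := hρ n' n (by simp [n'])
  have h2 := hρ (Submodule.inclusion hle f - r • (b' - n')) m (by
    convert hv using 1
    simp only [Submodule.coe_sub, Submodule.coe_smul, Submodule.coe_inclusion, b', n']
    rw [sub_right_comm, ← hvw, add_sub_cancel_right])
  rw [map_sub, map_smul, map_sub, h1, show ρ b' = n from hρb, sub_self, smul_zero, sub_zero] at h2
  exact h2

/-- An artinian module is a direct summand of any pure extension. -/
lemma exists_retraction [IsNoetherianRing R] [IsArtinian R N] (h : IsPureMod ι ⊥) :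
    ∃ ρ : B →ₗ[R] N, ρ ∘ₗ ι = LinearMap.id := by
  obtain ⟨V, -, hV⟩ := zorn_le_nonempty₀ {V | IsPureMod ι V}
    (fun c hc hch V hV => ⟨_, IsPureMod.sSup hch ⟨V, hV⟩ (fun W hW => hc hW),
      fun W hW => le_sSup hW⟩) ⊥ h
  have htop : ∀ b, ∃ n, b - ι n ∈ V := by
    intro b
    obtain ⟨n, hn⟩ := hV.1.exists_value b
    exact ⟨n, hV.2 hn le_sup_left (le_sup_right (a := V)
      (Submodule.mem_span_singleton_self (R := R) (b - ι n)))⟩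
  have huniq : ∀ b n n', b - ι n ∈ V → b - ι n' ∈ V → n = n' := by
    intro b n n' hn hn'
    have := V.sub_mem hn' hn
    rw [sub_sub_sub_cancel_left, ← map_sub] at this
    exact sub_eq_zero.1 (hV.1.eq_zero this)
  choose ρ hρ using htop
  refine ⟨{ toFun := ρ, map_add' := fun x y => ?_, map_smul' := fun r x => ?_ }, ?_⟩
  · refine huniq (x + y) _ _ (hρ _) ?_
    rw [map_add, add_sub_add_comm]
    exact V.add_mem (hρ x) (hρ y)
  · refine huniq (r • x) _ _ (hρ _) ?_
    rw [RingHom.id_apply, map_smul, ← smul_sub]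
    exact V.smul_mem r (hρ x)
  · ext n
    exact huniq (ι n) _ _ (hρ _) (by simp)

end IsPureMod

variable {E : Type u} [AddCommGroup E] [Module R E]

lemma isPureMod_double_dual [IsNoetherianRing R] (hE : Module.Injective R E)
    (hcog : ∀ (X : Type u) [AddCommGroup X] [Module R X] (x : X), x ≠ 0 →
      ∃ f : X →ₗ[R] E, f x ≠ 0) :
    IsPureMod (LinearMap.applyₗ : N →ₗ[R] ((N →ₗ[R] E) →ₗ[R] E)) ⊥ := by
  intro F hF
  have hFf : Module.Finite R F := Module.Finite.iff_fg.2 hF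
  set ι : N →ₗ[R] ((N →ₗ[R] E) →ₗ[R] E) := LinearMap.applyₗ with hι
  have hinj : Function.Injective ι := by
    rw [injective_iff_map_eq_zero]
    intro n hn
    by_contra h0
    obtain ⟨f, hf⟩ := hcog N n h0
    exact hf (LinearMap.congr_fun hn f)
  let G : Submodule R N := F.comap ι
  let j : G →ₗ[R] F := ι.restrict fun _ h => h
  have hj : Function.Injective j := fun x y hxy =>
    Subtype.ext (hinj (congrArg Subtype.val hxy))
  have hGf : Module.Finite R G := Module.Finite.of_injective j hj
  obtain ⟨ρ, hρ⟩ : G.subtype ∈ LinearMap.range (LinearMap.lcomp R N j) := by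
    by_contra hcon
    obtain ⟨χ', hχ'⟩ := hcog (_ ⧸ LinearMap.range (LinearMap.lcomp R N j))
      (Submodule.Quotient.mk G.subtype) (by rwa [Ne, Submodule.Quotient.mk_eq_zero])
    obtain ⟨t, ht⟩ := (homEval_bijective (A := G) (D := N) hE).2
      (χ' ∘ₗ (LinearMap.range (LinearMap.lcomp R N j)).mkQ)
    have h1 : j.rTensor _ t = 0 := by
      apply (homEval_bijective (A := F) (D := N) hE).1
      rw [map_zero]
      ext φ
      rw [homEval_naturality, ht, LinearMap.comp_apply, Submodule.mkQ_apply,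
        (Submodule.Quotient.mk_eq_zero _).2 (show φ ∘ₗ j ∈ LinearMap.range (LinearMap.lcomp R N j) from
          ⟨φ, rfl⟩), map_zero, LinearMap.zero_apply]
    have h2 : TensorProduct.lift F.subtype ∘ₗ j.rTensor (N →ₗ[R] E) =
        (LinearMap.applyₗ G.subtype : ((G →ₗ[R] N) →ₗ[R] E) →ₗ[R] E) ∘ₗ homEval R G N E := by
      ext g ξ
      simp [j, hι]
    have h3 := LinearMap.congr_fun h2 t
    rw [LinearMap.comp_apply, h1, map_zero, LinearMap.comp_apply, ht] at h3
    exact hχ' h3.symm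
  refine ⟨ρ, fun f n hfn => ?_⟩
  have hf : (f : (N →ₗ[R] E) →ₗ[R] E) = ι n := sub_eq_zero.1 ((Submodule.mem_bot R).1 hfn)
  have hn : n ∈ G := by
    change ι n ∈ F
    rw [← hf]
    exact f.2
  have : f = j ⟨n, hn⟩ := Subtype.ext hf
  rw [this]
  exact LinearMap.congr_fun hρ ⟨n, hn⟩

/-- An artinian module is a direct summand of its double dual. -/
lemma exists_retraction_double_dual [IsNoetherianRing R] [IsArtinian R N]
    (hE : Module.Injective R E)
    (hcog : ∀ (X : Type u) [AddCommGroup X] [Module R X] (x : X), x ≠ 0 →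
      ∃ f : X →ₗ[R] E, f x ≠ 0) :
    ∃ (ι : N →ₗ[R] ((N →ₗ[R] E) →ₗ[R] E)) (ρ : ((N →ₗ[R] E) →ₗ[R] E) →ₗ[R] N),
      ρ ∘ₗ ι = LinearMap.id :=
  ⟨_, (isPureMod_double_dual hE hcog).exists_retraction⟩

end

section

variable {R : Type u} [CommRing R]

section
variable {C E : Type u} [AddCommGroup C] [Module R C] [AddCommGroup E] [Module R E] {S : Type u}

variable (R S C E) in
/-- The comparison from a direct sum of `Hom`s to `Hom` into a direct sum. -/
def finsuppHom : (S →₀ (C →ₗ[R] E)) →ₗ[R] (C →ₗ[R] (S →₀ E)) :=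
  Finsupp.lsum R fun s => LinearMap.compRight R (Finsupp.lsingle s)

lemma finsuppHom_single (s : S) (f : C →ₗ[R] E) :
    finsuppHom R C E S (Finsupp.single s f) = Finsupp.lsingle s ∘ₗ f := by
  rw [finsuppHom, Finsupp.lsum_single]
  rfl

lemma finsuppHom_apply (t : S →₀ (C →ₗ[R] E)) (c : C) (s : S) :
    finsuppHom R C E S t c s = t s c := by
  classical
  induction t using Finsupp.induction_linear with
  | zero => simp
  | add f g hf hg => simp [hf, hg]
  | single s' f =>
    rw [finsuppHom_single, LinearMap.comp_apply, Finsupp.lsingle_apply, Finsupp.single_apply,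
      Finsupp.single_apply]
    split_ifs <;> rfl

lemma finsuppHom_bijective [Module.Finite R C] : Function.Bijective (finsuppHom R C E S) := by
  classical
  constructor
  · intro t t' h
    ext s c
    rw [← finsuppHom_apply, ← finsuppHom_apply, h]
  · intro g
    obtain ⟨W, hW⟩ := Module.Finite.fg_top (R := R) (M := C)
    let U : Finset S := W.biUnion fun c => (g c).support
    refine ⟨∑ s ∈ U, Finsupp.single s (Finsupp.lapply s ∘ₗ g), ?_⟩
    rw [map_sum]
    refine LinearMap.ext_on_range (v := ((↑) : W → C)) (by simpa using hW) fun ⟨c, hc⟩ => ?_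
    have hsub : (g c).support ⊆ U := fun s hs => Finset.mem_biUnion.2 ⟨c, hc, hs⟩
    rw [LinearMap.sum_apply]
    simp only [finsuppHom_single, LinearMap.comp_apply, Finsupp.lsingle_apply,
      Finsupp.lapply_apply]
    conv_rhs => rw [← Finsupp.sum_single (g c), Finsupp.sum_of_support_subset _ hsub _ (by simp)]

variable (S) in
/-- Direct sums of injective modules over a Noetherian ring are injective. -/
lemma injective_finsupp [IsNoetherianRing R] (hE : Module.Injective R E) :
    Module.Injective R (S →₀ E) := by
  apply Module.Baer.injective
  intro I g
  obtain ⟨t, rfl⟩ := (finsuppHom_bijective (C := I)).2 g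
  have hsurj : Function.Surjective
      (LinearMap.lcomp R E I.subtype : (R →ₗ[R] E) →ₗ[R] (I →ₗ[R] E)) := fun f =>
    hE.exists_comp_eq I.subtype I.injective_subtype f
  obtain ⟨t', rfl⟩ := Finsupp.mapRange_surjective (α := S) _ (map_zero _) hsurj t
  refine ⟨finsuppHom R R E S t', fun x hx => ?_⟩
  ext s
  rw [finsuppHom_apply, finsuppHom_apply]
  rfl

end

variable (R) in
lemma exists_injective_annihilators :
    ∃ E : ModuleCat.{u} R, Module.Injective R E ∧
      ∀ a : Ideal R, ∃ e : E, ∀ r : R, r • e = 0 ↔ r ∈ a := by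
  classical
  obtain ⟨E, j, hE, hj⟩ := exists_injective_embedding (R := R) (Π a : Ideal R, R ⧸ a)
  refine ⟨E, hE, fun a => ⟨j (LinearMap.single R (fun a : Ideal R => R ⧸ a) a 1), fun r => ?_⟩⟩
  rw [← map_smul, map_eq_zero_iff _ hj, ← map_smul,
    map_eq_zero_iff _ (Pi.single_injective (M := fun a : Ideal R => R ⧸ a) a),
    ← Ideal.Quotient.eq_zero_iff_mem]
  simp [Algebra.smul_def]

/-- Every injective module is a direct summand of a direct sum of copies of `E`. -/
lemma Module.Injective.exists_retract_finsupp [IsNoetherianRing R] {E J : Type u}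
    [AddCommGroup E] [Module R E]
    [AddCommGroup J] [Module R J] (hE : Module.Injective R E)
    (ha : ∀ a : Ideal R, ∃ e : E, ∀ r : R, r • e = 0 ↔ r ∈ a) (hJ : Module.Injective R J) :
    ∃ (s : J →ₗ[R] ((E →ₗ[R] J) →₀ E)) (r : ((E →ₗ[R] J) →₀ E) →ₗ[R] J),
      r ∘ₗ s = LinearMap.id := by
  let r : ((E →ₗ[R] J) →₀ E) →ₗ[R] J := Finsupp.lsum R fun f => f
  have hlift : ∀ j : J, ∃ x, r x = j ∧ ∀ t : R, t • j = 0 → t • x = 0 := by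
    intro j
    obtain ⟨e, he⟩ := ha (LinearMap.ker (LinearMap.toSpanSingleton R J j))
    have hker : LinearMap.ker (LinearMap.toSpanSingleton R E e) =
        LinearMap.ker (LinearMap.toSpanSingleton R J j) := by
      ext t; exact he t
    obtain ⟨f, hf⟩ := hJ.exists_comp_eq
      ((LinearMap.ker (LinearMap.toSpanSingleton R J j)).liftQ
        (LinearMap.toSpanSingleton R E e) hker.ge)
      (by rw [← LinearMap.ker_eq_bot, Submodule.ker_liftQ_eq_bot]; exact hker.le)
      ((LinearMap.ker (LinearMap.toSpanSingleton R J j)).liftQ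
        (LinearMap.toSpanSingleton R J j) le_rfl)
    have hfe := LinearMap.congr_fun hf (Submodule.Quotient.mk 1)
    rw [LinearMap.comp_apply, Submodule.liftQ_apply, Submodule.liftQ_apply,
      LinearMap.toSpanSingleton_apply, LinearMap.toSpanSingleton_apply, one_smul, one_smul] at hfe
    refine ⟨Finsupp.single f e, by simp [r, hfe], fun t ht => ?_⟩
    rw [Finsupp.smul_single, (he t).2 ht, Finsupp.single_zero]
  have hsurj : Function.Surjective r := fun j => (hlift j).imp fun _ h => h.1
  have hX : Module.Injective R ((E →ₗ[R] J) →₀ E) := injective_finsupp _ hE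
  have hK : Module.Injective R (LinearMap.ker r) := by
    apply Module.Baer.injective
    intro I g
    obtain ⟨h, hh⟩ := hX.exists_comp_eq I.subtype I.injective_subtype
      ((LinearMap.ker r).subtype ∘ₗ g)
    have hh' : ∀ x (hx : x ∈ I), x • h 1 = g ⟨x, hx⟩ := fun x hx => by
      have := LinearMap.congr_fun hh ⟨x, hx⟩
      rw [← map_smul, smul_eq_mul, mul_one]
      exact this
    obtain ⟨x, hx, hx'⟩ := hlift (r (h 1))
    refine ⟨LinearMap.toSpanSingleton R _ ⟨h 1 - x, by
      rw [LinearMap.mem_ker, map_sub, hx, sub_self]⟩, fun t ht => Subtype.ext ?_⟩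
    have h1 : t • x = 0 := hx' t <| by
      rw [← map_smul, hh' t ht]
      exact (g ⟨t, ht⟩).2
    change t • (h 1 - x) = _
    rw [smul_sub, h1, sub_zero, hh' t ht]
  obtain ⟨s, hs⟩ := ExtVanish.exists_lift (IsSES.of_surjective r hsurj) (M := J)
    (.of_injective 0 hK) LinearMap.id
  exact ⟨s, r, hs⟩

variable {C : Type u} [AddCommGroup C] [Module R C]

/-- The modules right orthogonal to all `C`-injective modules. -/
def RightOrth (R : Type u) [CommRing R] (C : Type u) [AddCommGroup C] [Module R C]
    (N : Type u) [AddCommGroup N] [Module R N] : Prop :=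
  ∀ (J : Type u) [AddCommGroup J] [Module R J], Module.Injective R J →
    ∀ i, ExtVanish R (i + 1) (C →ₗ[R] J) N

/-- A precover by a `C`-injective module. -/
lemma exists_precover [IsNoetherianRing R] [Module.Finite R C]
    (N : Type u) [AddCommGroup N] [Module R N] :
    ∃ (I : ModuleCat.{u} R) (p : (C →ₗ[R] I) →ₗ[R] N), Module.Injective R I ∧
      ∀ (J : Type u) [AddCommGroup J] [Module R J], Module.Injective R J →
        ∀ φ : (C →ₗ[R] J) →ₗ[R] N, ∃ ψ : (C →ₗ[R] J) →ₗ[R] (C →ₗ[R] I), p ∘ₗ ψ = φ := by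
  obtain ⟨E, hE, ha⟩ := exists_injective_annihilators R
  let e := LinearEquiv.ofBijective (finsuppHom R C E ((C →ₗ[R] E) →ₗ[R] N)) finsuppHom_bijective
  let p : (C →ₗ[R] (((C →ₗ[R] E) →ₗ[R] N) →₀ E)) →ₗ[R] N :=
    (Finsupp.lsum R fun s : (C →ₗ[R] E) →ₗ[R] N => s) ∘ₗ e.symm
  have hp : ∀ s f, p (Finsupp.lsingle s ∘ₗ f) = s f := by
    intro s f
    rw [← finsuppHom_single]
    change Finsupp.lsum R _ (e.symm (e _)) = _
    rw [LinearEquiv.symm_apply_apply, Finsupp.lsum_single]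
  refine ⟨.of R (((C →ₗ[R] E) →ₗ[R] N) →₀ E), p, injective_finsupp _ hE, fun J _ _ hJ φ => ?_⟩
  obtain ⟨s, r, hrs⟩ := hE.exists_retract_finsupp ha hJ
  let a : (E →ₗ[R] J) → ((C →ₗ[R] E) →ₗ[R] N) := fun f => φ ∘ₗ LinearMap.compRight R r ∘ₗ
    LinearMap.compRight R (Finsupp.lsingle f)
  have key : p ∘ₗ LinearMap.compRight R (Finsupp.lmapDomain E R a) =
      φ ∘ₗ LinearMap.compRight R r := by
    have h1 : (p ∘ₗ LinearMap.compRight R (Finsupp.lmapDomain E R a)) ∘ₗ finsuppHom R C E _ =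
      (φ ∘ₗ LinearMap.compRight R r) ∘ₗ finsuppHom R C E _ := by
      refine Finsupp.lhom_ext fun f t => ?_
      have h2 : LinearMap.compRight R (Finsupp.lmapDomain E R a) (Finsupp.lsingle f ∘ₗ t) =
          Finsupp.lsingle (a f) ∘ₗ t := by
        ext c : 1
        exact Finsupp.mapDomain_single
      have h3 := finsuppHom_single f t
      exact (congrArg p ((congrArg _ h3).trans h2)).trans ((hp _ _).trans
        (congrArg (fun x => φ (LinearMap.compRight R r x)) h3.symm))
    ext t
    obtain ⟨t, rfl⟩ := finsuppHom_bijective.2 t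
    exact LinearMap.congr_fun h1 t
  refine ⟨LinearMap.compRight R (Finsupp.lmapDomain E R a) ∘ₗ LinearMap.compRight R s, ?_⟩
  ext t
  have h1 := LinearMap.congr_fun key (s ∘ₗ t)
  refine h1.trans ?_
  change φ (r ∘ₗ s ∘ₗ t) = _
  rw [← LinearMap.comp_assoc, hrs, LinearMap.id_comp]

lemma CoAcyclic.mono {n m : ℕ} (hnm : n ≤ m) {K : Type u} [AddCommGroup K] [Module R K]
    (h : CoAcyclic R C n K) : CoAcyclic R C m K :=
  ⟨fun i hi => h.inj i (hnm.trans hi), h.acyclic⟩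

namespace RightOrth
variable {N : Type u} [AddCommGroup N] [Module R N]

lemma extVanish_of_coAcyclic [IsNoetherianRing R] [Module.Finite R C] (hN : RightOrth R C N)
    {n : ℕ} {K : Type u} [AddCommGroup K] [Module R K]
    (hK : CoAcyclic R C n K) (i : ℕ) : ExtVanish R (i + 1) (C →ₗ[R] K) N := by
  induction n generalizing K i with
  | zero => exact hN K hK.injective i
  | succ n ih =>
    obtain ⟨I, f, hI, hf⟩ := exists_injective_embedding (R := R) K
    have hs := IsSES.of_injective f hf
    exact .contra_left (hs.hom_of_injective C (hK.acyclic 0)) (hN I hI i)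
      (ih (hK.right hs hI) (i + 1))

/-- A module right orthogonal to the `C`-injectives is the image of a `C`-injective, with kernel
of the same kind. -/
lemma exists_cover [IsNoetherianRing R] {d : ℕ} (hC : Semidual R C) (hCd : CoAcyclic R C d C)
    (hN : RightOrth R C N) :
    ∃ (I : ModuleCat.{u} R) (p : (C →ₗ[R] I) →ₗ[R] N), Module.Injective R I ∧
      Function.Surjective p ∧ RightOrth R C (LinearMap.ker p) := by
  have := hC.finite
  obtain ⟨I, p, hI, hp⟩ := exists_precover (R := R) (C := C) N
  have hsurj : Function.Surjective p := by
    intro z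
    obtain ⟨I₀, f, hI₀, hf⟩ := exists_injective_embedding (R := R) C
    have hs := IsSES.of_injective f hf
    have hQ := (hCd.mono d.le_succ).right hs hI₀
    let e := LinearEquiv.ofBijective _ hC.bij
    obtain ⟨ψ, hψ⟩ := ExtVanish.exists_extend (hs.hom_of_injective C (hCd.acyclic 0))
      (hN.extVanish_of_coAcyclic hQ 0) (LinearMap.toSpanSingleton R N z ∘ₗ e.symm)
    obtain ⟨χ, hχ⟩ := hp I₀ hI₀ ψ
    refine ⟨χ (LinearMap.compRight R f (e 1)), ?_⟩
    rw [← LinearMap.comp_apply p χ, hχ]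
    refine (LinearMap.congr_fun hψ (e 1)).trans ?_
    rw [LinearMap.comp_apply, LinearEquiv.coe_coe, LinearEquiv.symm_apply_apply,
      LinearMap.toSpanSingleton_apply, one_smul]
  refine ⟨I, p, hI, hsurj, fun J _ _ hJ i => ?_⟩
  have hs := IsSES.of_surjective p hsurj
  cases i with
  | zero => exact .one_of_lift hs (hC.extVanish_hom hJ hI 0) (hp J hJ)
  | succ i => exact .co_left hs (hN J hJ i) (hC.extVanish_hom hJ hI (i + 1))

/-- Cosyzygies of right orthogonal modules are right orthogonal. -/
lemma exists_embedding (hN : RightOrth R C N) :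
    ∃ (I : ModuleCat.{u} R) (f : N →ₗ[R] I), Module.Injective R I ∧
      Function.Injective f ∧ RightOrth R C (I ⧸ LinearMap.range f) := by
  obtain ⟨I, f, hI, hf⟩ := exists_injective_embedding (R := R) N
  exact ⟨I, f, hI, hf, fun J _ _ hJ i =>
    .co_right (IsSES.of_injective f hf) (.of_injective i hI) (hN J hJ (i + 1))⟩

lemma retract {N' : Type u} [AddCommGroup N'] [Module R N'] (hN : RightOrth R C N)
    (s : N' →ₗ[R] N) (r : N →ₗ[R] N') (h : r ∘ₗ s = LinearMap.id) : RightOrth R C N' :=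
  fun J _ _ hJ i => .retract_right s r h (hN J hJ i)

end RightOrth

end

section

variable {R : Type u} [CommRing R] {C : ModuleCat.{u} R}

/-- Splicing short exact sequences of right orthogonal modules. -/
lemma IsGCInjective.of_splice (Z Y : ℤ → ModuleCat.{u} R) (j : ∀ i, Z i →ₗ[R] Y i)
    (q : ∀ i, Y (i + 1) →ₗ[R] Z i) (hj : ∀ i, Function.Injective (j i))
    (hs : ∀ i, IsSES (j (i + 1)) (q i)) (hZ : ∀ i, RightOrth R C (Z i))
    (hpos : ∀ i : ℤ, 0 < i → IsCInjective R C (Y i))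
    (hneg : ∀ i : ℤ, i ≤ 0 → Module.Injective R (Y i)) : IsGCInjective R C (Z 0) := by
  refine ⟨⟨Y, fun i => j i ∘ₗ q i, fun i x => ?_, hpos, hneg, ?_⟩, ?_⟩
  · rw [LinearMap.comp_apply, map_eq_zero_iff _ (hj i), (hs i).exact]
    constructor
    · rintro ⟨z, rfl⟩
      obtain ⟨y, rfl⟩ := (hs (i + 1)).surj z
      exact ⟨y, rfl⟩
    · rintro ⟨y, rfl⟩
      exact ⟨_, rfl⟩
  · rintro T ⟨J, hJ, ⟨e⟩⟩ i f
    constructor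
    · intro hf
      have hmem : ∀ t, f t ∈ LinearMap.range (j (i + 1)) := fun t =>
        ((hs i).exact _).1 ((map_eq_zero_iff _ (hj i)).1 (LinearMap.congr_fun hf t))
      let f' : T →ₗ[R] Z (i + 1) := (LinearEquiv.ofInjective _ (hj (i + 1))).symm ∘ₗ
        f.codRestrict _ hmem
      have hf' : j (i + 1) ∘ₗ f' = f := by
        ext t
        exact congrArg Subtype.val ((LinearEquiv.ofInjective _ (hj (i + 1))).apply_symm_apply _)
      obtain ⟨g, hg⟩ := ExtVanish.exists_lift (hs (i + 1))
        ((ExtVanish.congr_left e).2 (hZ _ J hJ 0)) f'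
      exact ⟨g, by rw [← hf', ← hg]; rfl⟩
    · rintro ⟨g, rfl⟩
      ext t
      change j i (q i (j (i + 1) (q (i + 1) (g t)))) = 0
      rw [((hs i).exact _).2 ⟨_, rfl⟩, map_zero]
  · have h : LinearMap.range (j (-1 + 1)) = LinearMap.ker (j (-1) ∘ₗ q (-1)) := by
      ext x
      rw [LinearMap.mem_ker, LinearMap.comp_apply, map_eq_zero_iff _ (hj (-1)), (hs (-1)).exact]
      rfl
    exact ⟨(LinearEquiv.ofInjective (j (-1 + 1)) (hj _)).trans (LinearEquiv.ofEq _ _ h)⟩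

lemma RightOrth.isGCInjective [IsNoetherianRing R] {d : ℕ} (hC : Semidual R C)
    (hCd : CoAcyclic R C d C) {N : ModuleCat.{u} R} (hN : RightOrth R C N) :
    IsGCInjective R C N := by
  have hcov : ∀ N : {N : ModuleCat.{u} R // RightOrth R C N},
      ∃ (Z : {N : ModuleCat.{u} R // RightOrth R C N}) (I : ModuleCat.{u} R)
        (j : Z.1 →ₗ[R] (C →ₗ[R] I)) (p : (C →ₗ[R] I) →ₗ[R] N.1),
        Module.Injective R I ∧ IsSES j p := by
    rintro ⟨N, hN⟩
    obtain ⟨I, p, hI, hp, hK⟩ := hN.exists_cover hC hCd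
    exact ⟨⟨.of R (LinearMap.ker p), hK⟩, I, _, p, hI, .of_surjective p hp⟩
  have hemb : ∀ N : {N : ModuleCat.{u} R // RightOrth R C N},
      ∃ (Z : {N : ModuleCat.{u} R // RightOrth R C N}) (I : ModuleCat.{u} R)
        (j : N.1 →ₗ[R] I) (p : I →ₗ[R] Z.1), Module.Injective R I ∧ IsSES j p := by
    rintro ⟨N, hN⟩
    obtain ⟨I, f, hI, hf, hQ⟩ := hN.exists_embedding
    exact ⟨⟨.of R (I ⧸ LinearMap.range f), hQ⟩, I, f, _, hI, .of_injective f hf⟩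
  choose cZ cI cj cp hcI hc using hcov
  choose eZ eI ej eq heI he using hemb
  let P : ℕ → {N : ModuleCat.{u} R // RightOrth R C N} := fun n =>
    Nat.rec ⟨N, hN⟩ (fun _ x => cZ x) n
  let Q : ℕ → {N : ModuleCat.{u} R // RightOrth R C N} := fun n =>
    Nat.rec ⟨N, hN⟩ (fun _ x => eZ x) n
  let Z : ℤ → {N : ModuleCat.{u} R // RightOrth R C N} := fun i => match i with
    | .ofNat n => P n
    | .negSucc n => Q (n + 1)
  let Y : ℤ → ModuleCat.{u} R := fun i => match i with
    | .ofNat 0 => eI (Q 0)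
    | .ofNat (n + 1) => .of R (C →ₗ[R] cI (P n))
    | .negSucc n => eI (Q (n + 1))
  let j : ∀ i, (Z i).1 →ₗ[R] Y i := fun i => match i with
    | .ofNat 0 => ej (Q 0)
    | .ofNat (n + 1) => cj (P n)
    | .negSucc n => ej (Q (n + 1))
  let q : ∀ i, Y (i + 1) →ₗ[R] (Z i).1 := fun i => match i with
    | .ofNat n => cp (P n)
    | .negSucc 0 => eq (Q 0)
    | .negSucc (n + 1) => eq (Q (n + 1))
  refine IsGCInjective.of_splice (fun i => (Z i).1) Y j q (fun i => ?_) (fun i => ?_)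
    (fun i => (Z i).2) (fun i hi => ?_) (fun i hi => ?_)
  · match i with
    | .ofNat 0 => exact (he (Q 0)).inj
    | .ofNat (n + 1) => exact (hc (P n)).inj
    | .negSucc n => exact (he (Q (n + 1))).inj
  · match i with
    | .ofNat n => exact hc (P n)
    | .negSucc 0 => exact he (Q 0)
    | .negSucc (n + 1) => exact he (Q (n + 1))
  · match i with
    | .ofNat 0 => exact absurd hi (by simp)
    | .ofNat (n + 1) => exact ⟨cI (P n), hcI _, ⟨LinearEquiv.refl R _⟩⟩
    | .negSucc n => exact absurd hi (by simp)
  · match i with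
    | .ofNat 0 => exact heI (Q 0)
    | .ofNat (n + 1) => exact absurd hi (by simp)
    | .negSucc n => exact heI (Q (n + 1))

end

section
variable {R : Type u} [CommRing R] (a : Ideal R) (i : ℕ)

namespace LC

section
variable {n : ℕ}

/-- Local cohomology of a finite free module is determined by its coordinates. -/
def piEquiv (n : ℕ) : LC a i (Fin n → R) ≃ₗ[R] (Fin n → LC a i R) :=
  LinearEquiv.ofLinearMap (LinearMap.pi fun k => map a i (LinearMap.proj k))
    (∑ k, map a i (LinearMap.single R (fun _ => R) k) ∘ₗ LinearMap.proj k)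
    (by
      ext k z l
      simp only [LinearMap.comp_apply, LinearMap.sum_apply, LinearMap.pi_apply,
        LinearMap.proj_apply, LinearMap.id_apply, LinearMap.single_apply]
      rw [_root_.map_sum, Finset.sum_eq_single k]
      · rw [Pi.single_eq_same, map_comp_apply]
        rcases eq_or_ne l k with rfl | h
        · rw [Pi.single_eq_same, LinearMap.proj_comp_single_same, map_id]
          rfl
        · rw [Pi.single_eq_of_ne h, LinearMap.proj_comp_single_ne _ _ _ _ h, map_zero]
          rfl
      · intro m _ hm
        rw [Pi.single_eq_of_ne hm, _root_.map_zero, _root_.map_zero]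
      · simp)
    (by
      ext z
      simp only [LinearMap.comp_apply, LinearMap.sum_apply, LinearMap.pi_apply,
        LinearMap.proj_apply, LinearMap.id_apply, map_comp_apply]
      rw [← LinearMap.sum_apply]
      have h : ∀ s : Finset (Fin n), ∑ k ∈ s, map a i
          (LinearMap.single R (fun _ : Fin n => R) k ∘ₗ LinearMap.proj k) =
          map a i (∑ k ∈ s, LinearMap.single R (fun _ : Fin n => R) k ∘ₗ LinearMap.proj k) := by
        intro s
        induction s using Finset.cons_induction with
        | empty => simp [map_zero]
        | cons k s hk ih => rw [Finset.sum_cons, Finset.sum_cons, map_add, ih]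
      rw [h]
      have h1 : ∑ k, LinearMap.single R (fun _ : Fin n => R) k ∘ₗ LinearMap.proj k =
          LinearMap.id := by
        ext x l
        simp
      rw [h1, map_id]
      rfl)

lemma piEquiv_apply (z : LC a i (Fin n → R)) (k : Fin n) :
    piEquiv a i n z k = map a i (LinearMap.proj k) z := rfl

lemma piEquiv_symm_apply (z : Fin n → LC a i R) :
    (piEquiv a i n).symm z = ∑ k, map a i (LinearMap.single R (fun _ => R) k) (z k) := by
  change (∑ k, map a i (LinearMap.single R (fun _ => R) k) ∘ₗ LinearMap.proj k :
    (Fin n → LC a i R) →ₗ[R] LC a i (Fin n → R)) z = _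
  rw [LinearMap.sum_apply]
  rfl

lemma piEquiv_map {m : ℕ} (κ : (Fin m → R) →ₗ[R] (Fin n → R)) (z : Fin m → LC a i R) (k : Fin n) :
    piEquiv a i n (map a i κ ((piEquiv a i m).symm z)) k =
      ∑ l, κ (Pi.single l 1) k • z l := by
  rw [piEquiv_symm_apply, _root_.map_sum, _root_.map_sum, Finset.sum_apply]
  refine Finset.sum_congr rfl fun l _ => ?_
  rw [piEquiv_apply, map_comp_apply, map_comp_apply]
  have h : (LinearMap.proj k ∘ₗ κ) ∘ₗ LinearMap.single R (fun _ => R) l =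
      κ (Pi.single l 1) k • (LinearMap.id : R →ₗ[R] R) := by
    ext
    simp
  rw [h, map_smul, map_id]
  rfl

/-- Right exactness of the top local cohomology, applied to a finite presentation. -/
lemma exists_presentation_of_finite [IsNoetherianRing R] {i : ℕ}
    (hd : ringKrullDim R = (i : WithBot ℕ∞)) (M : Type u) [AddCommGroup M] [Module R M]
    [Module.Finite R M] {T₁ T₀ : Type u} [AddCommGroup T₁] [Module R T₁] [AddCommGroup T₀]
    [Module R T₀] {φ : T₁ →ₗ[R] T₀} {ψ : T₀ →ₗ[R] LC a i R} (hφψ : Function.Exact φ ψ)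
    (hψ : Function.Surjective ψ) :
    ∃ (m n : ℕ) (Φ : ((Fin m → T₀) × (Fin n → T₁)) →ₗ[R] (Fin n → T₀))
      (Ψ : (Fin n → T₀) →ₗ[R] LC a i M), Function.Exact Φ Ψ ∧ Function.Surjective Ψ := by
  have hvan : ∀ (A : Type u) [AddCommGroup A] [Module R A] [Module.Finite R A],
      Subsingleton (LC a (i + 1) A) := fun A _ _ _ =>
    subsingleton_of_supportDim_lt a ((Module.supportDim_le_ringKrullDim R A).trans_lt
      (by rw [hd]; exact_mod_cast Nat.lt_succ_self i))
  obtain ⟨n, p, hp⟩ := Module.Finite.exists_fin' R M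
  obtain ⟨m, q, hq⟩ := Module.Finite.exists_fin' R (LinearMap.ker p)
  have hsp := IsSES.of_surjective p hp
  have hsq := IsSES.of_surjective q hq
  have hpS := map_surjective a hsp (hvan _)
  have hqS := map_surjective a hsq (hvan _)
  let κ := (LinearMap.ker p).subtype ∘ₗ q
  let κ' : (Fin m → T₀) →ₗ[R] (Fin n → T₀) :=
    LinearMap.pi fun k => ∑ l, κ (Pi.single l 1) k • LinearMap.proj l
  have hκ' : ∀ s k, κ' s k = ∑ l, κ (Pi.single l 1) k • s l := by
    intro s k
    simp [κ', LinearMap.sum_apply]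
  let Θ : (Fin n → T₀) →ₗ[R] LC a i (Fin n → R) :=
    (piEquiv a i n).symm.toLinearMap ∘ₗ ψ.compLeft (Fin n)
  have hΘ : ∀ s : Fin m → T₀,
      Θ (κ' s) = map a i κ ((piEquiv a i m).symm fun l => ψ (s l)) := by
    intro s
    apply (piEquiv a i n).injective
    ext k
    rw [piEquiv_map]
    refine (congrFun ((piEquiv a i n).apply_symm_apply _) k).trans ?_
    change ψ (κ' s k) = _
    rw [hκ', _root_.map_sum]
    exact Finset.sum_congr rfl fun l _ => _root_.map_smul _ _ _
  have hΘs : Function.Surjective Θ := by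
    intro z
    choose t ht using fun k => hψ (piEquiv a i n z k)
    refine ⟨t, ?_⟩
    apply (piEquiv a i n).injective
    refine ((piEquiv a i n).apply_symm_apply _).trans ?_
    ext k
    exact ht k
  have hΘ0 : ∀ t, Θ t = 0 ↔ ∃ u, φ.compLeft (Fin n) u = t := by
    intro t
    have h1 : Θ t = 0 ↔ ∀ k, ψ (t k) = 0 := by
      refine ((piEquiv a i n).symm.map_eq_zero_iff).trans ?_
      exact funext_iff
    rw [h1]
    constructor
    · intro h
      choose u hu using fun k => (hφψ _).1 (h k)
      exact ⟨u, funext hu⟩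
    · rintro ⟨u, rfl⟩ k
      exact (hφψ _).2 ⟨_, rfl⟩
  refine ⟨m, n, κ'.coprod (φ.compLeft (Fin n)), map a i p ∘ₗ Θ, fun t => ?_, hpS.comp hΘs⟩
  constructor
  · intro ht
    obtain ⟨y, hy⟩ := (exact_mid a i hsp (Θ t)).1 ht
    obtain ⟨z, rfl⟩ := hqS y
    choose s hs using fun l => hψ (piEquiv a i m z l)
    have h1 : Θ (κ' s) = Θ t := by
      rw [hΘ, ← hy, map_comp_apply]
      exact congrArg _ ((piEquiv a i m).symm_apply_eq.2 (funext hs))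
    obtain ⟨u, hu⟩ := (hΘ0 (t - κ' s)).1 (by rw [map_sub, h1, sub_self])
    refine ⟨(s, u), ?_⟩
    rw [LinearMap.coprod_apply, hu, add_sub_cancel]
  · rintro ⟨⟨s, u⟩, rfl⟩
    rw [LinearMap.coprod_apply, LinearMap.comp_apply, _root_.map_add, (hΘ0 _).2 ⟨u, rfl⟩, add_zero,
      hΘ, ← map_comp_apply]
    exact (exact_mid a i hsp _).2 ⟨_, rfl⟩

end
end LC

variable {C : Type u} [AddCommGroup C] [Module R C]

lemma Module.Injective.prod {J K : Type u} [AddCommGroup J] [Module R J] [AddCommGroup K]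
    [Module R K] (hJ : Module.Injective R J) (hK : Module.Injective R K) :
    Module.Injective R (J × K) where
  out X Y _ _ _ _ f hf g := by
    obtain ⟨h₁, hh₁⟩ := hJ.out f hf (LinearMap.fst R J K ∘ₗ g)
    obtain ⟨h₂, hh₂⟩ := hK.out f hf (LinearMap.snd R J K ∘ₗ g)
    exact ⟨h₁.prod h₂, fun x => Prod.ext (hh₁ x) (hh₂ x)⟩

lemma RightOrth.top_localCohomology [IsNoetherianRing R] [IsLocalRing R] {d : ℕ}
    (hd : ringKrullDim R = (d : WithBot ℕ∞)) (hd2 : d ≤ 2) (hC : Semidual R C)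
    (hCd : CoAcyclic R C d C) (M : Type u) [AddCommGroup M] [Module R M] [Module.Finite R M] :
    RightOrth R C (LC a d M) := by
  have := hC.finite
  obtain ⟨J₁, J₀, φ, ψ, h₁, h₀, hφψ, hψ⟩ := hCd.exists_presentation a
  let e : LC a d (C →ₗ[R] C) ≃ₗ[R] LC a d R :=
    LC.congr a d (LinearEquiv.ofBijective _ hC.bij).symm
  obtain ⟨m, n, Φ, Ψ, hΦΨ, hΨ⟩ := LC.exists_presentation_of_finite a hd M (φ := φ)
    (ψ := e.toLinearMap ∘ₗ ψ) (fun x => (e.map_eq_zero_iff).trans (hφψ x))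
    (e.surjective.comp hψ)
  have : IsArtinian R (LC a d M) := LC.isArtinian_top a
    ((Module.supportDim_le_ringKrullDim R M).trans_lt
      (by rw [hd]; exact_mod_cast Nat.lt_succ_self d))
  obtain ⟨E, hE, hcog⟩ := exists_injective_cogenerator R
  obtain ⟨ι, ρ, hρ⟩ := exists_retraction_double_dual (N := LC a d M) hE hcog
  let eP : ∀ (k : ℕ) (J : ModuleCat.{u} R), (Fin k → (C →ₗ[R] J)) ≃ₗ[R] (C →ₗ[R] (Fin k → J)) :=
    fun k J =>
    { toFun := LinearMap.pi
      invFun := fun f k => LinearMap.proj k ∘ₗ f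
      map_add' := fun _ _ => rfl
      map_smul' := fun _ _ => rfl
      left_inv := fun _ => rfl
      right_inv := fun _ => rfl }
  have hpi : ∀ (k : ℕ) (J : ModuleCat.{u} R), Module.Injective R J →
      Module.Injective R (Fin k → J) := fun k J hJ => Module.Injective.pi R fun _ => J
  exact .retract (fun J _ _ hJ i => hC.extVanish_double_dual hd2 hCd hE
    ((hpi m J₀ h₀).prod (hpi n J₁ h₁)) (hpi n J₀ h₀)
    (((eP m J₀).prodCongr (eP n J₁)) ≪≫ₗ LinearMap.prodEquiv R) (eP n J₀) hΦΨ hΨ hJ i) ι ρ hρ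

end

section
variable {R : Type u} [CommRing R]

namespace Resolved
variable {C N N' : Type u} [AddCommGroup C] [Module R C] [AddCommGroup N] [Module R N]
  [AddCommGroup N'] [Module R N']

lemma congr (e : N ≃ₗ[R] N') {n : ℕ} (h : Resolved R C n N) : Resolved R C n N' := by
  induction n generalizing N N' with
  | zero => trivial
  | succ n ih =>
    obtain ⟨I, p, hI, hp, h⟩ := h
    exact ⟨I, e.toLinearMap ∘ₗ p, hI, e.surjective.comp hp,
      ih (LinearEquiv.ofEq _ _ (LinearEquiv.ker_comp e p).symm) h⟩

lemma of_subsingleton [Subsingleton N] (n : ℕ) : Resolved R C n N := by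
  induction n generalizing N with
  | zero => trivial
  | succ n ih =>
    have hI : Module.Injective R (PUnit.{u + 1}) :=
      ⟨fun _ _ _ _ _ _ _ _ _ => ⟨0, fun _ => rfl⟩⟩
    refine ⟨ModuleCat.of R PUnit, 0, hI, fun z => ⟨0, Subsingleton.elim _ _⟩, ?_⟩
    have : Subsingleton (C →ₗ[R] ModuleCat.of R PUnit.{u + 1}) :=
      ⟨fun _ _ => LinearMap.ext fun _ => rfl⟩
    exact ih

lemma of_isCInjective {C N : ModuleCat.{u} R} (h : IsCInjective R C N) (n : ℕ) :
    Resolved R C n N := by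
  cases n with
  | zero => trivial
  | succ n =>
    obtain ⟨I, hI, ⟨e⟩⟩ := h
    refine ⟨I, e.symm.toLinearMap, hI, e.symm.surjective, ?_⟩
    rw [LinearEquiv.ker]
    exact .of_subsingleton n

lemma of_isGCInjective {C N : ModuleCat.{u} R} (h : IsGCInjective R C N) (n : ℕ) :
    Resolved R C n N := by
  obtain ⟨res, ⟨e⟩⟩ := h
  refine .congr e.symm ?_
  have key : ∀ i : ℤ, -1 ≤ i → Resolved R C n (LinearMap.ker (res.d i)) := by
    induction n with
    | zero => exact fun _ _ => trivial
    | succ n ih =>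
      intro i hi
      obtain ⟨I, hI, ⟨e⟩⟩ := res.cinj_pos (i + 1 + 1) (by omega)
      let q : res.Y (i + 1 + 1) →ₗ[R] LinearMap.ker (res.d i) :=
        (res.d (i + 1)).codRestrict _ fun y => (res.exact i _).2 ⟨y, rfl⟩
      have hq : Function.Surjective q := by
        rintro ⟨z, hz⟩
        obtain ⟨y, rfl⟩ := (res.exact i z).1 hz
        exact ⟨y, rfl⟩
      refine ⟨I, q ∘ₗ e.symm.toLinearMap, hI, hq.comp e.symm.surjective, ?_⟩
      let e' : LinearMap.ker (q ∘ₗ e.symm.toLinearMap) ≃ₗ[R] LinearMap.ker (res.d (i + 1)) :=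
        e.symm.ofSubmodules _ _ (by
          rw [LinearMap.ker_comp, Submodule.map_comap_eq_of_surjective e.symm.surjective]
          exact LinearMap.ker_codRestrict _ _ _)
      exact .congr e'.symm (ih (i + 1) (by omega))
  exact key _ le_rfl

end Resolved

lemma IsSemidualizing.semidual {C : ModuleCat.{u} R} (h : IsSemidualizing R C) :
    Semidual R C where
  finite := h.1
  bij := h.2.1
  ext i := by
    have := h.2.2 (i + 1) (by omega)
    exact (ExtBridge.equiv C C (i + 1)).symm.toEquiv.subsingleton

lemma ExtVanish.of_hasCoresDimLE {n : ℕ} {K : ModuleCat.{u} R}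
    (h : HasCoresDimLE R (fun N => Module.Injective R N) n K) {i : ℕ} (hi : n ≤ i)
    (N : Type u) [AddCommGroup N] [Module R N] : ExtVanish R (i + 1) N K := by
  induction n generalizing K i with
  | zero =>
    obtain h | h := h
    · exact .of_subsingleton_right
    · exact .of_injective i h
  | succ n ih =>
    obtain h | ⟨X, f, hX, hf, h⟩ := h
    · exact .of_subsingleton_right
    · obtain ⟨i, rfl⟩ : ∃ j, i = j + 1 := ⟨i - 1, by omega⟩
      exact .co_left (.of_injective f hf) (ih h (by omega)) (.of_injective _ hX)

lemma HasCoresDimLE.of_extVanish {n : ℕ} {K : ModuleCat.{u} R}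
    (h : ∀ (N : Type u) [AddCommGroup N] [Module R N], ExtVanish R (n + 1) N K) :
    HasCoresDimLE R (fun N => Module.Injective R N) n K := by
  induction n generalizing K with
  | zero => exact .inr (injective_of_extVanish fun I => h _)
  | succ n ih =>
    obtain ⟨X, f, hX, hf⟩ := exists_injective_embedding (R := R) K
    exact .inr ⟨X, f, hX, hf, ih fun N _ _ =>
      .co_right (.of_injective f hf) (.of_injective n hX) (h N)⟩

lemma injDim_ne_top_iff {K : ModuleCat.{u} R} :
    injDim R K ≠ ⊤ ↔ ∃ n, HasCoresDimLE R (fun N => Module.Injective R N) n K := by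
  constructor
  · intro h
    by_contra! hn
    refine h (sInf_eq_top.2 ?_)
    rintro _ ⟨n, -, h'⟩
    exact absurd h' (hn n)
  · rintro ⟨n, h⟩
    have hle : injDim R K ≤ n := sInf_le ⟨n, rfl, h⟩
    exact ne_top_of_le_ne_top (ENat.natCast_ne_top n) hle

section
variable [IsNoetherianRing R] [IsLocalRing R] {d : ℕ} {C : ModuleCat.{u} R}

lemma IsSemidualizing.isDualizing_of_resolved (hC : IsSemidualizing R C)
    (hd : ringKrullDim R = (d : WithBot ℕ∞)) (hd2 : d ≤ 2)
    (h : Resolved R C (d + 1)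
      ((localCohomology (IsLocalRing.maximalIdeal R) d).obj (ModuleCat.of R R))) :
    IsDualizing R C := by
  obtain ⟨e⟩ := LC.nonempty_equiv (IsLocalRing.maximalIdeal R) d (ModuleCat.of R R)
  refine ⟨hC, injDim_ne_top_iff.2 ⟨d, .of_extVanish fun N _ _ => .of_finite fun A _ _ _ => ?_⟩⟩
  exact hC.semidual.extVanish_of_resolved hd hd2 (h.congr e.symm) A le_rfl

lemma IsDualizing.coAcyclic (h : IsDualizing R C) (hd : ringKrullDim R = (d : WithBot ℕ∞)) :
    CoAcyclic R C d C ∧ ∀ j < d, Subsingleton (LC (IsLocalRing.maximalIdeal R) j C) := by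
  obtain ⟨n, hn⟩ := injDim_ne_top_iff.1 h.2
  have := h.1.1
  exact h.1.semidual.coAcyclic hd fun i hi N _ _ => .of_hasCoresDimLE hn hi N

lemma IsDualizing.isCInjective (h : IsDualizing R C) (hd : ringKrullDim R = (d : WithBot ℕ∞)) :
    IsCInjective R C
      ((localCohomology (IsLocalRing.maximalIdeal R) d).obj (ModuleCat.of R R)) := by
  have := h.1.1
  obtain ⟨hCd, hdepth⟩ := h.coAcyclic hd
  obtain ⟨hI, ⟨e⟩⟩ := hCd.injective_LC (IsLocalRing.maximalIdeal R) hdepth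
  obtain ⟨e'⟩ := LC.nonempty_equiv (IsLocalRing.maximalIdeal R) d (ModuleCat.of R R)
  exact ⟨ModuleCat.of R (LC (IsLocalRing.maximalIdeal R) d C), hI,
    ⟨e'.symm ≪≫ₗ LC.congr _ d (LinearEquiv.ofBijective _ h.1.2.1) ≪≫ₗ e⟩⟩

lemma IsDualizing.isGCInjective (h : IsDualizing R C) (hd : ringKrullDim R = (d : WithBot ℕ∞))
    (hd2 : d ≤ 2) (M : ModuleCat.{u} R) (hM : Module.Finite R M) (a : Ideal R) :
    IsGCInjective R C ((localCohomology a d).obj M) := by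
  have := h.1.1
  have hCd := (h.coAcyclic hd).1
  obtain ⟨e⟩ := LC.nonempty_equiv a d M
  refine RightOrth.isGCInjective h.1.semidual hCd
    (.retract (.top_localCohomology a hd hd2 h.1.semidual hCd M) e.symm.toLinearMap
      e.toLinearMap ?_)
  ext x
  exact e.apply_symm_apply x

end

end

end

noncomputable section
open CategoryTheory TensorProduct

/-- For a local ring of dimension `d ≤ 2` and a semidualizing module `C`:
`C` is dualizing iff `H_m^d(R)` is `C`-injective, iff `H_m^d(R)` is `G_C`-injective, iff
`H_a^d(M)` is `G_C`-injective for all finitely generated `M` and all ideals `a`. -/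
theorem stmt_11 (R : Type u) [CommRing R] [IsNoetherianRing R] [IsLocalRing R]
    (d : ℕ) (hdim : ringKrullDim R = (d : WithBot ℕ∞)) (hd2 : d ≤ 2)
    (C : ModuleCat.{u} R) (hC : IsSemidualizing R C) :
    (IsDualizing R C ↔ IsCInjective R C
      ((localCohomology (IsLocalRing.maximalIdeal R) d).obj (ModuleCat.of R R))) ∧
    (IsDualizing R C ↔ IsGCInjective R C
      ((localCohomology (IsLocalRing.maximalIdeal R) d).obj (ModuleCat.of R R))) ∧
    (IsDualizing R C ↔ ∀ M : ModuleCat.{u} R, Module.Finite R ↥M → ∀ a : Ideal R,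
      IsGCInjective R C ((localCohomology a d).obj M)) := by
  have hii : IsGCInjective R C
      ((localCohomology (IsLocalRing.maximalIdeal R) d).obj (ModuleCat.of R R)) →
      IsDualizing R C := fun h =>
    hC.isDualizing_of_resolved hdim hd2 (.of_isGCInjective h _)
  have hfin : Module.Finite R (ModuleCat.of R R) := inferInstanceAs (Module.Finite R R)
  exact ⟨⟨fun h => h.isCInjective hdim,
      fun h => hC.isDualizing_of_resolved hdim hd2 (.of_isCInjective h _)⟩,
    ⟨fun h => h.isGCInjective hdim hd2 _ hfin _, hii⟩,
    ⟨fun h => h.isGCInjective hdim hd2, fun h => hii (h _ hfin _)⟩⟩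

end
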